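/- There exists a constant C > 0 such that for every sufficiently large natural number k one has G̃(k) ≤ 2k² − 2^{2/3}·k^{4/3} + C·k. -/

import Mathlib

/-- e(z) = exp(2πiz). -/
noncomputable def ec (z : ℝ) : ℂ := Complex.exp (2 * Real.pi * Complex.I * z)

/-- R_{s,k}(n): the number of representations of n as a sum of s k-th powers of
positive integers. -/
noncomputable def Rcount (s k n : ℕ) : ℕ :=
  Set.ncard {x : Fin s → ℕ | (∀ i, 1 ≤ x i) ∧ ∑ i, (x i)^k = n}

/-- The singular series 𝔖_{s,k}(n). -/
noncomputable def singSeries (s k n : ℕ) : ℂ :=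
  ∑' q : ℕ, ∑ a ∈ (Finset.Icc 1 q).filter (fun a => Nat.Coprime a q),
    ((q:ℂ)⁻¹ * ∑ x ∈ Finset.Icc 1 q, ec ((a:ℝ) * (x:ℝ)^k / (q:ℝ)))^s *
      ec (-(n:ℝ) * (a:ℝ) / (q:ℝ))

/-- The anticipated asymptotic formula (9.2) in Waring's problem:
R_{s,k}(n) = Γ(1+1/k)^s Γ(s/k)⁻¹ 𝔖_{s,k}(n) n^{s/k-1} + o(n^{s/k-1}). -/
def AsympFormula (s k : ℕ) : Prop :=
  Asymptotics.IsLittleO Filter.atTop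
    (fun n : ℕ => (Rcount s k n : ℂ) -
      (((Real.Gamma (1 + 1/(k:ℝ)))^s / Real.Gamma ((s:ℝ)/(k:ℝ)) : ℝ) : ℂ) *
        singSeries s k n * (((n:ℝ) ^ ((s:ℝ)/(k:ℝ) - 1) : ℝ) : ℂ))
    (fun n : ℕ => (n:ℝ) ^ ((s:ℝ)/(k:ℝ) - 1))

namespace Waring

open Finset

section FiniteNorms

variable {Γ : Type*} [Fintype Γ]

/-- The weighted `L^r` norm of a nonnegative function on a finite set. -/
noncomputable def wnorm (r : ℕ) (w u : Γ → ℝ) : ℝ :=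
  (∑ α, w α * u α ^ r) ^ ((r : ℝ)⁻¹)

variable {r : ℕ} {w u v : Γ → ℝ}

lemma wsum_nonneg (hw : ∀ α, 0 ≤ w α) (hu : ∀ α, 0 ≤ u α) : 0 ≤ ∑ α, w α * u α ^ r :=
  sum_nonneg fun α _ => mul_nonneg (hw α) (pow_nonneg (hu α) r)

lemma wnorm_nonneg (hw : ∀ α, 0 ≤ w α) (hu : ∀ α, 0 ≤ u α) : 0 ≤ wnorm r w u :=
  Real.rpow_nonneg (wsum_nonneg hw hu) _

lemma wnorm_pow (hr : r ≠ 0) (hw : ∀ α, 0 ≤ w α) (hu : ∀ α, 0 ≤ u α) :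
    wnorm r w u ^ r = ∑ α, w α * u α ^ r :=
  Real.rpow_inv_natCast_pow (wsum_nonneg hw hu) hr

lemma wnorm_le_of_pow_le (hr : r ≠ 0) (hw : ∀ α, 0 ≤ w α) (hu : ∀ α, 0 ≤ u α) {c : ℝ}
    (hc : 0 ≤ c) (h : ∑ α, w α * u α ^ r ≤ c ^ r) : wnorm r w u ≤ c := by
  rw [← wnorm_pow hr hw hu] at h
  exact le_of_pow_le_pow_left₀ hr hc h

lemma wnorm_mono (hw : ∀ α, 0 ≤ w α) (hu : ∀ α, 0 ≤ u α)
    (h : ∀ α, u α ≤ v α) : wnorm r w u ≤ wnorm r w v := by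
  refine Real.rpow_le_rpow (wsum_nonneg hw hu) (sum_le_sum fun α _ => ?_) (by positivity)
  exact mul_le_mul_of_nonneg_left (pow_le_pow_left₀ (hu α) (h α) r) (hw α)

lemma wnorm_zero (hr : r ≠ 0) : wnorm r w (fun _ => 0) = 0 := by
  simp [wnorm, hr]

lemma wnorm_const_mul (hr : r ≠ 0) (hw : ∀ α, 0 ≤ w α) (hu : ∀ α, 0 ≤ u α) {c : ℝ} (hc : 0 ≤ c) :
    wnorm r w (fun α => c * u α) = c * wnorm r w u := by
  have h : ∑ α, w α * (c * u α) ^ r = c ^ r * ∑ α, w α * u α ^ r := by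
    rw [mul_sum]; exact sum_congr rfl fun α _ => by rw [mul_pow]; ring
  rw [wnorm, h, Real.mul_rpow (by positivity) (wsum_nonneg hw hu),
    Real.pow_rpow_inv_natCast hc hr, wnorm]

lemma wnorm_add_le (hr : r ≠ 0) (hw : ∀ α, 0 ≤ w α) (hu : ∀ α, 0 ≤ u α) (hv : ∀ α, 0 ≤ v α) :
    wnorm r w (fun α => u α + v α) ≤ wnorm r w u + wnorm r w v := by
  have hr1 : (1 : ℝ) ≤ r := by exact_mod_cast Nat.one_le_iff_ne_zero.2 hr
  have key : ∀ f : Γ → ℝ, (∀ α, 0 ≤ f α) →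
      (∑ α, |w α ^ ((r : ℝ)⁻¹) * f α| ^ (r : ℝ)) ^ (1 / (r : ℝ)) = wnorm r w f := by
    intro f hf
    rw [wnorm, one_div]
    congr 1
    refine sum_congr rfl fun α _ => ?_
    rw [abs_of_nonneg (mul_nonneg (Real.rpow_nonneg (hw α) _) (hf α)), Real.rpow_natCast, mul_pow,
      Real.rpow_inv_natCast_pow (hw α) hr]
  have := Real.Lp_add_le univ (fun α => w α ^ ((r : ℝ)⁻¹) * u α)
    (fun α => w α ^ ((r : ℝ)⁻¹) * v α) hr1
  simp only [← mul_add] at this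
  rwa [key _ hu, key _ hv, key (fun α => u α + v α) fun α => add_nonneg (hu α) (hv α)] at this

lemma wnorm_sum_le {ι : Type*} (s : Finset ι) {f : ι → Γ → ℝ} (hr : r ≠ 0) (hw : ∀ α, 0 ≤ w α)
    (hf : ∀ i α, 0 ≤ f i α) :
    wnorm r w (fun α => ∑ i ∈ s, f i α) ≤ ∑ i ∈ s, wnorm r w (f i) := by
  classical
  induction s using Finset.induction_on with
  | empty => simp [wnorm_zero hr]
  | insert i s hi ih =>
    simp only [sum_insert hi]
    exact (wnorm_add_le hr hw (hf i) fun α => sum_nonneg fun j _ => hf j α).trans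
      (add_le_add le_rfl ih)

/-- The squared `L^{2r}` norm of a sum of `card s` functions. -/
lemma wnorm_normSq_sum_le {ι : Type*} (s : Finset ι) {f : ι → Γ → ℂ} (hr : r ≠ 0)
    (hw : ∀ α, 0 ≤ w α) :
    wnorm r w (fun α => ‖∑ i ∈ s, f i α‖ ^ 2) ≤
      s.card * ∑ i ∈ s, wnorm r w (fun α => ‖f i α‖ ^ 2) := by
  calc wnorm r w (fun α => ‖∑ i ∈ s, f i α‖ ^ 2)
      ≤ wnorm r w (fun α => (s.card : ℝ) * ∑ i ∈ s, ‖f i α‖ ^ 2) := by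
        refine wnorm_mono hw (fun α => by positivity) fun α => ?_
        calc ‖∑ i ∈ s, f i α‖ ^ 2 ≤ (∑ i ∈ s, ‖f i α‖) ^ 2 := by
              gcongr; exact norm_sum_le _ _
          _ ≤ _ := sq_sum_le_card_mul_sum_sq
    _ = s.card * wnorm r w (fun α => ∑ i ∈ s, ‖f i α‖ ^ 2) :=
        wnorm_const_mul hr hw (fun α => by positivity) (by positivity)
    _ ≤ _ := by
        gcongr
        exact wnorm_sum_le s hr hw fun i α => by positivity

end FiniteNorms

end Waring

namespace Waring

open Finset

section Transfer

lemma card_mul_sum_comp {H Γ₁ : Type*} [AddCommGroup H] [Fintype H] [AddCommGroup Γ₁] [Fintype Γ₁]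
    (π : H →+ Γ₁) (hπ : Function.Surjective π) (G : Γ₁ → ℝ) :
    (Fintype.card Γ₁ : ℝ) * ∑ h, G (π h) = Fintype.card H * ∑ β, G β := by
  have h1 : ∑ β : Γ₁, ∑ h : H, G (β + π h) = Fintype.card Γ₁ * ∑ h, G (π h) := by
    have : ∀ β : Γ₁, ∑ h : H, G (β + π h) = ∑ h, G (π h) := by
      intro β
      obtain ⟨h', rfl⟩ := hπ β
      simp_rw [← map_add]
      exact Fintype.sum_equiv (Equiv.addLeft h') _ _ fun h => rfl
    simp [this]
  have h2 : ∑ h : H, ∑ β : Γ₁, G (β + π h) = Fintype.card H * ∑ β, G β := by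
    have : ∀ h : H, ∑ β : Γ₁, G (β + π h) = ∑ β, G β := fun h =>
      Fintype.sum_equiv (Equiv.addRight (π h)) _ _ fun _ => rfl
    simp [this]
  rw [← h1, ← h2, sum_comm]

variable {Γ : Type*} [AddCommGroup Γ]

/-- The exponential sum over the labels in `S`, with frequencies `χ (y x)`. -/
noncomputable def esum (χ : ℤ → AddChar Γ ℂ) (a : ℤ → ℂ) (y : ℤ → ℤ) (S : Finset ℤ) (α : Γ) : ℂ :=
  ∑ x ∈ S, a x * χ (y x) α

/-- The labels of `S` whose position lies in a given residue class. -/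
def cls (y : ℤ → ℤ) (S : Finset ℤ) (m : ℕ) (ρ : ZMod m) : Finset ℤ :=
  S.filter fun x => ((y x : ℤ) : ZMod m) = ρ

lemma esum_eq_sum_cls (χ : ℤ → AddChar Γ ℂ) (a : ℤ → ℂ) (y : ℤ → ℤ) (S : Finset ℤ) (m : ℕ)
    [NeZero m] (α : Γ) : esum χ a y S α = ∑ ρ : ZMod m, esum χ a y (cls y S m ρ) α :=
  (sum_fiberwise S (fun x => ((y x : ℤ) : ZMod m)) _).symm

lemma esum_add (χ : ℤ → AddChar Γ ℂ) (a : ℤ → ℂ) (y : ℤ → ℤ) (S : Finset ℤ) (α β : Γ) :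
    esum χ a y S (α + β) = ∑ x ∈ S, (a x * χ (y x) α) * χ (y x) β := by
  simp only [esum, AddChar.map_add_eq_mul, mul_assoc]

variable [Fintype Γ]

/-- The uniform probability weight. -/
noncomputable def unif (Γ : Type*) [Fintype Γ] : Γ → ℝ := fun _ => (Fintype.card Γ : ℝ)⁻¹

lemma unif_nonneg {Γ : Type*} [Fintype Γ] (α : Γ) : 0 ≤ unif Γ α := by unfold unif; positivity

/-- `ℓ²` decoupling in `L^{2r}` into residue classes modulo `m` with constant `D`. -/
def Decouples (χ : ℤ → AddChar Γ ℂ) (r m : ℕ) [NeZero m] (D : ℝ) : Prop :=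
  ∀ (S : Finset ℤ) (y : ℤ → ℤ) (a : ℤ → ℂ),
    wnorm r (unif Γ) (fun α => ‖esum χ a y S α‖ ^ 2) ≤
      D * ∑ ρ : ZMod m, wnorm r (unif Γ) (fun α => ‖esum χ a y (cls y S m ρ) α‖ ^ 2)

variable {H Γ₁ : Type*} [AddCommGroup H] [Fintype H] [AddCommGroup Γ₁] [Fintype Γ₁]

/-- Averaging over translates by the image of `i` reduces a mean value over `Γ` to one over `Γ₁`. -/
lemma wnorm_esum_eq {χ : ℤ → AddChar Γ ℂ} {χ' : ℤ → AddChar Γ₁ ℂ} (i : H →+ Γ) (π : H →+ Γ₁)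
    (hπ : Function.Surjective π) {r : ℕ} (hr : r ≠ 0) {w : Γ → ℝ}
    (hwi : ∀ α h, w (α + i h) = w α) {T : Finset ℤ} {y y' : ℤ → ℤ} (a : ℤ → ℂ) {c : H → ℂ}
    (hc : ∀ h, ‖c h‖ = 1) (hχ : ∀ x ∈ T, ∀ h, χ (y x) (i h) = c h * χ' (y' x) (π h)) :
    wnorm r w (fun α => ‖esum χ a y T α‖ ^ 2) = wnorm r w (fun α =>
      wnorm r (unif Γ₁) (fun β => ‖esum χ' (fun x => a x * χ (y x) α) y' T β‖ ^ 2)) := by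
  have hshift : ∀ α h, ‖esum χ a y T (α + i h)‖ =
      ‖esum χ' (fun x => a x * χ (y x) α) y' T (π h)‖ := by
    intro α h
    have : esum χ a y T (α + i h) = c h * esum χ' (fun x => a x * χ (y x) α) y' T (π h) := by
      rw [esum_add, esum, mul_sum]
      exact sum_congr rfl fun x hx => by rw [hχ x hx h]; ring
    rw [this, norm_mul, hc, one_mul]
  have hH : (Fintype.card H : ℝ) ≠ 0 := by positivity
  have hΓ : (Fintype.card Γ₁ : ℝ) ≠ 0 := by positivity
  unfold wnorm
  congr 1
  have e1 : (Fintype.card H : ℝ) * ∑ α, w α * (‖esum χ a y T α‖ ^ 2) ^ r =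
      ∑ h : H, ∑ α, w α * (‖esum χ a y T (α + i h)‖ ^ 2) ^ r := by
    have : ∀ h : H, ∑ α, w α * (‖esum χ a y T (α + i h)‖ ^ 2) ^ r =
        ∑ α, w α * (‖esum χ a y T α‖ ^ 2) ^ r := by
      intro h
      refine Fintype.sum_equiv (Equiv.addRight (i h)) _ _ fun α => ?_
      simp [hwi]
    simp [this]
  have e2 : ∀ α, ∑ h : H, w α * (‖esum χ a y T (α + i h)‖ ^ 2) ^ r = Fintype.card H *
      (w α * ∑ β, unif Γ₁ β * (‖esum χ' (fun x => a x * χ (y x) α) y' T β‖ ^ 2) ^ r) := by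
    intro α
    simp_rw [hshift]
    simp only [unif, ← mul_sum]
    have := card_mul_sum_comp π hπ
      (fun β => (‖esum χ' (fun x => a x * χ (y x) α) y' T β‖ ^ 2) ^ r)
    field_simp
    linear_combination w α * this
  rw [sum_comm, sum_congr rfl fun α _ => e2 α, ← mul_sum] at e1
  rw [mul_left_cancel₀ hH e1]
  refine sum_congr rfl fun α _ => ?_
  rw [Real.rpow_inv_natCast_pow _ hr]
  exact wsum_nonneg unif_nonneg fun β => by positivity

/-- Decoupling transfers along a pair of homomorphisms compatible with the characters. -/
lemma Decouples.transfer {χ : ℤ → AddChar Γ ℂ} {χ' : ℤ → AddChar Γ₁ ℂ} {r m : ℕ} [NeZero m]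
    {D : ℝ} (hD : Decouples χ' r m D) (hD0 : 0 ≤ D) (hr : r ≠ 0) (i : H →+ Γ) (π : H →+ Γ₁)
    (hπ : Function.Surjective π) {w : Γ → ℝ} (hw : ∀ α, 0 ≤ w α)
    (hwi : ∀ α h, w (α + i h) = w α) {S : Finset ℤ} {y y' : ℤ → ℤ} (a : ℤ → ℂ) {c : H → ℂ}
    (hc : ∀ h, ‖c h‖ = 1) (hχ : ∀ x ∈ S, ∀ h, χ (y x) (i h) = c h * χ' (y' x) (π h)) :
    wnorm r w (fun α => ‖esum χ a y S α‖ ^ 2) ≤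
      D * ∑ ρ : ZMod m, wnorm r w (fun α => ‖esum χ a y (cls y' S m ρ) α‖ ^ 2) := by
  have hsub : ∀ ρ : ZMod m, ∀ x ∈ cls y' S m ρ, ∀ h, χ (y x) (i h) = c h * χ' (y' x) (π h) :=
    fun ρ x hx => hχ x (mem_of_mem_filter x hx)
  rw [wnorm_esum_eq i π hπ hr hwi a hc hχ]
  simp_rw [fun ρ => wnorm_esum_eq i π hπ hr hwi a hc (hsub ρ)]
  have hn : ∀ (T : Finset ℤ) α, 0 ≤
      wnorm r (unif Γ₁) (fun β => ‖esum χ' (fun x => a x * χ (y x) α) y' T β‖ ^ 2) :=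
    fun T α => wnorm_nonneg unif_nonneg fun β => by positivity
  refine (wnorm_mono hw (hn S) fun α => hD S y' fun x => a x * χ (y x) α).trans ?_
  rw [wnorm_const_mul hr hw (fun α => sum_nonneg fun ρ _ => hn _ α) hD0]
  gcongr
  exact wnorm_sum_le univ hr hw fun ρ α => hn _ α

end Transfer

end Waring

namespace Waring

open Finset Polynomial

set_option linter.unusedSectionVars false

section MomentCurve

variable (p : ℕ) [hp : Fact p.Prime]

lemma exists_scaling_hom {M N : ℕ} (h : M ≤ N) : ∃ ι : ZMod (p ^ M) →+ ZMod (p ^ N),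
    ∀ z, ZMod.stdAddChar (ι z) = ZMod.stdAddChar z := by
  have hz : (zmultiplesHom (ZMod (p ^ N)) ((p : ZMod (p ^ N)) ^ (N - M))) ((p ^ M : ℕ) : ℤ) = 0 := by
    rw [zmultiplesHom_apply, natCast_zsmul, nsmul_eq_mul]
    push_cast
    rw [← pow_add, Nat.add_sub_cancel' h, ← Nat.cast_pow, ZMod.natCast_self]
  refine ⟨ZMod.lift (p ^ M) ⟨_, hz⟩, fun z => ?_⟩
  obtain ⟨n, rfl⟩ := ZMod.intCast_surjective z
  rw [ZMod.lift_coe]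
  have h1 : (zmultiplesHom (ZMod (p ^ N)) ((p : ZMod (p ^ N)) ^ (N - M))) n =
      ((n * (p : ℤ) ^ (N - M) : ℤ) : ZMod (p ^ N)) := by
    simp
  rw [h1, ZMod.stdAddChar_coe, ZMod.stdAddChar_coe]
  congr 1
  have hp0 : (p : ℂ) ≠ 0 := by exact_mod_cast hp.out.ne_zero
  have h2 : (p : ℂ) ^ N = (p : ℂ) ^ M * (p : ℂ) ^ (N - M) := by
    rw [← pow_add, Nat.add_sub_cancel' h]
  push_cast
  rw [h2]
  field_simp

lemma stdAddChar_pow_mul {M e : ℕ} (h : e ≤ M) (z : ZMod (p ^ M)) :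
    ZMod.stdAddChar ((p : ZMod (p ^ M)) ^ e * z) =
      ZMod.stdAddChar (ZMod.castHom (pow_dvd_pow p (Nat.sub_le M e)) (ZMod (p ^ (M - e))) z) := by
  obtain ⟨n, rfl⟩ := ZMod.intCast_surjective z
  have h1 : (p : ZMod (p ^ M)) ^ e * (n : ZMod (p ^ M)) = (((p : ℤ) ^ e * n : ℤ) : ZMod (p ^ M)) := by
    push_cast; rfl
  have h3 := map_intCast (ZMod.castHom (pow_dvd_pow p (Nat.sub_le M e)) (ZMod (p ^ (M - e)))) n
  rw [h1, h3, ZMod.stdAddChar_coe, ZMod.stdAddChar_coe]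
  congr 1
  have hp0 : (p : ℂ) ≠ 0 := by exact_mod_cast hp.out.ne_zero
  have h2 : (p : ℂ) ^ M = (p : ℂ) ^ e * (p : ℂ) ^ (M - e) := by
    rw [← pow_add, Nat.add_sub_cancel' h]
  push_cast
  rw [h2]
  field_simp

/-- The group of phases: polynomials of degree at most `k` with coefficients modulo `p ^ N`. -/
abbrev Phase (k N : ℕ) : Type := Fin (k + 1) → ZMod (p ^ N)

/-- The character of the phase group given by evaluation at `x`. -/
noncomputable def mchar (k N : ℕ) (x : ℤ) : AddChar (Phase p k N) ℂ :=
  (ZMod.stdAddChar (N := p ^ N)).compAddMonoidHom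
    (∑ m : Fin (k + 1), (AddMonoidHom.mulRight ((x : ZMod (p ^ N)) ^ (m : ℕ))).comp
      (Pi.evalAddMonoidHom _ m))

lemma mchar_apply (k N : ℕ) (x : ℤ) (α : Phase p k N) :
    mchar p k N x α = ZMod.stdAddChar (∑ m : Fin (k + 1), α m * (x : ZMod (p ^ N)) ^ (m : ℕ)) := by
  simp [mchar, AddChar.compAddMonoidHom_apply]

lemma exists_phase_hom {k l M N : ℕ} (h : M ≤ N) (G : Fin (l + 1) → (ZMod (p ^ M))[X])
    (hG : ∀ j, (G j).natDegree ≤ k) :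
    ∃ i : Phase p l M →+ Phase p k N, ∀ (x : ℤ) (b : Phase p l M),
      mchar p k N x (i b) = ZMod.stdAddChar (∑ j, b j * (G j).eval (x : ZMod (p ^ M))) := by
  obtain ⟨ι, hι⟩ := exists_scaling_hom p h
  let f : Phase p l M →+ Phase p k N := AddMonoidHom.pi fun m =>
    ι.comp (∑ j : Fin (l + 1), (AddMonoidHom.mulRight ((G j).coeff (m : ℕ))).comp
      (Pi.evalAddMonoidHom _ j))
  have hf : ∀ b m, f b m = ι (∑ j, b j * (G j).coeff (m : ℕ)) := by
    intro b m
    simp [f]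
  refine ⟨f, fun x b => ?_⟩
  rw [mchar_apply, ← hι]
  congr 1
  have h1 : ∀ (z : ZMod (p ^ M)) (n : ℕ), ι z * (x : ZMod (p ^ N)) ^ n =
      ι (z * (x : ZMod (p ^ M)) ^ n) := by
    intro z n
    have := map_zsmul ι (x ^ n) z
    simp only [zsmul_eq_mul, Int.cast_pow] at this
    rw [mul_comm, ← this, mul_comm]
  simp_rw [hf, h1]
  rw [← map_sum]
  congr 1
  simp_rw [sum_mul]
  rw [sum_comm]
  refine sum_congr rfl fun j _ => ?_
  rw [eval_eq_sum_range' (Nat.lt_succ_of_le (hG j)), mul_sum, ← Fin.sum_univ_eq_sum_range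
    (fun m => b j * ((G j).coeff m * (x : ZMod (p ^ M)) ^ m))]
  exact sum_congr rfl fun m _ => by ring

/-- Reduction of phases. -/
noncomputable def redHom (l : ℕ) {M' M : ℕ} (h : M' ≤ M) : Phase p l M →+ Phase p l M' :=
  AddMonoidHom.pi fun j =>
    ((ZMod.castHom (pow_dvd_pow p h) (ZMod (p ^ M'))).toAddMonoidHom).comp (Pi.evalAddMonoidHom _ j)

lemma redHom_surjective (l : ℕ) {M' M : ℕ} (h : M' ≤ M) :
    Function.Surjective (redHom p l h) := by
  intro b
  choose g hg using fun j => ZMod.castHom_surjective (pow_dvd_pow p h) (b j)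
  exact ⟨g, funext fun j => hg j⟩

lemma mchar_redHom {l M e : ℕ} (h : e ≤ M) (t : ℤ) (b : Phase p l M) :
    mchar p l (M - e) t (redHom p l (Nat.sub_le M e) b) =
      ZMod.stdAddChar (∑ j, b j * ((p : ZMod (p ^ M)) ^ e * (t : ZMod (p ^ M)) ^ (j : ℕ))) := by
  have h1 : ∑ j, b j * ((p : ZMod (p ^ M)) ^ e * (t : ZMod (p ^ M)) ^ (j : ℕ)) =
      (p : ZMod (p ^ M)) ^ e * ∑ j, b j * (t : ZMod (p ^ M)) ^ (j : ℕ) := by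
    rw [mul_sum]; exact sum_congr rfl fun j _ => by ring
  rw [h1, stdAddChar_pow_mul p h, mchar_apply]
  congr 1
  simp only [map_sum, map_mul, map_pow, map_intCast]
  rfl

end MomentCurve

end Waring

namespace Waring

open Finset Polynomial

section Interpolation

variable {A : Type*} [CommRing A]

lemma X_sub_C_pow_succ_dvd_of_derivative {k l : ℕ} (hk : ∀ i : ℕ, 1 ≤ i → i ≤ k → IsUnit (i : A))
    (hl : l ≤ k) {Q : A[X]} {t : A} (h : (X - C t) ^ l ∣ derivative Q) :
    (X - C t) ^ (l + 1) ∣ Q - C (Q.eval t) := by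
  rw [X_sub_C_pow_dvd_iff, X_pow_dvd_iff] at h ⊢
  have hd : (derivative Q).comp (X + C t) = derivative (Q.comp (X + C t)) := by
    rw [derivative_comp]; simp
  rw [hd] at h
  intro d hd'
  rcases d with _ | d
  · simp [coeff_zero_eq_eval_zero]
  · have := h d (by omega)
    rw [coeff_derivative] at this
    have hu := hk (d + 1) (by omega) (by omega)
    push_cast at hu
    have h0 := (hu.mul_left_eq_zero).1 this
    simp [h0]

lemma exists_antideriv {k : ℕ} (hk : ∀ i : ℕ, 1 ≤ i → i ≤ k → IsUnit (i : A)) {T : A[X]}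
    (hT : T.degree < k) : ∃ P : A[X], P.natDegree ≤ k ∧ derivative P = T := by
  refine ⟨∑ i ∈ range k, monomial (i + 1) (T.coeff i * Ring.inverse ((i + 1 : ℕ) : A)), ?_, ?_⟩
  · refine natDegree_sum_le_of_forall_le _ _ fun i hi => ?_
    exact (natDegree_monomial_le _).trans (by rw [mem_range] at hi; omega)
  · rw [derivative_sum]
    have : ∀ i ∈ range k, derivative (monomial (i + 1)
        (T.coeff i * Ring.inverse ((i + 1 : ℕ) : A))) = monomial i (T.coeff i) := by
      intro i hi
      rw [mem_range] at hi
      rw [derivative_monomial, mul_assoc, Nat.add_sub_cancel,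
        Ring.inverse_mul_cancel _ (hk (i + 1) (by omega) (by omega)), mul_one]
    rw [sum_congr rfl this]
    ext n
    simp only [finsetSum_coeff, coeff_monomial, sum_ite_eq', mem_range]
    split_ifs with hn
    · rfl
    · exact (coeff_eq_zero_of_degree_lt (hT.trans_le (by exact_mod_cast not_lt.1 hn))).symm

/-- A polynomial of degree at most `k` with prescribed Taylor expansion to order `l` at `x₀` which
is constant to order `k - l` at `ξ`. -/
lemma exists_interpolation {k l j : ℕ} (hk : ∀ i : ℕ, 1 ≤ i → i ≤ k → IsUnit (i : A))
    (hl : l ≤ k) (hj : j ≤ l) {x₀ ξ : A} (hu : IsUnit (x₀ - ξ)) :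
    ∃ P : A[X], P.natDegree ≤ k ∧ (X - C x₀) ^ (l + 1) ∣ P - (X - C x₀) ^ j ∧
      ∃ κ : A, (X - C ξ) ^ (k - l + 1) ∣ P - C κ := by
  nontriviality A
  rcases Nat.eq_zero_or_pos j with rfl | hj0
  · exact ⟨1, by simp, by simp, 1, by simp⟩
  have hcop : IsCoprime ((X - C ξ) ^ (k - l)) ((X - C x₀) ^ l) := by
    refine IsCoprime.pow ?_
    obtain ⟨v, hv⟩ := hu
    refine ⟨C (↑v⁻¹ : A), -C (↑v⁻¹ : A), ?_⟩
    have : C (↑v⁻¹ : A) * (X - C ξ) + -C (↑v⁻¹ : A) * (X - C x₀) = C (↑v⁻¹ * (x₀ - ξ)) := by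
      rw [C_mul, C_sub]; ring
    rw [this, ← hv, Units.inv_mul, C_1]
  obtain ⟨a, b, hab⟩ := hcop
  set m : A[X] := (X - C ξ) ^ (k - l) * (X - C x₀) ^ l with hm
  have hmon : m.Monic := ((monic_X_sub_C ξ).pow _).mul ((monic_X_sub_C x₀).pow _)
  have hdeg : m.degree = k := by
    rw [degree_eq_natDegree hmon.ne_zero, hm,
      ((monic_X_sub_C ξ).pow _).natDegree_mul ((monic_X_sub_C x₀).pow _),
      (monic_X_sub_C ξ).natDegree_pow, (monic_X_sub_C x₀).natDegree_pow, natDegree_X_sub_C,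
      natDegree_X_sub_C, mul_one, mul_one, Nat.sub_add_cancel hl]
  set z : A[X] := (j : A[X]) * (X - C x₀) ^ (j - 1) with hz
  set T₀ : A[X] := a * (X - C ξ) ^ (k - l) * z with hT₀
  have hTd : (T₀ %ₘ m).degree < k := hdeg ▸ degree_modByMonic_lt _ hmon
  obtain ⟨P, hPd, hP⟩ := exists_antideriv hk hTd
  have hmod : T₀ %ₘ m = T₀ - m * (T₀ /ₘ m) := modByMonic_eq_sub_mul_div T₀ m
  have h1 : (X - C ξ) ^ (k - l) ∣ derivative P := by
    rw [hP, hmod]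
    exact dvd_sub ⟨a * z, by rw [hT₀]; ring⟩
      (Dvd.dvd.mul_right (Dvd.intro _ rfl) _)
  have h2 : (X - C x₀) ^ l ∣ derivative (P - (X - C x₀) ^ j) := by
    rw [derivative_sub, hP, derivative_X_sub_C_pow, hmod]
    have : T₀ - m * (T₀ /ₘ m) - C (j : A) * (X - C x₀) ^ (j - 1) =
        (X - C x₀) ^ l * (-(b * z) - (X - C ξ) ^ (k - l) * (T₀ /ₘ m)) := by
      have : a * (X - C ξ) ^ (k - l) = 1 - b * (X - C x₀) ^ l := by rw [← hab]; ring
      rw [hT₀, this, hm, hz, C_eq_natCast]; ring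
    rw [this]
    exact Dvd.intro _ rfl
  have h3 := X_sub_C_pow_succ_dvd_of_derivative hk (Nat.sub_le k l) h1
  have h4 := X_sub_C_pow_succ_dvd_of_derivative hk hl h2
  set e : A := (P - (X - C x₀) ^ j).eval x₀
  refine ⟨P - C e, ?_, ?_, P.eval ξ - e, ?_⟩
  · exact (natDegree_sub_C (p := P)).le.trans hPd
  · convert h4 using 1; ring
  · convert h3 using 1; rw [C_sub]; ring

end Interpolation

end Waring

namespace Waring

open Finset Polynomial

set_option linter.unusedSectionVars false

section Classes

lemma cls_subset (y : ℤ → ℤ) (S : Finset ℤ) (m : ℕ) (ρ : ZMod m) : cls y S m ρ ⊆ S :=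
  filter_subset _ _

lemma mem_cls {y : ℤ → ℤ} {S : Finset ℤ} {m : ℕ} {ρ : ZMod m} {x : ℤ} :
    x ∈ cls y S m ρ ↔ x ∈ S ∧ ((y x : ℤ) : ZMod m) = ρ := mem_filter

lemma sum_fiber_eq_sum_image {B : Type*} [Fintype B] [DecidableEq B] (κ : ℤ → B) (S : Finset ℤ)
    {g : Finset ℤ → ℝ} (hg : g ∅ = 0) :
    ∑ ρ, g (S.filter fun x => κ x = ρ) =
      ∑ T ∈ S.image (fun x => S.filter fun z => κ z = κ x), g T := by
  have h1 : S.image (fun x => S.filter fun z => κ z = κ x) =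
      (S.image κ).image (fun ρ => S.filter fun z => κ z = ρ) := by
    rw [image_image]; rfl
  rw [h1, sum_image]
  · symm
    refine sum_subset (subset_univ _) fun ρ _ hρ => ?_
    have : S.filter (fun x => κ x = ρ) = ∅ :=
      filter_eq_empty_iff.2 fun {x} hx h => hρ (mem_image.2 ⟨x, hx, h⟩)
    rw [this, hg]
  · intro ρ hρ ρ' _ h
    obtain ⟨x, hx, rfl⟩ := mem_image.1 hρ
    have : x ∈ S.filter fun z => κ z = ρ' := by
      rw [← show _ = S.filter fun z => κ z = ρ' from h]; simp [mem_coe.1 hx]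
    exact (mem_filter.1 this).2

/-- Two labellings with the same fibres give the same sum over fibres. -/
lemma sum_cls_congr {m m' : ℕ} [NeZero m] [NeZero m'] {y y' : ℤ → ℤ} {S : Finset ℤ}
    {g : Finset ℤ → ℝ} (hg : g ∅ = 0)
    (h : ∀ x ∈ S, ∀ z ∈ S, ((y x : ℤ) : ZMod m) = y z ↔ ((y' x : ℤ) : ZMod m') = y' z) :
    ∑ ρ : ZMod m, g (cls y S m ρ) = ∑ ρ : ZMod m', g (cls y' S m' ρ) := by
  unfold cls
  rw [sum_fiber_eq_sum_image (fun x => ((y x : ℤ) : ZMod m)) S hg,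
    sum_fiber_eq_sum_image (fun x => ((y' x : ℤ) : ZMod m')) S hg]
  congr 1
  exact image_congr fun x hx => filter_congr fun z hz => h z hz x hx

lemma sum_cls_cls {m m' : ℕ} [NeZero m] [NeZero m'] (hm : m ∣ m') (y : ℤ → ℤ) (S : Finset ℤ)
    {g : Finset ℤ → ℝ} (hg : g ∅ = 0) :
    ∑ ρ : ZMod m, ∑ ρ' : ZMod m', g (cls y (cls y S m ρ) m' ρ') =
      ∑ ρ' : ZMod m', g (cls y S m' ρ') := by
  rw [sum_comm]
  refine sum_congr rfl fun ρ' _ => ?_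
  rw [sum_eq_single (ZMod.castHom hm (ZMod m) ρ')]
  · congr 1
    ext x
    simp only [mem_cls]
    constructor
    · rintro ⟨⟨h1, -⟩, h2⟩; exact ⟨h1, h2⟩
    · rintro ⟨h1, rfl⟩
      exact ⟨⟨h1, by simp⟩, rfl⟩
  · intro ρ _ hρ
    have : cls y (cls y S m ρ) m' ρ' = ∅ := by
      refine eq_empty_iff_forall_notMem.2 fun x hx => hρ ?_
      obtain ⟨hx1, rfl⟩ := mem_cls.1 hx
      rw [← (mem_cls.1 hx1).2]; simp
    rw [this, hg]
  · simp

/-- All the labels of `S` lie in the residue class of `ξ` modulo `m`. -/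
def InClass (y : ℤ → ℤ) (S : Finset ℤ) (m : ℕ) (ξ : ℤ) : Prop := ∀ x ∈ S, (m : ℤ) ∣ y x - ξ

lemma inClass_cls {y : ℤ → ℤ} {S : Finset ℤ} {m : ℕ} {ρ : ZMod m} {x : ℤ} (hx : x ∈ cls y S m ρ) :
    InClass y (cls y S m ρ) m (y x) := by
  intro z hz
  rw [← (ZMod.intCast_eq_intCast_iff_dvd_sub (y x) (y z) m), (mem_cls.1 hx).2, (mem_cls.1 hz).2]

lemma InClass.mono {y : ℤ → ℤ} {S T : Finset ℤ} {m m' : ℕ} {ξ : ℤ} (h : InClass y S m ξ)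
    (hm : m' ∣ m) (hT : T ⊆ S) : InClass y T m' ξ :=
  fun x hx => (Int.natCast_dvd_natCast.2 hm).trans (h x (hT hx))

end Classes

section Mass

variable {Γ : Type*} [AddCommGroup Γ] [Fintype Γ] (χ : ℤ → AddChar Γ ℂ)

@[simp] lemma esum_empty (a : ℤ → ℂ) (y : ℤ → ℤ) (α : Γ) : esum χ a y ∅ α = 0 := by simp [esum]

/-- The squared `L^{2r}` norm with weight `w` of the exponential sum over `S`. -/
noncomputable def wmass (r : ℕ) (w : Γ → ℝ) (a : ℤ → ℂ) (y : ℤ → ℤ) (S : Finset ℤ) : ℝ :=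
  wnorm r w fun α => ‖esum χ a y S α‖ ^ 2

variable {χ}

lemma wmass_nonneg {r : ℕ} {w : Γ → ℝ} (hw : ∀ α, 0 ≤ w α) (a : ℤ → ℂ) (y : ℤ → ℤ)
    (S : Finset ℤ) : 0 ≤ wmass χ r w a y S :=
  wnorm_nonneg hw fun _ => by positivity

lemma wmass_pow {r : ℕ} (hr : r ≠ 0) {w : Γ → ℝ} (hw : ∀ α, 0 ≤ w α) (a : ℤ → ℂ) (y : ℤ → ℤ)
    (S : Finset ℤ) : wmass χ r w a y S ^ r = ∑ α, w α * (‖esum χ a y S α‖ ^ 2) ^ r :=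
  wnorm_pow hr hw fun _ => by positivity

lemma wmass_empty {r : ℕ} (hr : r ≠ 0) (w : Γ → ℝ) (a : ℤ → ℂ) (y : ℤ → ℤ) :
    wmass χ r w a y ∅ = 0 := by
  simp [wmass, wnorm_zero hr, esum_empty]

/-- Decoupling with the trivial constant. -/
lemma wmass_le_card_mul {r : ℕ} (hr : r ≠ 0) {w : Γ → ℝ} (hw : ∀ α, 0 ≤ w α) (a : ℤ → ℂ)
    (y : ℤ → ℤ) (S : Finset ℤ) (m : ℕ) [NeZero m] :
    wmass χ r w a y S ≤ m * ∑ ρ : ZMod m, wmass χ r w a y (cls y S m ρ) := by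
  have := wnorm_normSq_sum_le (univ : Finset (ZMod m)) hr hw
    (f := fun ρ α => esum χ a y (cls y S m ρ) α)
  simp only [← esum_eq_sum_cls] at this
  simpa [wmass] using this

variable (χ) in
/-- The square function of the decomposition into residue classes modulo `m`. -/
noncomputable def sqf (r m : ℕ) [NeZero m] (a : ℤ → ℂ) (y : ℤ → ℤ) (S : Finset ℤ) : ℝ :=
  ∑ ρ : ZMod m, wmass χ r (unif Γ) a y (cls y S m ρ)

lemma sqf_nonneg {r m : ℕ} [NeZero m] (a : ℤ → ℂ) (y : ℤ → ℤ) (S : Finset ℤ) :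
    0 ≤ sqf χ r m a y S :=
  sum_nonneg fun _ _ => wmass_nonneg unif_nonneg _ _ _

lemma sqf_empty {r m : ℕ} [NeZero m] (hr : r ≠ 0) (a : ℤ → ℂ) (y : ℤ → ℤ) :
    sqf χ r m a y ∅ = 0 := by
  simp [sqf, cls, wmass_empty hr]

lemma sum_sqf_cls {r m m' : ℕ} [NeZero m] [NeZero m'] (hr : r ≠ 0) (hm : m ∣ m') (a : ℤ → ℂ)
    (y : ℤ → ℤ) (S : Finset ℤ) :
    ∑ ρ : ZMod m, sqf χ r m' a y (cls y S m ρ) = sqf χ r m' a y S :=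
  sum_cls_cls hm y S (g := fun T => wmass χ r (unif Γ) a y T) (wmass_empty hr _ _ _)

end Mass

section Steps

variable (p : ℕ) [hp : Fact p.Prime]

lemma mchar_redHom_of_add {l M M' e : ℕ} (h : M = M' + e) (t : ℤ) (b : Phase p l M) :
    mchar p l M' t (redHom p l (h ▸ Nat.le_add_right M' e) b) =
      ZMod.stdAddChar (∑ j, b j * ((p : ZMod (p ^ M)) ^ e * (t : ZMod (p ^ M)) ^ (j : ℕ))) := by
  obtain rfl : M' = M - e := by omega
  exact mchar_redHom p (by omega) t b

lemma pow_eq_zero_of_le {M N : ℕ} (h : M ≤ N) : (p : ZMod (p ^ M)) ^ N = 0 := by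
  rw [← Nat.cast_pow, ZMod.natCast_eq_zero_iff]
  exact pow_dvd_pow p h

lemma cls_iff_of_eq {m d : ℕ} {y y' : ℤ → ℤ} {ξ : ℤ} {x z : ℤ}
    (hx : y x = ξ + (p : ℤ) ^ m * y' x) (hz : y z = ξ + (p : ℤ) ^ m * y' z) :
    ((y' x : ℤ) : ZMod (p ^ d)) = y' z ↔ ((y x : ℤ) : ZMod (p ^ (m + d))) = y z := by
  rw [ZMod.intCast_eq_intCast_iff_dvd_sub, ZMod.intCast_eq_intCast_iff_dvd_sub, hx, hz]
  have h1 : ξ + (p : ℤ) ^ m * y' z - (ξ + (p : ℤ) ^ m * y' x) = (p : ℤ) ^ m * (y' z - y' x) := by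
    ring
  have hp0 : ((p : ℤ) ^ m) ≠ 0 := pow_ne_zero _ (by exact_mod_cast hp.out.ne_zero)
  rw [h1]
  push_cast
  rw [pow_add]
  exact (mul_dvd_mul_iff_left hp0).symm

/-- Affine rescaling: decoupling a residue class modulo `p ^ m` into classes modulo `p ^ (m + d)`
costs as much as decoupling everything into classes modulo `p ^ d`. -/
lemma wmass_rescale {k m d r : ℕ} (hr : r ≠ 0) {D : ℝ} (hD0 : 0 ≤ D)
    (hD : Decouples (mchar p k (k * d)) r (p ^ d) D) {y : ℤ → ℤ} {S : Finset ℤ} {ξ : ℤ}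
    (hS : InClass y S (p ^ m) ξ) (a : ℤ → ℂ) :
    wmass (mchar p k (k * (m + d))) r (unif _) a y S ≤
      D * sqf (mchar p k (k * (m + d))) r (p ^ (m + d)) a y S := by
  set y' : ℤ → ℤ := fun x => (y x - ξ) / (p : ℤ) ^ m with hy'
  have hy : ∀ x ∈ S, y x = ξ + (p : ℤ) ^ m * y' x := by
    intro x hx
    have := hS x hx
    push_cast at this
    rw [hy', Int.mul_ediv_cancel' this]; ring
  set G : Fin (k + 1) → (ZMod (p ^ (k * (m + d))))[X] := fun j =>
    C ((p : ZMod (p ^ (k * (m + d)))) ^ (m * (k - j))) * (X - C (ξ : ZMod _)) ^ (j : ℕ) with hG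
  have hdeg : ∀ j, (G j).natDegree ≤ k := by
    intro j
    refine (natDegree_C_mul_le _ _).trans ((natDegree_pow_le).trans ?_)
    have := natDegree_X_sub_C_le (ξ : ZMod (p ^ (k * (m + d))))
    have hj := j.is_le
    nlinarith
  obtain ⟨i, hi⟩ := exists_phase_hom p (le_refl (k * (m + d))) G hdeg
  have hM : k * (m + d) = k * d + m * k := by ring
  have := Decouples.transfer hD hD0 hr i (redHom p k (hM ▸ Nat.le_add_right (k * d) (m * k)))
    (redHom_surjective p k _) (w := unif _) unif_nonneg (fun _ _ => rfl) (S := S) (y := y) (y' := y')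
    a (c := fun _ => 1) (by simp) (by
      intro x hx h
      rw [one_mul, hi, mchar_redHom_of_add p hM]
      congr 1
      refine sum_congr rfl fun j _ => ?_
      congr 1
      simp only [hG, eval_mul, eval_C, eval_pow, eval_sub, eval_X, hy x hx]
      push_cast
      rw [add_sub_cancel_left, mul_pow, ← mul_assoc, ← pow_mul, ← pow_add, ← mul_add,
        Nat.sub_add_cancel j.is_le])
  refine this.trans_eq ?_
  congr 1
  exact sum_cls_congr (g := fun T => wmass _ r (unif _) a y T) (wmass_empty hr _ _ _)
    fun x hx z hz => cls_iff_of_eq p (hy x hx) (hy z hz)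

/-- Decoupling in lower degree `l`, in the presence of a weight supported by a transverse class. -/
lemma wmass_lower_step {k l b c d N r : ℕ} (hpk : k < p) (hl : l ≤ k) (hr : r ≠ 0) {D : ℝ}
    (hD0 : 0 ≤ D) (hD : Decouples (mchar p l (l * d)) r (p ^ d) D) {y : ℤ → ℤ} {S T : Finset ℤ}
    {ξ ξ' : ℤ} (hS : InClass y S (p ^ c) ξ) (hT : InClass y T (p ^ b) ξ')
    (hξ : ¬ (p : ℤ) ∣ ξ - ξ') (h1 : l * (c + d) ≤ (k - l + 1) * b)
    (h2 : l * (c + d) ≤ (l + 1) * c) (h3 : l * (c + d) ≤ N) (a : ℤ → ℂ) (g : ℕ) :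
    let w : Phase p k N → ℝ := fun α => unif _ α * (‖esum (mchar p k N) a y T α‖ ^ 2) ^ g
    wmass (mchar p k N) r w a y S ≤
      D * ∑ ρ : ZMod (p ^ (c + d)), wmass (mchar p k N) r w a y (cls y S (p ^ (c + d)) ρ) := by
  intro w
  set M := l * (c + d) with hMdef
  have hunit : ∀ z : ℤ, ¬ (p : ℤ) ∣ z → IsUnit (z : ZMod (p ^ M)) := by
    intro z hz
    rw [ZMod.coe_int_isUnit_iff_isCoprime]
    push_cast
    refine IsCoprime.pow_left ?_
    exact (Prime.coprime_iff_not_dvd (Nat.prime_iff_prime_int.1 hp.out)).2 hz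
  have hk : ∀ i, 1 ≤ i → i ≤ k → IsUnit (i : ZMod (p ^ M)) := by
    intro i h1 h2
    have := hunit i (by
      intro h
      have := Nat.le_of_dvd (by omega) (Int.natCast_dvd_natCast.1 h)
      omega)
    simpa using this
  have hu : IsUnit ((ξ : ZMod (p ^ M)) - (ξ' : ZMod (p ^ M))) := by
    have := hunit _ hξ
    push_cast at this
    exact this
  have hP := fun j : Fin (l + 1) => exists_interpolation hk hl (Nat.lt_succ_iff.1 j.2) hu
  choose P hPdeg hP1 κ hP2 using hP
  have hPS : ∀ j, ∀ t : ℤ, (P j).eval ((ξ + (p : ℤ) ^ c * t : ℤ) : ZMod (p ^ M)) =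
      (p : ZMod (p ^ M)) ^ (c * j) * (t : ZMod (p ^ M)) ^ (j : ℕ) := by
    intro j t
    obtain ⟨R, hR⟩ := hP1 j
    have h := congrArg (eval ((ξ + (p : ℤ) ^ c * t : ℤ) : ZMod (p ^ M))) hR
    simp only [eval_mul, eval_sub, eval_pow, eval_X, eval_C] at h
    push_cast at h ⊢
    rw [add_sub_cancel_left, mul_pow, mul_pow, ← pow_mul, ← pow_mul,
      pow_eq_zero_of_le p (show M ≤ c * (l + 1) by rw [mul_comm]; exact h2), zero_mul, zero_mul,
      sub_eq_zero] at h
    exact h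
  have hPT : ∀ j, ∀ t : ℤ, (P j).eval ((ξ' + (p : ℤ) ^ b * t : ℤ) : ZMod (p ^ M)) = κ j := by
    intro j t
    obtain ⟨R, hR⟩ := hP2 j
    have h := congrArg (eval ((ξ' + (p : ℤ) ^ b * t : ℤ) : ZMod (p ^ M))) hR
    simp only [eval_mul, eval_sub, eval_pow, eval_X, eval_C] at h
    push_cast at h ⊢
    rw [add_sub_cancel_left, mul_pow, ← pow_mul,
      pow_eq_zero_of_le p (show M ≤ b * (k - l + 1) by rw [mul_comm b]; exact h1), zero_mul,
      zero_mul, sub_eq_zero] at h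
    exact h
  obtain ⟨i, hi⟩ := exists_phase_hom p h3
    (fun j : Fin (l + 1) => C ((p : ZMod (p ^ M)) ^ (c * (l - j))) * P j)
    (fun j => (natDegree_C_mul_le _ _).trans (hPdeg j))
  have hdec : ∀ (U : Finset ℤ) (m : ℕ) (η : ℤ), InClass y U (p ^ m) η → ∀ x ∈ U,
      y x = η + (p : ℤ) ^ m * ((y x - η) / (p : ℤ) ^ m) := by
    intro U m η hU x hx
    have := hU x hx
    push_cast at this
    rw [Int.mul_ediv_cancel' this]; ring
  have hinv : ∀ α h, w (α + i h) = w α := by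
    intro α h
    have : esum (mchar p k N) a y T (α + i h) =
        ZMod.stdAddChar (∑ j, h j * ((p : ZMod (p ^ M)) ^ (c * (l - j)) * κ j)) *
          esum (mchar p k N) a y T α := by
      rw [esum_add, esum, mul_sum]
      refine sum_congr rfl fun x hx => ?_
      rw [hi]
      simp only [eval_mul, eval_C]
      rw [hdec T b ξ' hT x hx]
      simp only [hPT]
      ring
    simp only [w, this, norm_mul, AddChar.norm_apply, one_mul]
    rfl
  have hM : M = l * d + c * l := by rw [hMdef]; ring
  have := Decouples.transfer hD hD0 hr i (redHom p l (hM ▸ Nat.le_add_right (l * d) (c * l)))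
    (redHom_surjective p l _) (w := w) (fun α => mul_nonneg (unif_nonneg α) (by positivity)) hinv
    (S := S) (y := y) (y' := fun x => (y x - ξ) / (p : ℤ) ^ c)
    a (c := fun _ => 1) (by simp) (by
      intro x hx h
      rw [one_mul, hi, mchar_redHom_of_add p hM]
      congr 1
      refine sum_congr rfl fun j _ => ?_
      congr 1
      simp only [eval_mul, eval_C]
      conv_lhs => rw [hdec S c ξ hS x hx]
      rw [hPS, ← mul_assoc, ← pow_add, ← mul_add, Nat.sub_add_cancel j.is_le])
  refine this.trans_eq ?_
  congr 1
  exact sum_cls_congr (g := fun T => wmass _ r w a y T) (wmass_empty hr _ _ _)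
    fun x hx z hz => cls_iff_of_eq p (y' := fun x => (y x - ξ) / (p : ℤ) ^ c)
      (hdec S c ξ hS x hx) (hdec S c ξ hS z hz)

end Steps

end Waring

namespace Waring

open Finset Polynomial ComplexConjugate

set_option linter.unusedSectionVars false

/-- Half of the critical exponent `k * (k + 1)`. -/
def rr (k : ℕ) : ℕ := k * (k + 1) / 2

lemma two_mul_rr (k : ℕ) : 2 * rr k = k * (k + 1) :=
  Nat.mul_div_cancel' (Nat.even_mul_succ_self k).two_dvd

lemma rr_ne_zero {k : ℕ} (hk : 1 ≤ k) : rr k ≠ 0 := by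
  have := two_mul_rr k
  intro h
  rw [h] at this
  have : 0 < k * (k + 1) := by positivity
  omega

lemma rr_mono {l k : ℕ} (h : l ≤ k) : rr l ≤ rr k :=
  Nat.div_le_div_right (Nat.mul_le_mul h (by omega))

section Orthogonality

variable {Γ : Type*} [AddCommGroup Γ] [Fintype Γ] {χ : ℤ → AddChar Γ ℂ}

lemma sum_esum_mul_conj_eq_zero (a : ℤ → ℂ) (y : ℤ → ℤ) {S T : Finset ℤ}
    (h : ∀ x ∈ S, ∀ z ∈ T, χ (y x) ≠ χ (y z)) :
    ∑ α, esum χ a y S α * conj (esum χ a y T α) = 0 := by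
  have h1 : ∀ α, esum χ a y S α * conj (esum χ a y T α) =
      ∑ x ∈ S, ∑ z ∈ T, a x * conj (a z) * (χ (y x) - χ (y z)) α := by
    intro α
    simp only [esum, map_sum, sum_mul_sum, map_mul]
    refine sum_congr rfl fun x _ => sum_congr rfl fun z _ => ?_
    rw [AddChar.sub_apply', ← AddChar.map_neg_eq_conj, AddChar.map_neg_eq_inv]
    ring
  simp_rw [h1]
  rw [sum_comm]
  refine sum_eq_zero fun x hx => ?_
  rw [sum_comm]
  refine sum_eq_zero fun z hz => ?_
  rw [← mul_sum, AddChar.sum_eq_zero_iff_ne_zero.2 (sub_ne_zero.2 (h x hx z hz)), mul_zero]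

lemma Decouples.of_injective {m : ℕ} [NeZero m]
    (h : ∀ x z : ℤ, χ x = χ z → (x : ZMod m) = z) : Decouples χ 1 m 1 := by
  intro S y a
  simp only [wnorm, pow_one, Nat.cast_one, inv_one, Real.rpow_one, one_mul]
  rw [sum_comm]
  simp only [unif, ← mul_sum]
  refine mul_le_mul_of_nonneg_left (le_of_eq ?_) (by positivity)
  have h1 : ∀ T : Finset ℤ, ∀ α, ((‖esum χ a y T α‖ ^ 2 : ℝ) : ℂ) =
      esum χ a y T α * conj (esum χ a y T α) := by
    intro T α
    rw [Complex.mul_conj, Complex.normSq_eq_norm_sq]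
  have h2 : ∑ α, (((‖esum χ a y S α‖ ^ 2 : ℝ)) : ℂ) =
      ∑ ρ : ZMod m, ∑ α, ((‖esum χ a y (cls y S m ρ) α‖ ^ 2 : ℝ) : ℂ) := by
    simp_rw [h1]
    have h3 : ∀ α, esum χ a y S α * conj (esum χ a y S α) = ∑ ρ : ZMod m, ∑ ρ' : ZMod m,
        esum χ a y (cls y S m ρ) α * conj (esum χ a y (cls y S m ρ') α) := by
      intro α
      rw [esum_eq_sum_cls χ a y S m α, map_sum, sum_mul_sum]
    simp_rw [h3]
    rw [sum_comm]
    refine sum_congr rfl fun ρ _ => ?_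
    rw [sum_comm]
    refine sum_eq_single ρ (fun ρ' _ hne => ?_) (by simp)
    refine sum_esum_mul_conj_eq_zero a y fun x hx z hz hxz => hne ?_
    rw [← (mem_cls.1 hx).2, ← (mem_cls.1 hz).2, h _ _ hxz]
  rw [sum_comm]
  exact_mod_cast h2

end Orthogonality

section Chain

variable (p : ℕ) [hp : Fact p.Prime]

/-- Decoupling for the moment curve of degree `k` with exponent `Λ`. -/
def DecBound (k : ℕ) (Λ : ℝ) : Prop :=
  ∃ C : ℝ, 1 ≤ C ∧ ∀ n : ℕ,
    Decouples (mchar p k (k * n)) (rr k) (p ^ n) (C * (p : ℝ) ^ (Λ * n))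

lemma one_lt_p : (1 : ℝ) < p := by exact_mod_cast hp.out.one_lt

lemma DecBound.mono {k : ℕ} {Λ Λ' : ℝ} (h : DecBound p k Λ) (hΛ : Λ ≤ Λ') : DecBound p k Λ' := by
  obtain ⟨C, hC, h⟩ := h
  refine ⟨C, hC, fun n S y a => (h n S y a).trans ?_⟩
  have := one_lt_p p
  gcongr
  · exact sum_nonneg fun ρ _ => wnorm_nonneg unif_nonneg fun _ => by positivity
  · exact this.le

lemma decBound_one {Λ : ℝ} (hΛ : 0 ≤ Λ) : DecBound p 1 Λ := by
  refine DecBound.mono p (Λ := 0) ⟨1, le_rfl, fun n => ?_⟩ hΛ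
  have h1 : (1 : ℝ) * (p : ℝ) ^ ((0 : ℝ) * n) = 1 := by simp
  rw [h1, show rr 1 = 1 from rfl]
  refine Decouples.of_injective fun x z hxz => ?_
  have h2 := DFunLike.congr_fun hxz (fun m : Fin (1 + 1) => if m = 1 then 1 else 0)
  rw [mchar_apply, mchar_apply] at h2
  simp only [ite_mul, one_mul, zero_mul, sum_ite_eq', mem_univ, if_true] at h2
  have := ZMod.injective_stdAddChar h2
  rw [show n = 1 * n by simp]
  simpa using this

lemma decBound_trivial {k : ℕ} (hk : 1 ≤ k) : DecBound p k 1 := by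
  refine ⟨1, le_rfl, fun n S y a => ?_⟩
  have := wmass_le_card_mul (χ := mchar p k (k * n)) (rr_ne_zero hk) unif_nonneg a y S (p ^ n)
  simpa [wmass] using this

lemma wmass_lower_chain {k l : ℕ} (hl1 : 1 ≤ l) (hlk : l ≤ k) (hpk : k < p) {ε : ℝ} (hε : 0 < ε)
    (hB : DecBound p l ε) : ∃ C : ℝ, 1 ≤ C ∧ ∀ (c b N : ℕ) (S T : Finset ℤ) (y : ℤ → ℤ) (ξ ξ' : ℤ)
      (a : ℤ → ℂ) (g : ℕ), InClass y S p ξ → InClass y T (p ^ b) ξ' → ¬ (p : ℤ) ∣ ξ - ξ' →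
      l * c ≤ (k - l + 1) * b → l * c ≤ N →
      let w : Phase p k N → ℝ := fun α => unif _ α * (‖esum (mchar p k N) a y T α‖ ^ 2) ^ g
      wmass (mchar p k N) (rr l) w a y S ≤ C * (p : ℝ) ^ (2 * ε * c) *
        ∑ ρ : ZMod (p ^ c), wmass (mchar p k N) (rr l) w a y (cls y S (p ^ c) ρ) := by
  obtain ⟨A, hA1, hA⟩ := hB
  have hp1 := one_lt_p p
  have hp0 : (0 : ℝ) < p := by linarith
  obtain ⟨m, hm1, hm⟩ : ∃ m : ℕ, 1 ≤ m ∧ A ≤ (p : ℝ) ^ (ε * m) := by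
    obtain ⟨m, hm⟩ := pow_unbounded_of_one_lt A (Real.one_lt_rpow hp1 hε)
    refine ⟨m + 1, by omega, ?_⟩
    rw [Real.rpow_mul hp0.le, Real.rpow_natCast]
    exact hm.le.trans (pow_le_pow_right₀ (Real.one_le_rpow hp1.le hε.le) (by omega))
  have hr := rr_ne_zero hl1
  refine ⟨(p : ℝ) ^ ((l + 1) * m), one_le_pow₀ hp1.le, fun c => ?_⟩
  induction c using Nat.strong_induction_on with
  | _ c ih =>
    intro b N S T y ξ ξ' a g hS hT hξ h1 h2 w
    have hw : ∀ α, 0 ≤ w α := fun α => mul_nonneg (unif_nonneg α) (by positivity)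
    by_cases hc : c ≤ (l + 1) * m
    · refine (wmass_le_card_mul hr hw a y S (p ^ c)).trans ?_
      refine mul_le_mul_of_nonneg_right ?_ (sum_nonneg fun ρ _ => wmass_nonneg hw _ _ _)
      have e1 : (1 : ℝ) ≤ (p : ℝ) ^ (2 * ε * c) := Real.one_le_rpow hp1.le (by positivity)
      have e2 : ((p ^ c : ℕ) : ℝ) ≤ (p : ℝ) ^ ((l + 1) * m) := by
        push_cast
        exact pow_le_pow_right₀ hp1.le hc
      calc ((p ^ c : ℕ) : ℝ) ≤ (p : ℝ) ^ ((l + 1) * m) * 1 := by simpa using e2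
        _ ≤ _ := by gcongr
    · push Not at hc
      obtain ⟨d, hddef⟩ : ∃ d, d = c / (l + 1) := ⟨_, rfl⟩
      have hdle : (l + 1) * d ≤ c := hddef ▸ Nat.mul_div_le c (l + 1)
      have hmd : m ≤ d := hddef ▸ (Nat.le_div_iff_mul_le (by omega)).2 (by rw [mul_comm]; exact hc.le)
      have hdc : d ≤ c := by nlinarith
      obtain ⟨c1, rfl⟩ : ∃ c1, c = c1 + d := ⟨c - d, by omega⟩
      have hstep : l * (c1 + d) ≤ (l + 1) * c1 := by nlinarith
      have h3 : l * c1 ≤ l * (c1 + d) := by gcongr; omega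
      have hih := ih c1 (by omega) b N S T y ξ ξ' a g hS hT hξ (h3.trans h1) (h3.trans h2)
      refine hih.trans ?_
      have hAd : A * (p : ℝ) ^ (ε * d) ≤ (p : ℝ) ^ (2 * ε * d) := by
        have : A ≤ (p : ℝ) ^ (ε * d) := hm.trans (by gcongr; exact hp1.le)
        calc A * (p : ℝ) ^ (ε * d) ≤ (p : ℝ) ^ (ε * d) * (p : ℝ) ^ (ε * d) := by gcongr
          _ = _ := by rw [← Real.rpow_add hp0]; congr 1; ring
      have hρ : ∀ ρ : ZMod (p ^ c1), wmass (mchar p k N) (rr l) w a y (cls y S (p ^ c1) ρ) ≤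
          (p : ℝ) ^ (2 * ε * d) * ∑ ρ' : ZMod (p ^ (c1 + d)),
            wmass (mchar p k N) (rr l) w a y (cls y (cls y S (p ^ c1) ρ) (p ^ (c1 + d)) ρ') := by
        intro ρ
        have hnn : 0 ≤ ∑ ρ' : ZMod (p ^ (c1 + d)),
            wmass (mchar p k N) (rr l) w a y (cls y (cls y S (p ^ c1) ρ) (p ^ (c1 + d)) ρ') :=
          sum_nonneg fun ρ _ => wmass_nonneg hw _ _ _
        rcases (cls y S (p ^ c1) ρ).eq_empty_or_nonempty with he | ⟨x, hx⟩
        · rw [he] at hnn ⊢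
          rw [wmass_empty hr]
          positivity
        · refine (wmass_lower_step p hpk hlk hr (by positivity) (hA d) (inClass_cls hx) hT ?_ h1
            hstep h2 a g).trans ?_
          · intro h
            apply hξ
            have := (dvd_sub h (hS x (cls_subset _ _ _ _ hx)))
            simpa using this
          · exact mul_le_mul_of_nonneg_right hAd hnn
      calc _ ≤ (p : ℝ) ^ ((l + 1) * m) * (p : ℝ) ^ (2 * ε * c1) * ∑ ρ : ZMod (p ^ c1),
            ((p : ℝ) ^ (2 * ε * d) * ∑ ρ' : ZMod (p ^ (c1 + d)),
              wmass (mchar p k N) (rr l) w a y (cls y (cls y S (p ^ c1) ρ) (p ^ (c1 + d)) ρ')) := by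
            gcongr with ρ _
            exact hρ ρ
        _ = _ := by
            rw [← mul_sum, sum_cls_cls (pow_dvd_pow p (Nat.le_add_right c1 d)) y S
              (g := fun U => wmass (mchar p k N) (rr l) w a y U) (wmass_empty hr _ _ _)]
            push_cast
            rw [mul_add, Real.rpow_add hp0]
            ring

end Chain

end Waring

namespace Waring

open Finset

set_option linter.unusedSectionVars false

section Bilinear

variable (p : ℕ) [hp : Fact p.Prime]

/-- A bilinear mean value of the exponential sums over two sets of labels. -/
noncomputable def mixed (k n g h : ℕ) (a : ℤ → ℂ) (y : ℤ → ℤ) (S T : Finset ℤ) : ℝ :=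
  ∑ α : Phase p k (k * n), unif _ α * ((‖esum (mchar p k (k * n)) a y S α‖ ^ 2) ^ g *
    (‖esum (mchar p k (k * n)) a y T α‖ ^ 2) ^ h)

/-- The bilinear decoupling inequality with constant `B` for transverse classes modulo `p ^ u` and
`p ^ v`. -/
def BL (k n g h u v : ℕ) (B : ℝ) : Prop :=
  ∀ (S T : Finset ℤ) (y : ℤ → ℤ) (a : ℤ → ℂ) (ξ ξ' : ℤ), InClass y S (p ^ u) ξ →
    InClass y T (p ^ v) ξ' → ¬ (p : ℤ) ∣ ξ - ξ' →
    mixed p k n g h a y S T ≤ B * (sqf (mchar p k (k * n)) (rr k) (p ^ n) a y S ^ g *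
      sqf (mchar p k (k * n)) (rr k) (p ^ n) a y T ^ h)

variable {p}

lemma mixed_comm (k n g h : ℕ) (a : ℤ → ℂ) (y : ℤ → ℤ) (S T : Finset ℤ) :
    mixed p k n g h a y S T = mixed p k n h g a y T S :=
  sum_congr rfl fun α _ => by ring

lemma mixed_nonneg (k n g h : ℕ) (a : ℤ → ℂ) (y : ℤ → ℤ) (S T : Finset ℤ) :
    0 ≤ mixed p k n g h a y S T :=
  sum_nonneg fun α _ => mul_nonneg (unif_nonneg α) (by positivity)

lemma BL.symm {k n g h u v : ℕ} {B : ℝ} (H : BL p k n g h u v B) : BL p k n h g v u B := by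
  intro S T y a ξ ξ' hS hT hξ
  rw [mixed_comm, mul_comm (_ ^ h)]
  refine H T S y a ξ' ξ hT hS fun h => hξ ?_
  rw [← neg_sub]
  exact (dvd_neg).2 h

lemma BL.mono {k n g h u u' v : ℕ} {B B' : ℝ} (H : BL p k n g h u v B) (hu : u ≤ u')
    (hB : B ≤ B') : BL p k n g h u' v B' := by
  intro S T y a ξ ξ' hS hT hξ
  refine (H S T y a ξ ξ' (hS.mono (pow_dvd_pow p hu) subset_rfl) hT hξ).trans ?_
  have h1 := sqf_nonneg (χ := mchar p k (k * n)) (r := rr k) (m := p ^ n) a y S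
  have h2 := sqf_nonneg (χ := mchar p k (k * n)) (r := rr k) (m := p ^ n) a y T
  gcongr

lemma BL.zero {k v d : ℕ} (hk : 1 ≤ k) {D : ℝ} (hD0 : 0 ≤ D)
    (hD : Decouples (mchar p k (k * d)) (rr k) (p ^ d) D) :
    BL p k (v + d) 0 (rr k) 0 v (D ^ rr k) := by
  intro S T y a ξ ξ' hS hT hξ
  have h := wmass_rescale p (rr_ne_zero hk) hD0 hD hT a
  have h1 := pow_le_pow_left₀ (wmass_nonneg unif_nonneg _ _ _) h (rr k)
  rw [wmass_pow (rr_ne_zero hk) unif_nonneg, mul_pow] at h1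
  simpa [mixed] using h1

/-- Refining the first class. -/
lemma BL.refine_left {k n g h u u' v : ℕ} (hk : 1 ≤ k) (hg : g ≠ 0) (hn : u' ≤ n) (hu : 1 ≤ u)
    {B E : ℝ} (hB0 : 0 ≤ B) (hE0 : 0 ≤ E) (hE : ∀ (S T : Finset ℤ) (y : ℤ → ℤ) (a : ℤ → ℂ) (ξ ξ' : ℤ),
      InClass y S p ξ → InClass y T (p ^ v) ξ' → ¬ (p : ℤ) ∣ ξ - ξ' →
      let w : Phase p k (k * n) → ℝ :=
        fun α => unif _ α * (‖esum (mchar p k (k * n)) a y T α‖ ^ 2) ^ h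
      wmass (mchar p k (k * n)) g w a y S ≤ E *
        ∑ ρ : ZMod (p ^ u'), wmass (mchar p k (k * n)) g w a y (cls y S (p ^ u') ρ))
    (H : BL p k n g h u' v B) : BL p k n g h u v (E ^ g * B) := by
  intro S T y a ξ ξ' hS hT hξ
  have hSp : InClass y S p ξ := hS.mono (dvd_pow_self p (by omega)) subset_rfl
  have h1 := hE S T y a ξ ξ' hSp hT hξ
  set w : Phase p k (k * n) → ℝ :=
        fun α => unif _ α * (‖esum (mchar p k (k * n)) a y T α‖ ^ 2) ^ h with hwdef
  have hw : ∀ α, 0 ≤ w α := fun α => mul_nonneg (unif_nonneg α) (by positivity)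
  have hmix : ∀ U, mixed p k n g h a y U T = wmass (mchar p k (k * n)) g w a y U ^ g := by
    intro U
    rw [wmass_pow hg hw]
    exact sum_congr rfl fun α _ => by simp only [hwdef]; ring
  set QT := sqf (mchar p k (k * n)) (rr k) (p ^ n) a y T with hQT
  have hQT0 : 0 ≤ QT := sqf_nonneg _ _ _
  have hK0 : 0 ≤ B * QT ^ h := by positivity
  have hQ0 := fun U => sqf_nonneg (χ := mchar p k (k * n)) (r := rr k) (m := p ^ n) a y U
  obtain ⟨K, hK, hKg⟩ : ∃ K : ℝ, 0 ≤ K ∧ K ^ g = B * QT ^ h :=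
    ⟨(B * QT ^ h) ^ ((g : ℝ)⁻¹), by positivity, Real.rpow_inv_natCast_pow hK0 hg⟩
  have h2 : ∀ ρ : ZMod (p ^ u'), wmass (mchar p k (k * n)) g w a y (cls y S (p ^ u') ρ) ≤
      K * sqf (mchar p k (k * n)) (rr k) (p ^ n) a y (cls y S (p ^ u') ρ) := by
    intro ρ
    rcases (cls y S (p ^ u') ρ).eq_empty_or_nonempty with he | ⟨x, hx⟩
    · rw [he, wmass_empty hg, sqf_empty (rr_ne_zero hk), mul_zero]
    · have hx' : ¬ (p : ℤ) ∣ y x - ξ' := by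
        intro h
        have := (dvd_sub h (hSp x (cls_subset _ _ _ _ hx)))
        exact hξ (by simpa using this)
      have := H _ T y a (y x) ξ' (inClass_cls hx) hT hx'
      rw [hmix] at this
      refine le_of_pow_le_pow_left₀ hg (mul_nonneg hK (hQ0 _)) (this.trans_eq ?_)
      rw [mul_pow, hKg]; ring
  rw [hmix]
  calc _ ≤ (E * ∑ ρ : ZMod (p ^ u'), K *
        sqf (mchar p k (k * n)) (rr k) (p ^ n) a y (cls y S (p ^ u') ρ)) ^ g := by
        refine pow_le_pow_left₀ (wmass_nonneg hw _ _ _) (h1.trans ?_) g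
        gcongr with ρ _
        exact h2 ρ
    _ = _ := by
        rw [← mul_sum, sum_sqf_cls (rr_ne_zero hk) (pow_dvd_pow p hn), mul_pow, mul_pow, hKg]
        ring

lemma BL.refine_trivial {k n g h u v : ℕ} (hk : 1 ≤ k) (hg : g ≠ 0) (hn : u ≤ n)
    {B : ℝ} (hB0 : 0 ≤ B) (H : BL p k n g h u v B) :
    BL p k n g h 1 v (((p ^ u : ℕ) : ℝ) ^ g * B) :=
  H.refine_left hk hg hn le_rfl hB0 (by positivity) fun S T y a ξ ξ' _ _ _ =>
    wmass_le_card_mul hg (fun α => mul_nonneg (unif_nonneg α) (by positivity)) a y S (p ^ u)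

lemma BL.exists_refine_lower {k l : ℕ} (hl1 : 1 ≤ l) (hlk : l ≤ k) (hpk : k < p) {ε : ℝ}
    (hε : 0 < ε) (hB : DecBound p l ε) : ∃ C : ℝ, 1 ≤ C ∧ ∀ (n h u u' v : ℕ) (B : ℝ), 1 ≤ u →
      u' ≤ n → l * u' ≤ (k - l + 1) * v → l * u' ≤ k * n → 0 ≤ B → BL p k n (rr l) h u' v B →
      BL p k n (rr l) h u v ((C * (p : ℝ) ^ (2 * ε * u')) ^ rr l * B) := by
  obtain ⟨C, hC, H⟩ := wmass_lower_chain p hl1 hlk hpk hε hB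
  refine ⟨C, hC, fun n h u u' v B hu hn h1 h2 hB0 HB => ?_⟩
  exact HB.refine_left (by omega) (rr_ne_zero hl1) hn hu hB0 (by positivity)
    fun S T y a ξ ξ' hS hT hξ => H u' v (k * n) S T y ξ ξ' a h hS hT hξ h1 h2

lemma rpow_interp {x θ : ℝ} (hx : 0 ≤ x) {g g1 g2 : ℕ} (h0 : 0 ≤ θ) (h1 : θ ≤ 1)
    (hg : (g : ℝ) = (1 - θ) * g1 + θ * g2) : (x ^ g1) ^ (1 - θ) * (x ^ g2) ^ θ = x ^ g := by
  rw [← Real.rpow_natCast x g1, ← Real.rpow_natCast x g2, ← Real.rpow_natCast x g,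
    ← Real.rpow_mul hx, ← Real.rpow_mul hx, ← Real.rpow_add_of_nonneg hx, hg]
  · congr 1; ring
  · exact mul_nonneg (by positivity) (by linarith)
  · positivity

lemma sum_interp_le {ι : Type*} (s : Finset ι) {f g : ι → ℝ} (hf : ∀ i, 0 ≤ f i) (hg : ∀ i, 0 ≤ g i)
    {θ : ℝ} (h0 : 0 < θ) (h1 : θ < 1) :
    ∑ i ∈ s, f i ^ (1 - θ) * g i ^ θ ≤ (∑ i ∈ s, f i) ^ (1 - θ) * (∑ i ∈ s, g i) ^ θ := by
  have h1' : 0 < 1 - θ := by linarith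
  have hc : ((1 - θ)⁻¹).HolderConjugate θ⁻¹ := by
    rw [Real.holderConjugate_iff]
    refine ⟨(one_lt_inv₀ h1').2 (by linarith), by simp⟩
  have := Real.inner_le_Lp_mul_Lq_of_nonneg s hc (f := fun i => f i ^ (1 - θ))
    (g := fun i => g i ^ θ) (fun i _ => Real.rpow_nonneg (hf i) _)
    (fun i _ => Real.rpow_nonneg (hg i) _)
  simp only [one_div, inv_inv] at this
  simpa only [Real.rpow_rpow_inv (hf _) h1'.ne', Real.rpow_rpow_inv (hg _) h0.ne'] using this

lemma BL.holder {k n g h g1 h1 g2 h2 u v : ℕ} {B1 B2 θ : ℝ} (hθ0 : 0 < θ) (hθ1 : θ < 1)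
    (hg : (g : ℝ) = (1 - θ) * g1 + θ * g2) (hh : (h : ℝ) = (1 - θ) * h1 + θ * h2)
    (hB1 : 0 ≤ B1) (hB2 : 0 ≤ B2) (H1 : BL p k n g1 h1 u v B1) (H2 : BL p k n g2 h2 u v B2) :
    BL p k n g h u v (B1 ^ (1 - θ) * B2 ^ θ) := by
  intro S T y a ξ ξ' hS hT hξ
  have e1 := H1 S T y a ξ ξ' hS hT hξ
  have e2 := H2 S T y a ξ ξ' hS hT hξ
  have hθ1' : 0 ≤ 1 - θ := by linarith
  have hm : mixed p k n g h a y S T ≤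
      mixed p k n g1 h1 a y S T ^ (1 - θ) * mixed p k n g2 h2 a y S T ^ θ := by
    refine le_trans (le_of_eq ?_) (sum_interp_le _
      (fun α => mul_nonneg (unif_nonneg α) (by positivity))
      (fun α => mul_nonneg (unif_nonneg α) (by positivity)) hθ0 hθ1)
    refine sum_congr rfl fun α _ => ?_
    have hu := unif_nonneg α
    rw [Real.mul_rpow hu (by positivity), Real.mul_rpow hu (by positivity),
      Real.mul_rpow (by positivity) (by positivity), Real.mul_rpow (by positivity) (by positivity),
      ← rpow_interp (sq_nonneg ‖esum (mchar p k (k * n)) a y S α‖) hθ0.le hθ1.le hg,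
      ← rpow_interp (sq_nonneg ‖esum (mchar p k (k * n)) a y T α‖) hθ0.le hθ1.le hh]
    have hu1 : unif (Phase p k (k * n)) α = unif _ α ^ (1 - θ) * unif _ α ^ θ := by
      rw [← Real.rpow_add_of_nonneg hu hθ1' hθ0.le]; simp
    nth_rewrite 1 [hu1]
    ring
  refine hm.trans ?_
  have hQS := sqf_nonneg (χ := mchar p k (k * n)) (r := rr k) (m := p ^ n) a y S
  have hQT := sqf_nonneg (χ := mchar p k (k * n)) (r := rr k) (m := p ^ n) a y T
  rw [← rpow_interp hQS hθ0.le hθ1.le hg, ← rpow_interp hQT hθ0.le hθ1.le hh]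
  calc _ ≤ (B1 * (sqf (mchar p k (k * n)) (rr k) (p ^ n) a y S ^ g1 *
        sqf (mchar p k (k * n)) (rr k) (p ^ n) a y T ^ h1)) ^ (1 - θ) *
      (B2 * (sqf (mchar p k (k * n)) (rr k) (p ^ n) a y S ^ g2 *
        sqf (mchar p k (k * n)) (rr k) (p ^ n) a y T ^ h2)) ^ θ := by
        exact mul_le_mul (Real.rpow_le_rpow (mixed_nonneg k n g1 h1 a y S T) e1 hθ1')
          (Real.rpow_le_rpow (mixed_nonneg k n g2 h2 a y S T) e2 hθ0.le)
          (Real.rpow_nonneg (mixed_nonneg k n g2 h2 a y S T) _) (by positivity)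
    _ = _ := by
        rw [Real.mul_rpow hB1 (by positivity), Real.mul_rpow hB2 (by positivity),
          Real.mul_rpow (by positivity) (by positivity),
          Real.mul_rpow (by positivity) (by positivity)]
        ring

end Bilinear

end Waring

namespace Waring

open Finset

set_option linter.unusedSectionVars false

/-- The gains obtained after `T` rounds of the bilinear iteration. -/
noncomputable def gain (k : ℕ) : ℕ → ℕ → ℝ
  | 0, l => if l = 0 then 1 else 0
  | T + 1, l => if l = 0 then 1 else
      ((k : ℝ) - l) / (k - l + 1) * gain k T (l - 1) + gain k T (k - l) / l

lemma gain_zero (k T : ℕ) : gain k T 0 = 1 := by cases T <;> simp [gain]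

lemma sum_gain (k T : ℕ) :
    ∑ l ∈ range k, gain k.succ T (l + 1) = T * ((k : ℝ) / (k + 1)) := by
  induction T with
  | zero => simp [gain]
  | succ T ih =>
    simp only [gain, Nat.add_eq_zero_iff, one_ne_zero, and_false, if_false, Nat.add_sub_cancel,
      sum_add_distrib]
    have h1 : ∑ l ∈ range k, gain k.succ T (k.succ - (l + 1)) / ((l + 1 : ℕ) : ℝ) =
        ∑ l ∈ range k, gain k.succ T (l + 1) / ((k : ℝ) - l) := by
      rw [← sum_range_reflect]
      refine sum_congr rfl fun l hl => ?_
      have hl := mem_range.1 hl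
      rw [show k.succ - (k - 1 - l + 1) = l + 1 by omega,
        show k - 1 - l + 1 = k - l by omega, Nat.cast_sub hl.le]
    have h2 : ∑ l ∈ range k, ((k.succ : ℕ) - ((l + 1 : ℕ) : ℝ)) / ((k.succ : ℕ) - (l + 1 : ℕ) + 1) *
        gain k.succ T l = (k : ℝ) / (k + 1) +
        ∑ l ∈ range k, ((k : ℝ) - l - 1) / (k - l) * gain k.succ T (l + 1) := by
      have h3 := sum_range_succ' (fun l => ((k : ℝ) - l) / (k - l + 1) * gain k.succ T l) k
      rw [sum_range_succ] at h3
      simp only [sub_self, zero_div, zero_mul, add_zero, Nat.cast_zero, sub_zero, gain_zero,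
        mul_one] at h3
      have e : ∀ x y : ℝ, x + 1 - (y + 1) = x - y := fun x y => by ring
      have e' : ∀ x y : ℝ, x - (y + 1) = x - y - 1 := fun x y => by ring
      push_cast at h3 ⊢
      simp only [e, e', sub_add_cancel] at h3 ⊢
      rw [h3, add_comm]
    rw [h1, h2, add_assoc, ← sum_add_distrib]
    have h4 : ∀ l ∈ range k, ((k : ℝ) - l - 1) / (k - l) * gain k.succ T (l + 1) +
        gain k.succ T (l + 1) / ((k : ℝ) - l) = gain k.succ T (l + 1) := by
      intro l hl
      have : (0 : ℝ) < (k : ℝ) - l := sub_pos.2 (by exact_mod_cast mem_range.1 hl)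
      field_simp
      ring
    rw [sum_congr rfl h4, ih]
    push_cast
    ring

section Iteration

variable {p : ℕ} [hp : Fact p.Prime]

lemma pow_rpow_interp {r : ℕ} {C X1 X2 X θ : ℝ} (hC : 0 < C) (hX : X = (1 - θ) * X1 + θ * X2) :
    ((C * (p : ℝ) ^ X1) ^ r) ^ (1 - θ) * ((C * (p : ℝ) ^ X2) ^ r) ^ θ =
      (C * (p : ℝ) ^ X) ^ r := by
  have hp1 := one_lt_p p
  have hp0 : (0 : ℝ) < p := by linarith
  have e : ∀ (Y t : ℝ), ((C * (p : ℝ) ^ Y) ^ r) ^ t = ((C * (p : ℝ) ^ Y) ^ t) ^ r := by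
    intro Y t
    rw [← Real.rpow_natCast, ← Real.rpow_natCast, ← Real.rpow_mul (by positivity),
      ← Real.rpow_mul (by positivity), mul_comm (r : ℝ)]
  rw [e, e, ← mul_pow, Real.mul_rpow hC.le (by positivity), Real.mul_rpow hC.le (by positivity),
    ← Real.rpow_mul hp0.le, ← Real.rpow_mul hp0.le]
  congr 1
  rw [mul_mul_mul_comm, ← Real.rpow_add hC, ← Real.rpow_add hp0]
  congr 2
  · simp
  · rw [hX]; ring_nf

lemma pow_mul_rpow_mono {r : ℕ} {C C' X X' : ℝ} (h0 : 0 ≤ C) (hC : C ≤ C') (hX : X ≤ X') :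
    (C * (p : ℝ) ^ X) ^ r ≤ (C' * (p : ℝ) ^ X') ^ r :=
  pow_le_pow_left₀ (by positivity) (mul_le_mul hC
    (Real.rpow_le_rpow_of_exponent_le (one_lt_p p).le hX) (by positivity) (h0.trans hC)) _

lemma BL.of_decBound {k : ℕ} (hk : 1 ≤ k) {C Λ : ℝ} (hC : 1 ≤ C)
    (hD : ∀ n : ℕ, Decouples (mchar p k (k * n)) (rr k) (p ^ n) (C * (p : ℝ) ^ (Λ * n)))
    {n v : ℕ} (hv : v ≤ n) : BL p k n 0 (rr k) 0 v ((C * (p : ℝ) ^ (Λ * (n - v))) ^ rr k) := by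
  obtain ⟨d, rfl⟩ := Nat.exists_eq_add_of_le hv
  have := BL.zero (v := v) hk (by positivity) (hD d)
  convert this using 4
  push_cast
  ring_nf

lemma rr_lt {l k : ℕ} (h : l < k) : rr l < rr k := by
  have h1 := two_mul_rr l
  have h2 := two_mul_rr k
  nlinarith

/-- The bilinear iteration. -/
theorem BL.iterate {k : ℕ} (hk : 2 ≤ k) (hpk : k < p)
    (hlow : ∀ l, 1 ≤ l → l < k → ∀ ε : ℝ, 0 < ε → DecBound p l ε) {Λ : ℝ} (hΛ : 0 ≤ Λ)
    (hD : DecBound p k Λ) (T : ℕ) : ∀ ε : ℝ, 0 < ε → ∃ C : ℝ, 1 ≤ C ∧ ∀ n v : ℕ, 1 ≤ v →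
      k.factorial ^ (T + 1) ∣ v → k ^ (T + 1) * v ≤ n → ∀ l < k,
      BL p k n (rr l) (rr k - rr l) ((k - l + 1) * (v / l)) v
        ((C * (p : ℝ) ^ (Λ * (n - gain k T l * v) + ε * n)) ^ rr k) := by
  have hp1 := one_lt_p p
  have hp0 : (0 : ℝ) < p := by linarith
  obtain ⟨C0, hC0, hD0⟩ := hD
  have hzero : ∀ (C ε : ℝ) (n v T : ℕ), C0 ≤ C → 0 ≤ ε → v ≤ n →
      BL p k n (rr 0) (rr k - rr 0) 0 v
        ((C * (p : ℝ) ^ (Λ * (n - gain k T 0 * v) + ε * n)) ^ rr k) := by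
    intro C ε n v T hC hε hv
    refine (BL.of_decBound (by omega) hC0 hD0 hv).mono le_rfl ?_
    rw [gain_zero, one_mul]
    have : (0:ℝ) ≤ ε * n := by positivity
    exact pow_mul_rpow_mono (by linarith) hC (by linarith)
  have hdiv : ∀ l v, 1 ≤ l → (k - l + 1) * (v / l) ≤ k * v := fun l v hl => by
    gcongr
    · omega
    · exact Nat.div_le_self v l
  have hself : ∀ T v : ℕ, k * v ≤ k ^ (T + 1) * v := fun T v => by
    gcongr
    exact Nat.le_self_pow (by omega) k
  induction T with
  | zero =>
    intro ε hε
    refine ⟨C0, hC0, fun n v hv _ hvn l hl => ?_⟩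
    rw [zero_add, pow_one] at hvn
    rcases Nat.eq_zero_or_pos l with rfl | hl0
    · simpa using hzero C0 ε n v 0 le_rfl hε.le (by nlinarith)
    set u := (k - l + 1) * (v / l) with hu
    have hun : u ≤ n := (hdiv l v hl0).trans hvn
    have hvn' : v ≤ n := by nlinarith
    have H1 := (BL.of_decBound (by omega) hC0 hD0 hvn').mono (Nat.zero_le u) le_rfl
    have H2 := ((BL.of_decBound (by omega) hC0 hD0 hun).mono (Nat.zero_le v) le_rfl).symm
    have hrl : 0 < rr l := Nat.pos_of_ne_zero (rr_ne_zero hl0)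
    have hrk := rr_lt hl
    have hrk0 : (0 : ℝ) < rr k := by exact_mod_cast hrl.trans hrk
    have H := BL.holder (g := rr l) (h := rr k - rr l) (θ := (rr l : ℝ) / rr k) (by positivity)
      ((div_lt_one hrk0).2 (by exact_mod_cast hrk)) (by field_simp; simp)
      (by rw [Nat.cast_sub hrk.le]; field_simp; simp) (by positivity) (by positivity) H1 H2
    refine H.mono le_rfl ?_
    rw [pow_rpow_interp (by linarith) rfl]
    refine pow_mul_rpow_mono (by linarith) le_rfl ?_
    · have hθ1 : (rr l : ℝ) / rr k ≤ 1 := (div_le_one hrk0).2 (by exact_mod_cast hrk.le)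
      have hθ0 : 0 ≤ (rr l : ℝ) / rr k := by positivity
      simp only [gain, if_neg hl0.ne', zero_mul, sub_zero]
      have : 0 ≤ (1 - (rr l : ℝ) / rr k) * (Λ * v) := mul_nonneg (by linarith) (by positivity)
      have : 0 ≤ ((rr l : ℝ) / rr k) * (Λ * u) := by positivity
      have : 0 ≤ ε * n := by positivity
      nlinarith
  | succ T ih =>
    intro ε hε
    obtain ⟨C1, hC1, H⟩ := ih (ε / 2) (by positivity)
    have hch : ∀ l, ∃ C : ℝ, 1 ≤ C ∧ (1 ≤ l → l < k → ∀ (n h u u' v : ℕ) (B : ℝ), 1 ≤ u →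
        u' ≤ n → l * u' ≤ (k - l + 1) * v → l * u' ≤ k * n → 0 ≤ B → BL p k n (rr l) h u' v B →
        BL p k n (rr l) h u v ((C * (p : ℝ) ^ (2 * (ε / 4) * u')) ^ rr l * B)) := by
      intro l
      by_cases hl : 1 ≤ l ∧ l < k
      · obtain ⟨C, hC, h⟩ := BL.exists_refine_lower (p := p) hl.1 hl.2.le hpk
          (show 0 < ε / 4 by positivity) (hlow l hl.1 hl.2 (ε / 4) (by positivity))
        exact ⟨C, hC, fun _ _ => h⟩
      · exact ⟨1, le_rfl, fun h1 h2 => absurd ⟨h1, h2⟩ hl⟩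
    choose Cf hCf hf using hch
    set C2 : ℝ := ∑ l ∈ range k, Cf l with hC2
    have hCf2 : ∀ l < k, Cf l ≤ C2 := fun l hl =>
      single_le_sum (f := Cf) (fun i _ => by linarith [hCf i]) (mem_range.2 hl)
    have hC21 : 1 ≤ C2 := (hCf 0).trans (hCf2 0 (by omega))
    -- absorbing the loss from refinement
    have habs : ∀ (l n u' : ℕ) (X : ℝ), l < k → u' ≤ n →
        (Cf l * (p : ℝ) ^ (2 * (ε / 4) * u')) ^ rr l *
          (C1 * (p : ℝ) ^ (X + ε / 2 * n)) ^ rr k ≤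
        (C0 * C1 * C2 * (p : ℝ) ^ (X + ε * n)) ^ rr k := by
      intro l n u' X hl hu
      have h1 : Cf l * (p : ℝ) ^ (2 * (ε / 4) * u') ≤ C2 * (p : ℝ) ^ (ε / 2 * n) := by
        have := hCf2 l hl
        have h0 := hCf l
        gcongr
        · exact hp1.le
        · linarith
      have h2 : 1 ≤ C2 * (p : ℝ) ^ (ε / 2 * n) :=
        one_le_mul_of_one_le_of_one_le hC21 (Real.one_le_rpow hp1.le (by positivity))
      have h0 := hCf l
      calc _ ≤ (C2 * (p : ℝ) ^ (ε / 2 * n)) ^ rr k * (C1 * (p : ℝ) ^ (X + ε / 2 * n)) ^ rr k := by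
            gcongr
            exact (pow_le_pow_left₀ (by positivity) h1 _).trans
              (pow_le_pow_right₀ h2 (rr_mono hl.le))
        _ = (1 * C1 * C2 * (p : ℝ) ^ (X + ε * n)) ^ rr k := by
            rw [← mul_pow]
            congr 1
            rw [show X + ε * n = ε / 2 * n + (X + ε / 2 * n) by ring,
              Real.rpow_add hp0 (ε / 2 * n)]
            ring
        _ ≤ _ := by gcongr
    refine ⟨C0 * C1 * C2, one_le_mul_of_one_le_of_one_le (one_le_mul_of_one_le_of_one_le hC0 hC1)
      hC21, fun n v hv hdvd hvn l hl => ?_⟩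
    have hkn : k * v ≤ n := (hself _ v).trans hvn
    have hvn' : v ≤ n := by nlinarith
    rcases Nat.eq_zero_or_pos l with rfl | hl0
    · simpa using hzero (C0 * C1 * C2) ε n v (T + 1) (by
        have := one_le_mul_of_one_le_of_one_le hC1 hC21
        rw [mul_assoc]; nlinarith) hε.le hvn'
    have hldvd : l ∣ k.factorial := Nat.dvd_factorial hl0 hl.le
    obtain ⟨t, ht⟩ : ∃ t, v = l * t := (hldvd.trans (dvd_pow_self _ (by omega))).trans hdvd
    have hvl : v / l = t := by rw [ht, Nat.mul_div_cancel_left _ hl0]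
    have htdvd : k.factorial ^ (T + 1) ∣ t := by
      obtain ⟨m, hm⟩ := hldvd
      refine Nat.dvd_of_mul_dvd_mul_left hl0 ?_
      rw [← ht]
      refine dvd_trans ?_ hdvd
      rw [pow_succ _ (T + 1), mul_comm]
      exact mul_dvd_mul_left _ ⟨m, hm⟩
    have ht0 : 1 ≤ t := by
      rcases Nat.eq_zero_or_pos t with h | h
      · subst h; omega
      · exact h
    set u := (k - l + 1) * (v / l) with hu
    have hu1 : 1 ≤ u := by rw [hu, hvl]; nlinarith
    have hukv : u ≤ k * v := hdiv l v hl0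
    have hun : u ≤ n := hukv.trans hkn
    have hkun : k ^ (T + 1) * u ≤ n := by
      calc k ^ (T + 1) * u ≤ k ^ (T + 1) * (k * v) := by gcongr
        _ = k ^ (T + 1 + 1) * v := by ring
        _ ≤ n := hvn
    have hkun' : k * u ≤ n := (hself T u).trans hkun
    have hkTv : k ^ (T + 1) * v ≤ n := by
      refine le_trans ?_ hvn
      gcongr <;> omega
    have hudvd : k.factorial ^ (T + 1) ∣ u := by rw [hu, hvl]; exact htdvd.mul_left _
    have hvdvd : k.factorial ^ (T + 1) ∣ v := by rw [ht]; exact htdvd.mul_left _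
    set C := C0 * C1 * C2
    have hCpos : 0 < C := by positivity
    have H1 : BL p k n (rr (l - 1)) (rr k - rr (l - 1)) u v
        ((C * (p : ℝ) ^ (Λ * (n - gain k T (l - 1) * v) + ε * n)) ^ rr k) := by
      rcases Nat.eq_zero_or_pos (l - 1) with h0 | h0
      · rw [h0]
        refine (hzero C ε n v T ?_ hε.le hvn').mono (Nat.zero_le _) le_rfl
        have := one_le_mul_of_one_le_of_one_le hC1 hC21
        simp only [C]
        rw [mul_assoc]; nlinarith
      · have hm : (l - 1) * (v / (l - 1)) ≤ v := Nat.mul_div_le v (l - 1)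
        have hle : (l - 1) * ((k - (l - 1) + 1) * (v / (l - 1))) ≤ (k - (l - 1) + 1) * v := by
          rw [mul_left_comm]; gcongr
        refine (hf (l - 1) h0 (by omega) n (rr k - rr (l - 1)) u _ v _ hu1
          ((hdiv (l - 1) v h0).trans hkn) hle (hle.trans ?_) (by positivity)
          (H n v hv hvdvd hkTv (l - 1) (by omega))).mono le_rfl
          (habs _ _ _ _ (by omega) ((hdiv (l - 1) v h0).trans hkn))
        have : k - (l - 1) + 1 ≤ k := by omega
        gcongr
    have H2 : BL p k n (rr (k - l)) (rr k - rr (k - l)) v u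
        ((C * (p : ℝ) ^ (Λ * (n - gain k T (k - l) * u) + ε * n)) ^ rr k) := by
      have h0 : 1 ≤ k - l := by omega
      have hm : (k - l) * (u / (k - l)) ≤ u := Nat.mul_div_le u (k - l)
      have hle : (k - l) * ((k - (k - l) + 1) * (u / (k - l))) ≤ (k - (k - l) + 1) * u := by
        rw [mul_left_comm]; gcongr
      refine (hf (k - l) h0 (by omega) n (rr k - rr (k - l)) v _ u _ hv
        ((hdiv (k - l) u h0).trans hkun') hle (hle.trans ?_) (by positivity)
        (H n u hu1 hudvd hkun (k - l) (by omega))).mono le_rfl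
        (habs _ _ _ _ (by omega) ((hdiv (k - l) u h0).trans hkun'))
      have : k - (k - l) + 1 ≤ k := by omega
      gcongr
    have hkl : (0 : ℝ) < (k : ℝ) - l := sub_pos.2 (by exact_mod_cast hl)
    have hr : ∀ m : ℕ, (rr m : ℝ) = m * (m + 1) / 2 := by
      intro m
      have := two_mul_rr m
      have h : (2 : ℝ) * rr m = m * (m + 1) := by exact_mod_cast this
      linarith
    have hl1 : ((l - 1 : ℕ) : ℝ) = l - 1 := by push_cast [hl0]; ring
    have hkl1 : ((k - l : ℕ) : ℝ) = k - l := by push_cast [hl.le]; ring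
    have hlpos : (0 : ℝ) < l := by exact_mod_cast hl0
    have HH := BL.holder (g := rr l) (h := rr k - rr l) (θ := 1 / ((k : ℝ) - l + 1)) (by positivity)
      ((div_lt_one (by linarith)).2 (by linarith))
      (by
        rw [Nat.cast_sub (rr_mono (by omega)), hr, hr, hr, hr, hl1, hkl1]
        field_simp; ring)
      (by
        rw [Nat.cast_sub (rr_mono (by omega)), Nat.cast_sub (rr_mono (by omega)), hr, hr, hr, hr,
          hl1, hkl1]
        field_simp; ring) (by positivity) (by positivity) H1 H2.symm
    refine HH.mono le_rfl (le_of_eq ?_)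
    refine pow_rpow_interp hCpos ?_
    have hur : (u : ℝ) = ((k : ℝ) - l + 1) * (v / l) := by
      rw [hu, hvl, ht]
      push_cast [hl.le]
      field_simp
    simp only [gain, if_neg hl0.ne']
    rw [hur]
    field_simp
    ring

end Iteration

end Waring

namespace Waring

open Finset

set_option linter.unusedSectionVars false

/-- A broad-narrow dichotomy. -/
lemma sum_pow_le_narrow_add_broad {ι : Type*} [Fintype ι] [DecidableEq ι] [Nonempty ι] {u : ι → ℝ}
    (hu : ∀ i, 0 ≤ u i) {η : ℝ} (hη : 0 < η) (g h : ℕ) :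
    (∑ i, u i) ^ (2 * (g + h)) ≤ (1 + η) ^ (2 * (g + h)) * ∑ i, u i ^ (2 * (g + h)) +
      (Fintype.card ι : ℝ) ^ (2 * (g + h)) * (Fintype.card ι / η) ^ (2 * h) *
        ∑ i, ∑ j ∈ univ.erase i, u i ^ (2 * g) * u j ^ (2 * h) := by
  obtain ⟨m, -, hm⟩ := exists_max_image (univ : Finset ι) u univ_nonempty
  set P : ℝ := ((Fintype.card ι : ℕ) : ℝ) with hP
  have hP0 : 0 < P := by rw [hP]; exact_mod_cast Fintype.card_pos
  have hum := hu m
  by_cases hcase : ∀ i, i ≠ m → u i ≤ η / P * u m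
  · have h1 : ∑ i, u i ≤ (1 + η) * u m := by
      rw [← add_sum_erase univ u (mem_univ m)]
      have : ∑ i ∈ univ.erase m, u i ≤ ∑ i : ι, η / P * u m :=
        (sum_le_sum fun i hi => hcase i (ne_of_mem_erase hi)).trans
          (sum_le_sum_of_subset_of_nonneg (erase_subset _ _) fun _ _ _ => by positivity)
      rw [sum_const, card_univ, nsmul_eq_mul] at this
      have e : P * (η / P * u m) = η * u m := by field_simp
      linarith [e]
    have h2 : u m ^ (2 * (g + h)) ≤ ∑ i, u i ^ (2 * (g + h)) :=
      single_le_sum (f := fun i => u i ^ (2 * (g + h))) (fun i _ => pow_nonneg (hu i) _)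
        (mem_univ m)
    have h3 : 0 ≤ P ^ (2 * (g + h)) * (P / η) ^ (2 * h) *
        ∑ i, ∑ j ∈ univ.erase i, u i ^ (2 * g) * u j ^ (2 * h) :=
      mul_nonneg (by positivity) (sum_nonneg fun i _ => sum_nonneg fun j _ =>
        mul_nonneg (pow_nonneg (hu i) _) (pow_nonneg (hu j) _))
    calc _ ≤ ((1 + η) * u m) ^ (2 * (g + h)) :=
          pow_le_pow_left₀ (sum_nonneg fun i _ => hu i) h1 _
      _ = (1 + η) ^ (2 * (g + h)) * u m ^ (2 * (g + h)) := mul_pow _ _ _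
      _ ≤ (1 + η) ^ (2 * (g + h)) * ∑ i, u i ^ (2 * (g + h)) := by gcongr
      _ ≤ _ := by linarith
  · push Not at hcase
    obtain ⟨j, hjm, hj⟩ := hcase
    have h1 : ∑ i, u i ≤ P * u m := by
      have := sum_le_card_nsmul univ u (u m) fun i hi => hm i hi
      simpa [hP] using this
    have h2 : u m ≤ P / η * u j := by
      have : P / η * (η / P * u m) ≤ P / η * u j := by gcongr
      have e : P / η * (η / P * u m) = u m := by field_simp
      linarith
    have h3 : u m ^ (2 * g) * u j ^ (2 * h) ≤
        ∑ i, ∑ j ∈ univ.erase i, u i ^ (2 * g) * u j ^ (2 * h) := by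
      have hnn : ∀ i j, 0 ≤ u i ^ (2 * g) * u j ^ (2 * h) := fun i j =>
        mul_nonneg (pow_nonneg (hu i) _) (pow_nonneg (hu j) _)
      refine le_trans ?_ (single_le_sum (f := fun i => ∑ j ∈ univ.erase i,
        u i ^ (2 * g) * u j ^ (2 * h)) (fun i _ => sum_nonneg fun j _ => hnn i j) (mem_univ m))
      exact single_le_sum (f := fun j => u m ^ (2 * g) * u j ^ (2 * h)) (fun j _ => hnn m j)
        (mem_erase.2 ⟨hjm, mem_univ j⟩)
    have h4 : 0 ≤ (1 + η) ^ (2 * (g + h)) * ∑ i, u i ^ (2 * (g + h)) :=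
      mul_nonneg (by positivity) (sum_nonneg fun i _ => pow_nonneg (hu i) _)
    calc _ ≤ (P * u m) ^ (2 * (g + h)) := pow_le_pow_left₀ (sum_nonneg fun i _ => hu i) h1 _
      _ = P ^ (2 * (g + h)) * (u m ^ (2 * g) * u m ^ (2 * h)) := by
          rw [mul_pow, mul_add 2 g h, pow_add (u m)]
      _ ≤ P ^ (2 * (g + h)) * (u m ^ (2 * g) * (P / η * u j) ^ (2 * h)) := by gcongr
      _ = P ^ (2 * (g + h)) * (P / η) ^ (2 * h) * (u m ^ (2 * g) * u j ^ (2 * h)) := by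
          rw [mul_pow (P / η)]; ring
      _ ≤ P ^ (2 * (g + h)) * (P / η) ^ (2 * h) *
          ∑ i, ∑ j ∈ univ.erase i, u i ^ (2 * g) * u j ^ (2 * h) := by gcongr
      _ ≤ _ := by linarith

lemma sum_pow_le_sum_pow {ι : Type*} [Fintype ι] {u : ι → ℝ} (hu : ∀ i, 0 ≤ u i) {r : ℕ}
    (hr : r ≠ 0) : ∑ i, u i ^ r ≤ (∑ i, u i) ^ r := by
  obtain ⟨r, rfl⟩ := Nat.exists_eq_succ_of_ne_zero hr
  rw [pow_succ', sum_mul]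
  refine sum_le_sum fun i _ => ?_
  rw [pow_succ']
  exact mul_le_mul_of_nonneg_left (pow_le_pow_left₀ (hu i)
    (single_le_sum (fun j _ => hu j) (mem_univ i)) r) (hu i)

section Descent

variable {p : ℕ} [hp : Fact p.Prime]

lemma Decouples.succ {k d g h : ℕ} (hk : 1 ≤ k) (hgh : g + h = rr k) (hg : g ≠ 0) (hh : h ≠ 0)
    {D D' B η : ℝ} (hη : 0 < η) (hD'0 : 0 ≤ D') (hD0 : 0 ≤ D) (hB0 : 0 ≤ B)
    (hD' : Decouples (mchar p k (k * d)) (rr k) (p ^ d) D') (HB : BL p k (1 + d) g h 1 1 B)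
    (hD : (1 + η) ^ (2 * rr k) * D' ^ rr k +
      (p : ℝ) ^ (2 * rr k) * (p / η) ^ (2 * h) * ((p : ℝ) ^ 2 * B) ≤ D ^ rr k) :
    Decouples (mchar p k (k * (1 + d))) (rr k) (p ^ (1 + d)) D := by
  intro S y a
  have hr := rr_ne_zero hk
  change wmass _ (rr k) (unif _) a y S ≤ D * sqf _ (rr k) (p ^ (1 + d)) a y S
  set χ := mchar p k (k * (1 + d)) with hχ
  have hQ := fun U => sqf_nonneg (χ := χ) (r := rr k) (m := p ^ (1 + d)) a y U
  have hsum : ∑ ρ : ZMod p, sqf χ (rr k) (p ^ (1 + d)) a y (cls y S p ρ) =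
      sqf χ (rr k) (p ^ (1 + d)) a y S := sum_sqf_cls hr (dvd_pow_self p (by omega)) a y S
  set Q := sqf χ (rr k) (p ^ (1 + d)) a y S with hQdef
  have hQle : ∀ ρ : ZMod p, sqf χ (rr k) (p ^ (1 + d)) a y (cls y S p ρ) ≤ Q := fun ρ => by
    rw [← hsum]
    exact single_le_sum (f := fun ρ => sqf χ (rr k) (p ^ (1 + d)) a y (cls y S p ρ))
      (fun _ _ => hQ _) (mem_univ ρ)
  have hmass : ∀ ρ : ZMod p, wmass χ (rr k) (unif _) a y (cls y S p ρ) ≤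
      D' * sqf χ (rr k) (p ^ (1 + d)) a y (cls y S p ρ) := by
    intro ρ
    rcases (cls y S p ρ).eq_empty_or_nonempty with he | ⟨x, hx⟩
    · rw [he, wmass_empty hr, sqf_empty hr, mul_zero]
    · exact wmass_rescale p hr hD'0 hD' (m := 1) (ξ := y x) (by simpa using inClass_cls hx) a
  have hmix : ∀ ρ ρ' : ZMod p, ρ' ≠ ρ →
      mixed p k (1 + d) g h a y (cls y S p ρ) (cls y S p ρ') ≤ B * Q ^ rr k := by
    intro ρ ρ' hne
    have hBQ : 0 ≤ B * Q ^ rr k := mul_nonneg hB0 (pow_nonneg (hQ S) _)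
    rcases (cls y S p ρ).eq_empty_or_nonempty with he | ⟨x, hx⟩
    · rw [he]; simpa [mixed, hg] using hBQ
    rcases (cls y S p ρ').eq_empty_or_nonempty with he | ⟨x', hx'⟩
    · rw [he]; simpa [mixed, hh] using hBQ
    refine (HB _ _ y a (y x) (y x') (by simpa using inClass_cls hx) (by simpa using inClass_cls hx')
      ?_).trans ?_
    · intro hdvd
      apply hne
      rw [← (mem_cls.1 hx).2, ← (mem_cls.1 hx').2]
      exact (ZMod.intCast_eq_intCast_iff_dvd_sub _ _ p).2 hdvd
    · have e : Q ^ rr k = Q ^ g * Q ^ h := by rw [← pow_add, hgh]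
      rw [e]
      have h1 := hQle ρ
      have h2 := hQle ρ'
      have h3 := hQ (cls y S p ρ)
      have h4 := hQ (cls y S p ρ')
      have h5 := hQ S
      gcongr
  refine le_of_pow_le_pow_left₀ hr (mul_nonneg hD0 (hQ S)) ?_
  rw [wmass_pow hr unif_nonneg, mul_pow]
  have hpt : ∀ α, (‖esum χ a y S α‖ ^ 2) ^ rr k ≤
      (1 + η) ^ (2 * rr k) * ∑ ρ : ZMod p, (‖esum χ a y (cls y S p ρ) α‖ ^ 2) ^ rr k +
      (p : ℝ) ^ (2 * rr k) * (p / η) ^ (2 * h) * ∑ ρ : ZMod p, ∑ ρ' ∈ univ.erase ρ,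
        (‖esum χ a y (cls y S p ρ) α‖ ^ 2) ^ g * (‖esum χ a y (cls y S p ρ') α‖ ^ 2) ^ h := by
    intro α
    have h1 : ‖esum χ a y S α‖ ≤ ∑ ρ : ZMod p, ‖esum χ a y (cls y S p ρ) α‖ := by
      rw [esum_eq_sum_cls χ a y S p α]
      exact norm_sum_le _ _
    have h2 := sum_pow_le_narrow_add_broad (ι := ZMod p)
      (u := fun ρ => ‖esum χ a y (cls y S p ρ) α‖) (fun _ => norm_nonneg _) hη g h
    rw [ZMod.card, hgh] at h2
    simp only [← pow_mul]
    exact (pow_le_pow_left₀ (norm_nonneg _) h1 _).trans h2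
  calc ∑ α, unif _ α * (‖esum χ a y S α‖ ^ 2) ^ rr k
      ≤ ∑ α, unif _ α * ((1 + η) ^ (2 * rr k) *
          ∑ ρ : ZMod p, (‖esum χ a y (cls y S p ρ) α‖ ^ 2) ^ rr k +
        (p : ℝ) ^ (2 * rr k) * (p / η) ^ (2 * h) * ∑ ρ : ZMod p, ∑ ρ' ∈ univ.erase ρ,
          (‖esum χ a y (cls y S p ρ) α‖ ^ 2) ^ g *
            (‖esum χ a y (cls y S p ρ') α‖ ^ 2) ^ h) := by
        gcongr with α _
        · exact unif_nonneg α
        · exact hpt α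
    _ = (1 + η) ^ (2 * rr k) * ∑ ρ : ZMod p, wmass χ (rr k) (unif _) a y (cls y S p ρ) ^ rr k +
        (p : ℝ) ^ (2 * rr k) * (p / η) ^ (2 * h) * ∑ ρ : ZMod p, ∑ ρ' ∈ univ.erase ρ,
          mixed p k (1 + d) g h a y (cls y S p ρ) (cls y S p ρ') := by
        simp only [wmass_pow hr unif_nonneg, mixed, mul_add, sum_add_distrib]
        congr 1
        · rw [sum_comm]
          simp only [mul_sum]
          exact sum_congr rfl fun α _ => sum_congr rfl fun ρ _ => by ring
        · rw [sum_congr rfl fun ρ _ => sum_comm, sum_comm]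
          simp only [mul_sum]
          exact sum_congr rfl fun α _ => sum_congr rfl fun ρ _ => sum_congr rfl fun ρ' _ => by ring
    _ ≤ (1 + η) ^ (2 * rr k) * (D' ^ rr k * Q ^ rr k) +
        (p : ℝ) ^ (2 * rr k) * (p / η) ^ (2 * h) * ((p : ℝ) ^ 2 * (B * Q ^ rr k)) := by
        gcongr
        · calc ∑ ρ : ZMod p, wmass χ (rr k) (unif _) a y (cls y S p ρ) ^ rr k
              ≤ ∑ ρ : ZMod p, (D' * sqf χ (rr k) (p ^ (1 + d)) a y (cls y S p ρ)) ^ rr k :=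
                sum_le_sum fun ρ _ => pow_le_pow_left₀ (wmass_nonneg unif_nonneg _ _ _) (hmass ρ) _
            _ = D' ^ rr k * ∑ ρ : ZMod p, sqf χ (rr k) (p ^ (1 + d)) a y (cls y S p ρ) ^ rr k := by
                simp only [mul_pow, mul_sum]
            _ ≤ D' ^ rr k * Q ^ rr k := by
                gcongr
                rw [← hsum]
                exact sum_pow_le_sum_pow (fun _ => hQ _) hr
        · calc ∑ ρ : ZMod p, ∑ ρ' ∈ univ.erase ρ,
                mixed p k (1 + d) g h a y (cls y S p ρ) (cls y S p ρ')
              ≤ ∑ ρ : ZMod p, ∑ ρ' ∈ univ.erase ρ, B * Q ^ rr k :=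
                sum_le_sum fun ρ _ => sum_le_sum fun ρ' h => hmix ρ ρ' (ne_of_mem_erase h)
            _ ≤ ∑ ρ : ZMod p, ∑ ρ' : ZMod p, B * Q ^ rr k :=
                sum_le_sum fun ρ _ => sum_le_sum_of_subset_of_nonneg (erase_subset _ _)
                  fun _ _ _ => mul_nonneg hB0 (pow_nonneg (hQ S) _)
            _ = _ := by simp [ZMod.card]; ring
    _ = ((1 + η) ^ (2 * rr k) * D' ^ rr k +
      (p : ℝ) ^ (2 * rr k) * (p / η) ^ (2 * h) * ((p : ℝ) ^ 2 * B)) * Q ^ rr k := by ring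
    _ ≤ _ := mul_le_mul_of_nonneg_right hD (pow_nonneg (hQ S) _)

lemma exists_gain_ge {k : ℕ} (hk : 2 ≤ k) (K : ℝ) : ∃ T l, 1 ≤ l ∧ l < k ∧ K ≤ gain k T l := by
  obtain ⟨j, rfl⟩ : ∃ j, k = j.succ := ⟨k - 1, by omega⟩
  have hj : (0 : ℝ) < j := by exact_mod_cast (show 0 < j by omega)
  obtain ⟨T, hT⟩ := exists_nat_ge ((j + 1) * K)
  by_contra! hcon
  have h1 : ∑ l ∈ range j, gain j.succ T (l + 1) < ∑ l ∈ range j, K :=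
    sum_lt_sum_of_nonempty (nonempty_range_iff.2 (by omega)) fun l hl =>
      hcon T (l + 1) (by omega) (by have := mem_range.1 hl; omega)
  rw [sum_gain, sum_const, card_range, nsmul_eq_mul] at h1
  have h2 : j * K ≤ T * ((j : ℝ) / (j + 1)) := by
    rw [mul_div_assoc', le_div_iff₀ (by positivity)]
    nlinarith
  linarith

lemma DecBound.descend {k : ℕ} (hk : 2 ≤ k) (hpk : k < p)
    (hlow : ∀ l, 1 ≤ l → l < k → ∀ ε : ℝ, 0 < ε → DecBound p l ε) {lam : ℝ} (hlam : 0 < lam) :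
    ∃ σ : ℝ, 0 < σ ∧ ∀ Λ : ℝ, lam ≤ Λ → DecBound p k Λ → DecBound p k (Λ - σ) := by
  have hp1 := one_lt_p p
  have hp0 : (0 : ℝ) < p := by linarith
  obtain ⟨T, l, hl1, hlk, hgain⟩ := exists_gain_ge hk ((k + 2) / lam)
  set β : ℝ := 1 / (k : ℝ) ^ (T + 1) with hβ
  have hk0 : (0 : ℝ) < k := by exact_mod_cast (show 0 < k by omega)
  have hβ0 : 0 < β := by positivity
  refine ⟨min (β / 2) (lam / 2), by positivity, fun Λ hΛ hD => ?_⟩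
  set σ := min (β / 2) (lam / 2) with hσ
  have hσβ : σ ≤ β / 2 := min_le_left _ _
  have hσlam : σ ≤ lam / 2 := min_le_right _ _
  obtain ⟨C, hC, HC⟩ := BL.iterate hk hpk hlow (by linarith) hD T (β / 2) (by positivity)
  set F := k.factorial ^ (T + 1) with hF
  have hF0 : 0 < F := by positivity
  set N0 := k ^ (T + 1) * F with hN0
  have hN0pos : 0 < N0 := by positivity
  set r := rr k with hrdef
  have hr : r ≠ 0 := rr_ne_zero (by omega)
  set C3 : ℝ := C * (p : ℝ) ^ F with hC3
  have hC31 : 1 ≤ C3 := one_le_mul_of_one_le_of_one_le hC (one_le_pow₀ hp1.le)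
  have hrl := rr_lt hlk
  have hBL : ∀ n, N0 ≤ n → BL p k n (rr l) (r - rr l) 1 1 ((C3 * (p : ℝ) ^ ((Λ - σ) * n)) ^ r) := by
    intro n hn
    set v := F * (n / N0) with hv
    have hv1 : 1 ≤ v := Nat.mul_pos hF0 (Nat.div_pos hn hN0pos)
    have hvn : k ^ (T + 1) * v ≤ n := by
      rw [hv, ← mul_assoc]; exact Nat.mul_div_le n N0
    have hkv : k * v ≤ n := by
      refine le_trans ?_ hvn
      gcongr
      exact Nat.le_self_pow (by omega) k
    have hvn' : v ≤ n := by nlinarith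
    set u := (k - l + 1) * (v / l) with hu
    have hukv : u ≤ k * v := by
      rw [hu]
      gcongr
      · omega
      · exact Nat.div_le_self v l
    have H := HC n v hv1 (Dvd.intro _ rfl) hvn l hlk
    have H1 := H.refine_trivial (by omega) (rr_ne_zero hl1) (hukv.trans hkv) (by positivity)
    have H2 := (H1.symm.refine_trivial (by omega) (by omega) hvn' (by positivity)).symm
    refine H2.mono le_rfl ?_
    have hpow : ∀ m : ℕ, ∀ g ≤ r, ((p ^ m : ℕ) : ℝ) ^ g ≤ ((p : ℝ) ^ (m : ℝ)) ^ r := by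
      intro m g hg
      rw [Real.rpow_natCast]
      push_cast
      exact pow_le_pow_right₀ (one_le_pow₀ hp1.le) hg
    calc _ ≤ ((p : ℝ) ^ (v : ℝ)) ^ r * (((p : ℝ) ^ (u : ℝ)) ^ r *
          (C * (p : ℝ) ^ (Λ * (n - gain k T l * v) + β / 2 * n)) ^ r) := by
          gcongr
          · exact hpow v _ (Nat.sub_le _ _)
          · exact hpow u _ hrl.le
      _ = (C * (p : ℝ) ^ (v + (u + (Λ * (n - gain k T l * v) + β / 2 * n)))) ^ r := by
          rw [← mul_pow, ← mul_pow, Real.rpow_add hp0 (v : ℝ), Real.rpow_add hp0 (u : ℝ)]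
          congr 1
          ring
      _ ≤ (C * (p : ℝ) ^ (F + (Λ - σ) * n)) ^ r := by
          refine pow_mul_rpow_mono (by linarith) le_rfl ?_
          have e1 : (u : ℝ) ≤ k * v := by exact_mod_cast hukv
          have e2 : (k + 2 : ℝ) ≤ Λ * gain k T l := by
            calc (k + 2 : ℝ) = lam * ((k + 2) / lam) := by field_simp
              _ ≤ Λ * gain k T l := mul_le_mul hΛ hgain (by positivity) (by linarith)
          have e3 : (k + 2 : ℝ) * v ≤ Λ * gain k T l * v := by gcongr
          have e4 : β * n - F ≤ v := by
            have h1 : n < N0 * (n / N0 + 1) := Nat.lt_mul_div_succ n hN0pos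
            have h2 : (n : ℝ) ≤ (k : ℝ) ^ (T + 1) * F * ((n / N0 : ℕ) + 1) := by exact_mod_cast h1.le
            have h3 : β * n ≤ F * ((n / N0 : ℕ) + 1) := by
              rw [hβ, div_mul_eq_mul_div, one_mul, div_le_iff₀ (by positivity)]
              linarith
            rw [hv]
            push_cast
            linarith
          have e5 : σ * n ≤ β / 2 * n := by gcongr
          nlinarith
      _ = _ := by
          rw [Real.rpow_add hp0, Real.rpow_natCast, hC3, mul_assoc]
  -- closing the recursion
  set η : ℝ := (p : ℝ) ^ (lam / 8) - 1 with hη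
  have hη0 : 0 < η := sub_pos.2 (Real.one_lt_rpow hp1 (by positivity))
  set h := r - rr l with hhdef
  set K : ℝ := (p : ℝ) ^ (2 * r) * (p / η) ^ (2 * h) * (p : ℝ) ^ 2 with hK
  have hK0 : 0 < K := by positivity
  set τ : ℝ := ((p : ℝ) ^ (lam / 4)) ^ r with hτ
  have hτ1 : 1 < τ := one_lt_pow₀ (Real.one_lt_rpow hp1 (by positivity)) hr
  set δ : ℝ := 1 - τ⁻¹ with hδ
  have hδ0 : 0 < δ := sub_pos.2 (inv_lt_one_of_one_lt₀ hτ1)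
  set A : ℝ := C3 * (K / δ + 1) * (p : ℝ) ^ N0 with hA
  have hA1 : 1 ≤ A := by
    refine one_le_mul_of_one_le_of_one_le (one_le_mul_of_one_le_of_one_le hC31 ?_)
      (one_le_pow₀ hp1.le)
    have : 0 < K / δ := by positivity
    linarith
  have hAp : (p : ℝ) ^ N0 ≤ A := by
    have h1 : 1 ≤ C3 * (K / δ + 1) := by
      refine one_le_mul_of_one_le_of_one_le hC31 ?_
      have : 0 < K / δ := by positivity
      linarith
    rw [hA]
    exact le_mul_of_one_le_left (by positivity) h1
  have hAr : C3 ^ r * (K / δ) ≤ A ^ r := by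
    have h0 : 0 < K / δ := by positivity
    have h1 : C3 * (K / δ + 1) ≤ A := by
      rw [hA]
      exact le_mul_of_one_le_right (by positivity) (one_le_pow₀ hp1.le)
    calc C3 ^ r * (K / δ) ≤ C3 ^ r * (K / δ + 1) ^ r := by
          gcongr
          exact (by linarith : K / δ ≤ K / δ + 1).trans (le_self_pow₀ (by linarith) hr)
      _ = (C3 * (K / δ + 1)) ^ r := (mul_pow _ _ _).symm
      _ ≤ _ := by gcongr
  refine ⟨A, hA1, fun n => ?_⟩
  have hexp : ∀ n : ℕ, 0 ≤ (Λ - σ) * n := fun n => mul_nonneg (by linarith) (by positivity)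
  induction n with
  | zero =>
    intro S y a
    have := wmass_le_card_mul (χ := mchar p k (k * 0)) hr unif_nonneg a y S (p ^ 0)
    refine this.trans (mul_le_mul_of_nonneg_right ?_ (sqf_nonneg _ _ _))
    simpa using hA1
  | succ d ih =>
    rw [add_comm d 1]
    by_cases hd : 1 + d < N0
    · intro S y a
      have := wmass_le_card_mul (χ := mchar p k (k * (1 + d))) hr unif_nonneg a y S (p ^ (1 + d))
      refine this.trans (mul_le_mul_of_nonneg_right ?_ (sqf_nonneg _ _ _))
      have h1 : ((p ^ (1 + d) : ℕ) : ℝ) ≤ A := by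
        push_cast
        exact (pow_le_pow_right₀ hp1.le hd.le).trans hAp
      refine h1.trans (le_mul_of_one_le_right (by linarith) ?_)
      exact Real.one_le_rpow hp1.le (hexp _)
    · push Not at hd
      refine Decouples.succ (by omega) (by omega : rr l + h = rr k) (rr_ne_zero hl1) (by omega) hη0
        (by positivity) (by positivity) (by positivity) ih (hBL _ hd) ?_
      set W : ℝ := ((p : ℝ) ^ ((Λ - σ) * (1 + d : ℕ))) ^ r with hW
      have hW0 : 0 < W := by positivity
      have e1 : (1 + η) ^ (2 * r) * (A * (p : ℝ) ^ ((Λ - σ) * d)) ^ r ≤ τ⁻¹ * (A ^ r * W) := by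
        have h1 : (1 + η) ^ 2 = (p : ℝ) ^ (lam / 4) := by
          rw [hη, add_sub_cancel, ← Real.rpow_natCast, ← Real.rpow_mul hp0.le]
          congr 1
          push_cast
          ring
        rw [pow_mul, h1, ← hτ, mul_pow, mul_left_comm, mul_left_comm τ⁻¹]
        refine mul_le_mul_of_nonneg_left ?_ (by positivity)
        rw [le_inv_mul_iff₀ (by positivity), hτ, hW, ← mul_pow, ← mul_pow, ← Real.rpow_add hp0,
          ← Real.rpow_add hp0]
        gcongr
        · exact hp1.le
        · push_cast
          linarith
      have e2 : (p : ℝ) ^ (2 * r) * (p / η) ^ (2 * h) *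
          ((p : ℝ) ^ 2 * (C3 * (p : ℝ) ^ ((Λ - σ) * (1 + d : ℕ))) ^ r) ≤ δ * (A ^ r * W) := by
        calc _ = δ * ((C3 ^ r * (K / δ)) * W) := by
              rw [mul_pow, hK, hW]
              field_simp
          _ ≤ _ := by gcongr
      calc _ ≤ τ⁻¹ * (A ^ r * W) + δ * (A ^ r * W) := add_le_add e1 e2
        _ = (A * (p : ℝ) ^ ((Λ - σ) * (1 + d : ℕ))) ^ r := by
          rw [← add_mul, hδ, add_sub_cancel, one_mul, mul_pow A]

/-- Decoupling for the moment curve holds with arbitrarily small loss. -/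
theorem decBound_of_pos {k : ℕ} (hk : 1 ≤ k) (hpk : k < p) {lam : ℝ} (hlam : 0 < lam) :
    DecBound p k lam := by
  induction k using Nat.strong_induction_on generalizing lam with
  | _ k ih =>
    rcases eq_or_lt_of_le hk with rfl | hk2
    · exact decBound_one p hlam.le
    obtain ⟨σ, hσ, hdesc⟩ := DecBound.descend hk2 hpk
      (fun l hl1 hlk ε hε => ih l hlk hl1 (by omega) hε) hlam
    have hj : ∀ j : ℕ, DecBound p k (max lam (1 - j * σ)) := by
      intro j
      induction j with
      | zero => exact (decBound_trivial p hk).mono p (by simp)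
      | succ j ihj =>
        refine (hdesc _ (le_max_left _ _) ihj).mono p ?_
        rw [sub_le_iff_le_add]
        refine max_le (by linarith [le_max_left lam (1 - ((j + 1 : ℕ) : ℝ) * σ)]) ?_
        have := le_max_right lam (1 - ((j + 1 : ℕ) : ℝ) * σ)
        push_cast at this ⊢
        linarith
    obtain ⟨j, hj1⟩ := exists_nat_ge (1 / σ)
    have := hj j
    rwa [max_eq_left] at this
    rw [div_le_iff₀ hσ] at hj1
    linarith

end Descent

end Waring

namespace Waring

open Finset

set_option linter.unusedSectionVars false

section Exponential

lemma ec_eq (z : ℝ) : ec z = Complex.exp (((2 * Real.pi * z : ℝ) : ℂ) * Complex.I) := by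
  unfold ec
  congr 1
  push_cast
  ring

lemma norm_ec (z : ℝ) : ‖ec z‖ = 1 := by
  rw [ec_eq, Complex.norm_exp_ofReal_mul_I]

lemma ec_add (x y : ℝ) : ec (x + y) = ec x * ec y := by
  simp only [ec_eq, ← Complex.exp_add]
  congr 1
  push_cast
  ring

lemma ec_zero : ec 0 = 1 := by simp [ec]

lemma ec_neg (x : ℝ) : ec (-x) = (starRingEnd ℂ) (ec x) := by
  rw [ec_eq, ec_eq, ← Complex.exp_conj, map_mul, Complex.conj_ofReal, Complex.conj_I]
  congr 1
  push_cast
  ring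

lemma ec_int (m : ℤ) : ec m = 1 := by
  rw [ec, ← Complex.exp_int_mul_two_pi_mul_I m]
  congr 1
  push_cast
  ring

lemma ec_add_int (x : ℝ) (m : ℤ) : ec (x + m) = ec x := by rw [ec_add, ec_int, mul_one]

lemma ec_sum {ι : Type*} (s : Finset ι) (f : ι → ℝ) : ec (∑ i ∈ s, f i) = ∏ i ∈ s, ec (f i) := by
  classical
  induction s using Finset.induction_on with
  | empty => simp [ec_zero]
  | insert a s ha ih => rw [sum_insert ha, prod_insert ha, ec_add, ih]

@[fun_prop]
lemma continuous_ec : Continuous ec := by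
  unfold ec
  fun_prop

lemma integral_ec_int (m : ℤ) : ∫ α in (0 : ℝ)..1, ec (α * m) = if m = 0 then 1 else 0 := by
  split_ifs with h
  · simp [h, ec_zero]
  · have hc : (2 * Real.pi * Complex.I * m : ℂ) ≠ 0 := by
      simp [Real.pi_ne_zero, Complex.I_ne_zero, h]
    have h1 : ∀ α : ℝ, ec (α * m) = Complex.exp ((2 * Real.pi * Complex.I * m) * α) := by
      intro α
      rw [ec]
      congr 1
      push_cast
      ring
    simp only [h1]
    rw [integral_exp_mul_complex hc]
    have h2 := Complex.exp_int_mul_two_pi_mul_I m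
    have h3 : (2 * Real.pi * Complex.I * m) * ((1 : ℝ) : ℂ) = m * (2 * Real.pi * Complex.I) := by
      push_cast; ring
    rw [h3, h2]
    simp

end Exponential

section Orthogonality

variable {ι : Type*} [Fintype ι]

lemma norm_sum_pow_eq (g : ι → ℂ) (r : ℕ) :
    ((‖∑ x, g x‖ ^ (2 * r) : ℝ) : ℂ) = ∑ z : (Fin r → ι) × (Fin r → ι),
      (∏ i, g (z.1 i)) * ∏ i, (starRingEnd ℂ) (g (z.2 i)) := by
  rw [Fintype.sum_prod_type]
  dsimp only
  rw [← Fintype.sum_mul_sum, ← Fintype.sum_pow,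
    ← Fintype.sum_pow (fun x => (starRingEnd ℂ) (g x)), ← mul_pow,
    ← map_sum, Complex.mul_conj, Complex.normSq_eq_norm_sq, pow_mul]
  push_cast
  rfl

/-- The mean value of an even power of an exponential sum counts solutions of an equation. -/
lemma integral_norm_sum_ec_pow (m : ι → ℤ) (r : ℕ) :
    ∫ α in (0 : ℝ)..1, ‖∑ x, ec (α * m x)‖ ^ (2 * r) =
      #{z : (Fin r → ι) × (Fin r → ι) | ∑ i, m (z.1 i) = ∑ i, m (z.2 i)} := by
  have key : ∀ α : ℝ, ((‖∑ x, ec (α * m x)‖ ^ (2 * r) : ℝ) : ℂ) =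
      ∑ z : (Fin r → ι) × (Fin r → ι),
        ec (α * ((∑ i, m (z.1 i) - ∑ i, m (z.2 i) : ℤ) : ℝ)) := by
    intro α
    rw [norm_sum_pow_eq]
    refine sum_congr rfl fun z _ => ?_
    simp only [← ec_neg]
    rw [← ec_sum, ← ec_sum, ← ec_add]
    congr 1
    push_cast
    rw [sum_neg_distrib, mul_sub, mul_sum, mul_sum, sub_eq_add_neg]
  apply Complex.ofReal_injective
  rw [← intervalIntegral.integral_ofReal]
  simp only [key]
  rw [intervalIntegral.integral_finsetSum]
  · simp only [integral_ec_int, sub_eq_zero]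
    simp [sum_boole]
  · intro z _
    exact (by fun_prop : Continuous _).intervalIntegrable _ _

variable {Γ : Type*} [AddCommGroup Γ] [Fintype Γ]

lemma card_solutions_le (ψ : ι → AddChar Γ ℂ) (θ : AddChar Γ ℂ) (r : ℕ) :
    (#{z : (Fin r → ι) × (Fin r → ι) | ∏ i, ψ (z.1 i) = (∏ i, ψ (z.2 i)) * θ} : ℝ) ≤
      ∑ α, unif Γ α * (‖∑ x, ψ x α‖ ^ 2) ^ r := by
  classical
  have hcard : (0 : ℝ) < Fintype.card Γ := by exact_mod_cast Fintype.card_pos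
  have hconj : ∀ (φ : AddChar Γ ℂ) (α : Γ), (starRingEnd ℂ) (φ α) = φ⁻¹ α := fun φ α =>
    by rw [AddChar.inv_apply', AddChar.inv_apply_eq_conj]
  have h1 : ∀ z : (Fin r → ι) × (Fin r → ι), ∀ α,
      (∏ i, ψ (z.1 i) α) * (∏ i, (starRingEnd ℂ) (ψ (z.2 i) α)) * (starRingEnd ℂ) (θ α) =
        ((∏ i, ψ (z.1 i)) * ((∏ i, ψ (z.2 i)) * θ)⁻¹) α := by
    intro z α
    rw [AddChar.mul_apply, ← hconj, AddChar.mul_apply, map_mul, ← mul_assoc, AddChar.prod_apply,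
      AddChar.prod_apply, map_prod]
  have h2 : ((#{z : (Fin r → ι) × (Fin r → ι) | ∏ i, ψ (z.1 i) = (∏ i, ψ (z.2 i)) * θ} : ℝ) : ℂ) *
      (Fintype.card Γ : ℝ) =
      ∑ α, ((‖∑ x, ψ x α‖ ^ (2 * r) : ℝ) : ℂ) * (starRingEnd ℂ) (θ α) := by
    simp only [norm_sum_pow_eq, sum_mul, h1]
    rw [sum_comm]
    simp only [AddChar.sum_eq_ite]
    have : ∀ z : (Fin r → ι) × (Fin r → ι),
        ((∏ i, ψ (z.1 i)) * ((∏ i, ψ (z.2 i)) * θ)⁻¹ = 0) ↔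
          ∏ i, ψ (z.1 i) = (∏ i, ψ (z.2 i)) * θ := fun z => by
      rw [← AddChar.one_eq_zero, mul_inv_eq_one]
    simp only [this]
    rw [← sum_filter, sum_const, nsmul_eq_mul]
    push_cast
    rfl
  have h3 : ‖∑ α, ((‖∑ x, ψ x α‖ ^ (2 * r) : ℝ) : ℂ) * (starRingEnd ℂ) (θ α)‖ ≤
      ∑ α, (‖∑ x, ψ x α‖ ^ 2) ^ r := by
    refine (norm_sum_le _ _).trans (sum_le_sum fun α _ => ?_)
    rw [norm_mul, RCLike.norm_conj, AddChar.norm_apply, mul_one, Complex.norm_real, pow_mul,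
      Real.norm_of_nonneg (by positivity)]
  rw [← h2, ← Complex.ofReal_mul, Complex.norm_real, Real.norm_of_nonneg (by positivity)] at h3
  simp only [unif]
  rw [← mul_sum, ← div_eq_inv_mul, le_div_iff₀ hcard]
  exact h3

end Orthogonality

/-- The exponential sum `∑_{x ≤ X} e(α x ^ k)`. -/
noncomputable def weylSum (k X : ℕ) (α : ℝ) : ℂ := ∑ x ∈ Icc 1 X, ec (α * (x : ℝ) ^ k)

section MeanValue

lemma two_mul_sum_range_add_rr (k : ℕ) : ∑ i ∈ range k, i + rr k = k ^ 2 := by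
  have h1 := sum_range_id_mul_two k
  have h2 := two_mul_rr k
  rcases k with _ | k
  · simp [rr]
  · simp only [Nat.add_sub_cancel] at h1
    nlinarith

lemma decouples_mean_le {p : ℕ} [Fact p.Prime] {k n X : ℕ} (hk : 1 ≤ k) (hX : X ≤ p ^ n) {D : ℝ}
    (hD0 : 0 ≤ D) (hD : Decouples (mchar p k (k * n)) (rr k) (p ^ n) D) :
    ∑ α, unif _ α * (‖∑ x : Icc 1 X, mchar p k (k * n) ((x : ℕ) : ℤ) α‖ ^ 2) ^ rr k ≤
      (D * X) ^ rr k := by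
  have hr := rr_ne_zero hk
  set S : Finset ℤ := (Icc 1 X).image fun x : ℕ => (x : ℤ) with hS
  have hcard : S.card = X := by
    rw [hS, card_image_of_injective _ Nat.cast_injective]; simp
  have hes : ∀ α, esum (mchar p k (k * n)) (fun _ => 1) id S α =
      ∑ x : Icc 1 X, mchar p k (k * n) ((x : ℕ) : ℤ) α := by
    intro α
    rw [esum, hS, sum_image (fun _ _ _ _ h => Nat.cast_injective h), ← sum_coe_sort]
    simp
  have hinj : ∀ ρ : ZMod (p ^ n), (cls id S (p ^ n) ρ).card ≤ 1 := by
    intro ρ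
    refine card_le_one.2 fun a ha b hb => ?_
    obtain ⟨ha1, ha2⟩ := mem_cls.1 ha
    obtain ⟨hb1, hb2⟩ := mem_cls.1 hb
    rw [hS, mem_image] at ha1 hb1
    obtain ⟨a', ha', rfl⟩ := ha1
    obtain ⟨b', hb', rfl⟩ := hb1
    have h := (ZMod.intCast_eq_intCast_iff_dvd_sub _ _ _).1 (ha2.trans hb2.symm)
    rw [mem_Icc] at ha' hb'
    have h0 := Int.eq_zero_of_abs_lt_dvd h (by
      rw [abs_lt]; simp only [id]; constructor <;> omega)
    simp only [id] at h0
    omega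
  have hcls : ∀ ρ : ZMod (p ^ n),
      wnorm (rr k) (unif _) (fun α => ‖esum (mchar p k (k * n)) (fun _ => 1) id
        (cls id S (p ^ n) ρ) α‖ ^ 2) ≤ (cls id S (p ^ n) ρ).card := by
    intro ρ
    refine wnorm_le_of_pow_le hr unif_nonneg (fun _ => by positivity) (by positivity) ?_
    have h1 : ∀ α, ‖esum (mchar p k (k * n)) (fun _ => 1) id (cls id S (p ^ n) ρ) α‖ ≤
        (cls id S (p ^ n) ρ).card := by
      intro α
      refine (norm_sum_le _ _).trans ?_
      simp [AddChar.norm_apply]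
    calc _ ≤ ∑ α, unif (Phase p k (k * n)) α * ((cls id S (p ^ n) ρ).card : ℝ) ^ rr k := by
          refine sum_le_sum fun α _ => mul_le_mul_of_nonneg_left ?_ (unif_nonneg α)
          refine pow_le_pow_left₀ (by positivity) ?_ _
          have h2 : ((cls id S (p ^ n) ρ).card : ℝ) ≤ 1 := by exact_mod_cast hinj ρ
          have h3 : (0 : ℝ) ≤ ((cls id S (p ^ n) ρ).card : ℝ) := by positivity
          nlinarith [h1 α, norm_nonneg (esum (mchar p k (k * n)) (fun _ => 1) id
            (cls id S (p ^ n) ρ) α)]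
      _ = _ := by
          rw [← sum_mul]
          simp only [unif, sum_const, card_univ, nsmul_eq_mul]
          rw [mul_inv_cancel₀ (by exact_mod_cast Fintype.card_ne_zero), one_mul]
  have hmain := hD S id fun _ => 1
  have hsum : ∑ ρ : ZMod (p ^ n), ((cls id S (p ^ n) ρ).card : ℝ) = X := by
    have h1 := card_eq_sum_card_fiberwise (f := fun x : ℤ => (x : ZMod (p ^ n))) (s := S)
      (t := univ) fun _ _ => by simp
    rw [hcard] at h1
    rw [h1]
    push_cast
    rfl
  have h2 : wnorm (rr k) (unif _) (fun α => ‖esum (mchar p k (k * n)) (fun _ => 1) id S α‖ ^ 2) ≤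
      D * X := by
    refine hmain.trans (mul_le_mul_of_nonneg_left ?_ hD0)
    rw [← hsum]
    exact sum_le_sum fun ρ _ => hcls ρ
  have h3 := pow_le_pow_left₀ (wnorm_nonneg unif_nonneg fun _ => by positivity) h2 (rr k)
  rw [wnorm_pow hr unif_nonneg fun _ => by positivity] at h3
  simpa only [hes] using h3

/-- The character of the phase group attached to a vector of moments. -/
noncomputable def momentChar (p k N : ℕ) [Fact p.Prime] (h : Fin (k + 1) → ℤ) :
    AddChar (Phase p k N) ℂ :=
  (ZMod.stdAddChar (N := p ^ N)).compAddMonoidHom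
    (∑ m : Fin (k + 1), (AddMonoidHom.mulRight ((h m : ℤ) : ZMod (p ^ N))).comp
      (Pi.evalAddMonoidHom _ m))

lemma momentChar_apply (p k N : ℕ) [Fact p.Prime] (h : Fin (k + 1) → ℤ) (α : Phase p k N) :
    momentChar p k N h α = ZMod.stdAddChar (∑ m, α m * ((h m : ℤ) : ZMod (p ^ N))) := by
  simp [momentChar, AddChar.compAddMonoidHom_apply]

lemma momentChar_add (p k N : ℕ) [Fact p.Prime] (h h' : Fin (k + 1) → ℤ) :
    momentChar p k N (h + h') = momentChar p k N h * momentChar p k N h' := by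
  ext α
  rw [AddChar.mul_apply, momentChar_apply, momentChar_apply, momentChar_apply,
    ← AddChar.map_add_eq_mul]
  congr 1
  rw [← sum_add_distrib]
  refine sum_congr rfl fun m _ => ?_
  rw [Pi.add_apply]
  push_cast
  ring

lemma prod_mchar (p k N : ℕ) [Fact p.Prime] {ι : Type*} (s : Finset ι) (x : ι → ℤ) :
    ∏ i ∈ s, mchar p k N (x i) = momentChar p k N fun m => ∑ i ∈ s, x i ^ (m : ℕ) := by
  ext α
  rw [AddChar.prod_apply, momentChar_apply]
  simp only [mchar_apply]
  have h : ∀ t : ι → ZMod (p ^ N),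
      ∏ i ∈ s, ZMod.stdAddChar (t i) = ZMod.stdAddChar (∑ i ∈ s, t i) := fun t =>
    (map_prod (ZMod.stdAddChar (N := p ^ N)).toMonoidHom (fun i => Multiplicative.ofAdd (t i)) s).symm
  rw [h, sum_comm]
  congr 1
  refine sum_congr rfl fun m _ => ?_
  rw [← mul_sum]
  push_cast
  rfl

lemma card_waring_solutions_le {p : ℕ} [Fact p.Prime] {k n X : ℕ} (hk : 1 ≤ k) (hX1 : 1 ≤ X)
    (hX : X ≤ p ^ n) {D : ℝ} (hD0 : 0 ≤ D)
    (hD : Decouples (mchar p k (k * n)) (rr k) (p ^ n) D) :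
    (#{z : (Fin (rr k) → Icc 1 X) × (Fin (rr k) → Icc 1 X) |
      ∑ i, ((z.1 i : ℕ) : ℤ) ^ k = ∑ i, ((z.2 i : ℕ) : ℤ) ^ k} : ℝ) ≤
      (3 * rr k) ^ k * (X : ℝ) ^ (∑ i ∈ range k, i) * (D * X) ^ rr k := by
  classical
  set r := rr k with hrdef
  have hr : r ≠ 0 := rr_ne_zero hk
  set A : Finset ((Fin r → Icc 1 X) × (Fin r → Icc 1 X)) :=
    {z | ∑ i, ((z.1 i : ℕ) : ℤ) ^ k = ∑ i, ((z.2 i : ℕ) : ℤ) ^ k} with hA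
  set mom : (Fin r → Icc 1 X) × (Fin r → Icc 1 X) → Fin (k + 1) → ℤ := fun z m =>
    ∑ i, ((z.1 i : ℕ) : ℤ) ^ (m : ℕ) - ∑ i, ((z.2 i : ℕ) : ℤ) ^ (m : ℕ) with hmom
  set b : Fin (k + 1) → ℕ := fun m => if (m : ℕ) < k then r * X ^ (m : ℕ) else 0 with hb
  set T : Finset (Fin (k + 1) → ℤ) := Fintype.piFinset fun m => Icc (-(b m : ℤ)) (b m) with hT
  have hAT : ∀ z ∈ A, mom z ∈ T := by
    intro z hz
    rw [hT, Fintype.mem_piFinset]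
    intro m
    rw [mem_Icc, ← abs_le]
    by_cases hm : (m : ℕ) < k
    · have hbd : ∀ x : Fin r → Icc 1 X, 0 ≤ ∑ i, ((x i : ℕ) : ℤ) ^ (m : ℕ) ∧
          ∑ i, ((x i : ℕ) : ℤ) ^ (m : ℕ) ≤ r * X ^ (m : ℕ) := by
        intro x
        refine ⟨sum_nonneg fun i _ => by positivity, ?_⟩
        have h1 : ∀ i ∈ (univ : Finset (Fin r)), ((x i : ℕ) : ℤ) ^ (m : ℕ) ≤ (X : ℤ) ^ (m : ℕ) := by
          intro i _
          have := (mem_Icc.1 (x i).2).2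
          gcongr
        simpa using sum_le_card_nsmul _ _ _ h1
      have h1 := hbd z.1
      have h2 := hbd z.2
      simp only [hb, hm, if_true, hmom]
      push_cast
      rw [abs_le]
      constructor <;> linarith
    · have hmk : (m : ℕ) = k := by omega
      have := (mem_filter.1 hz).2
      simp only [hb, hmom, hmk, lt_irrefl, if_false, this]
      simp
  have hTcard : (T.card : ℝ) ≤ (3 * r) ^ k * (X : ℝ) ^ (∑ i ∈ range k, i) := by
    rw [hT, Fintype.card_piFinset, Fin.prod_univ_castSucc]
    have h1 : #(Icc (-(b (Fin.last k) : ℤ)) (b (Fin.last k))) = 1 := by simp [hb]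
    rw [h1, mul_one, ← prod_pow_eq_pow_sum, ← Fin.prod_univ_eq_prod_range]
    push_cast
    have h2 : ((3 : ℝ) * r) ^ k = ∏ i : Fin k, (3 * r : ℝ) := by simp
    rw [h2, ← prod_mul_distrib]
    refine prod_le_prod (fun _ _ => by positivity) fun i _ => ?_
    have h3 : #(Icc (-(b i.castSucc : ℤ)) (b i.castSucc)) ≤ 3 * (r * X ^ (i : ℕ)) := by
      have h4 : b i.castSucc = r * X ^ (i : ℕ) := by simp [hb]
      have h5 : 1 ≤ r * X ^ (i : ℕ) := Nat.one_le_iff_ne_zero.2 (by positivity)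
      rw [Int.card_Icc, h4]
      omega
    calc (#(Icc (-(b i.castSucc : ℤ)) (b i.castSucc)) : ℝ) ≤ ((3 * (r * X ^ (i : ℕ)) : ℕ) : ℝ) := by
          exact_mod_cast h3
      _ = _ := by push_cast; ring
  have hfib : ∀ h ∈ T, (#{z ∈ A | mom z = h} : ℝ) ≤ (D * X) ^ r := by
    intro h _
    refine le_trans ?_ ((card_solutions_le
      (fun x : Icc 1 X => mchar p k (k * n) ((x : ℕ) : ℤ)) (momentChar p k (k * n) h) r).trans
      (decouples_mean_le hk hX hD0 hD))
    refine Nat.cast_le.2 (card_le_card fun z hz => ?_)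
    rw [mem_filter] at hz ⊢
    refine ⟨mem_univ _, ?_⟩
    rw [prod_mchar, prod_mchar, ← momentChar_add, ← hz.2]
    congr 1
    ext m
    simp [hmom]
  have hfin := card_eq_sum_card_fiberwise (f := mom) (s := A) (t := T) hAT
  rw [hfin]
  push_cast
  calc _ ≤ ∑ h ∈ T, (D * X) ^ r := sum_le_sum hfib
    _ = T.card * (D * X) ^ r := by rw [sum_const, nsmul_eq_mul]
    _ ≤ _ := by gcongr

/-- The mean value estimate for the exponential sum over `k`-th powers at the critical exponent. -/
theorem integral_weylSum_pow_le {k : ℕ} (hk : 1 ≤ k) {ε : ℝ} (hε : 0 < ε) :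
    ∃ C : ℝ, 0 < C ∧ ∀ X : ℕ, 1 ≤ X →
      ∫ α in (0 : ℝ)..1, ‖weylSum k X α‖ ^ (2 * rr k) ≤ C * (X : ℝ) ^ ((k : ℝ) ^ 2 + ε) := by
  obtain ⟨p, hpk, hp⟩ := Nat.exists_infinite_primes (k + 1)
  have : Fact p.Prime := ⟨hp⟩
  have hp1 := one_lt_p p
  have hp0 : (0 : ℝ) < p := by linarith
  have hr := rr_ne_zero hk
  set r := rr k with hrdef
  have hr0 : (0 : ℝ) < r := by exact_mod_cast Nat.pos_of_ne_zero hr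
  obtain ⟨C, hC, HC⟩ := decBound_of_pos (p := p) hk (by omega) (div_pos hε hr0)
  set B : ℝ := C * (p : ℝ) ^ (ε / r) with hB
  have hB0 : 0 < B := by positivity
  refine ⟨(3 * r) ^ k * B ^ r, by positivity, fun X hX => ?_⟩
  have hX0 : (0 : ℝ) < X := by exact_mod_cast hX
  set n := Nat.clog p X with hn
  have hXn : X ≤ p ^ n := Nat.le_pow_clog hp.one_lt X
  have hpn : (p : ℝ) ^ n ≤ p * X := by
    rcases Nat.lt_or_ge X 2 with h | h
    · have : X = 1 := by omega
      rw [hn, this]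
      simpa using hp1.le
    · have h1 := Nat.pow_pred_clog_lt_self hp.one_lt h
      have h2 : 0 < n := Nat.clog_pos hp.one_lt h
      obtain ⟨j, hj⟩ : ∃ j, n = j + 1 := ⟨n - 1, by omega⟩
      rw [← hn, hj] at h1
      rw [hj, pow_succ']
      gcongr
      exact_mod_cast h1.le
  have hD : C * (p : ℝ) ^ (ε / r * n) ≤ B * (X : ℝ) ^ (ε / r) := by
    rw [hB, mul_assoc, ← Real.mul_rpow hp0.le hX0.le, mul_comm (ε / r), Real.rpow_mul hp0.le,
      Real.rpow_natCast]
    gcongr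
  have h1 := card_waring_solutions_le hk hX hXn (by positivity) (HC n)
  have h2 : ∫ α in (0 : ℝ)..1, ‖weylSum k X α‖ ^ (2 * r) =
      #{z : (Fin r → Icc 1 X) × (Fin r → Icc 1 X) |
        ∑ i, ((z.1 i : ℕ) : ℤ) ^ k = ∑ i, ((z.2 i : ℕ) : ℤ) ^ k} := by
    rw [← integral_norm_sum_ec_pow (fun x : Icc 1 X => ((x : ℕ) : ℤ) ^ k) r]
    refine intervalIntegral.integral_congr fun α _ => ?_
    simp only [weylSum]
    rw [← sum_coe_sort]
    push_cast
    rfl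
  rw [h2]
  refine h1.trans ?_
  calc _ ≤ (3 * r) ^ k * (X : ℝ) ^ (∑ i ∈ range k, i) * (B * (X : ℝ) ^ (ε / r) * X) ^ r := by gcongr
    _ = (3 * r) ^ k * B ^ r * ((X : ℝ) ^ (∑ i ∈ range k, i + r) * ((X : ℝ) ^ (ε / r)) ^ r) := by
        rw [pow_add]; ring
    _ = _ := by
        rw [two_mul_sum_range_add_rr, ← Real.rpow_natCast (X : ℝ), ← Real.rpow_natCast ((X : ℝ) ^ (ε / r)),
          ← Real.rpow_mul hX0.le, ← Real.rpow_add hX0]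
        congr 2
        push_cast
        field_simp

end MeanValue

end Waring

namespace Waring

open Finset

section Recurrence

lemma card_le_of_pairwise_le {s : Finset ℕ} {K : ℝ} (hK : 0 ≤ K)
    (h : ∀ i ∈ s, ∀ j ∈ s, i ≤ j → (j : ℝ) - i ≤ K) : (s.card : ℝ) ≤ K + 1 := by
  rcases s.eq_empty_or_nonempty with rfl | hs
  · simp; linarith
  have h1 : s ⊆ Icc (s.min' hs) (s.max' hs) := fun x hx =>
    mem_Icc.2 ⟨s.min'_le x hx, s.le_max' x hx⟩
  have h2 := card_le_card h1
  rw [Nat.card_Icc] at h2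
  have h3 : s.min' hs ≤ s.max' hs := s.min'_le _ (s.max'_mem hs)
  have h4 := h _ (s.min'_mem hs) _ (s.max'_mem hs) h3
  have h5 : s.card + s.min' hs ≤ s.max' hs + 1 := by omega
  have h6 : (s.card : ℝ) + s.min' hs ≤ s.max' hs + 1 := by exact_mod_cast h5
  linarith

/-- If `θ h` is close to an integer for many `h ≤ H`, then `θ` is close to a rational number with
small denominator. -/
lemma exists_approx_of_recurrent {H : ℕ} {A : Finset ℕ} (hA : A ⊆ Icc 1 H) {θ κ E : ℝ}
    (hE : 1 ≤ E) (hκ0 : 0 ≤ κ) (hκ : 32 * (E * κ) < 1) (hH : 16 * E ^ 2 ≤ H)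
    (hcard : (H : ℝ) ≤ E * A.card) (hclose : ∀ h ∈ A, ∃ m : ℤ, |h * θ - m| ≤ κ) :
    ∃ d : ℕ, 1 ≤ d ∧ (d : ℝ) ≤ 2 * E ∧ ∃ m : ℤ, |d * θ - m| * H ≤ 32 * κ * E ^ 2 := by
  have hH0 : (0 : ℝ) < H := by nlinarith
  have hκE : κ ≤ E * κ := le_mul_of_one_le_left hκ0 hE
  -- two close elements of `A`
  obtain ⟨d, hd1, hd2, m, hm⟩ : ∃ d : ℕ, 1 ≤ d ∧ (d : ℝ) ≤ 2 * E ∧ ∃ m : ℤ, |d * θ - m| ≤ 2 * κ := by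
    set M := ⌈2 * E⌉₊ with hM
    have hM0 : 0 < M := Nat.ceil_pos.2 (by linarith)
    have hMle : 2 * E ≤ M := Nat.le_ceil _
    have hlt : (range (H / M + 1)).card < A.card := by
      rw [card_range]
      have h1 : ((H / M : ℕ) : ℝ) ≤ H / M := Nat.cast_div_le
      have h2 : (H : ℝ) / M ≤ H / (2 * E) := by gcongr
      have h3 : (H : ℝ) / E ≤ A.card := by
        rw [div_le_iff₀ (by linarith)]; linarith
      have h4 : (H : ℝ) / (2 * E) + H / (2 * E) = H / E := by field_simp; ring
      have h5 : 1 < (H : ℝ) / (2 * E) := by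
        rw [lt_div_iff₀ (by linarith)]; nlinarith
      have : ((H / M + 1 : ℕ) : ℝ) < A.card := by push_cast; linarith
      exact_mod_cast this
    obtain ⟨x, hx, y, hy, hxy, hdiv⟩ := exists_ne_map_eq_of_card_lt_of_maps_to hlt
      (f := fun h => h / M) fun h hh => by
        have := (mem_Icc.1 (hA hh)).2
        simp only [coe_range, Set.mem_Iio]
        exact Nat.lt_succ_of_le (Nat.div_le_div_right this)
    wlog hlt : x < y generalizing x y
    · exact this y hy x hx hxy.symm hdiv.symm (by omega)
    refine ⟨y - x, by omega, ?_, ?_⟩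
    · have h1 := Nat.div_add_mod x M
      have h2 := Nat.div_add_mod y M
      have h3 := Nat.mod_lt y hM0
      rw [hdiv] at h1
      have h4 : y - x < M := by omega
      exact (Nat.lt_ceil.1 h4).le
    · obtain ⟨m, hm⟩ := hclose x hx
      obtain ⟨m', hm'⟩ := hclose y hy
      refine ⟨m' - m, ?_⟩
      rw [Nat.cast_sub hlt.le]
      push_cast
      rw [abs_le] at *
      constructor <;> linarith [hm.1, hm.2, hm'.1, hm'.2]
  refine ⟨d, hd1, hd2, m, ?_⟩
  set β := d * θ - m with hβ
  by_cases hβ0 : |β| = 0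
  · rw [hβ0, zero_mul]; positivity
  have hβpos : 0 < |β| := lt_of_le_of_ne (abs_nonneg β) (Ne.symm hβ0)
  have hd0 : (1 : ℝ) ≤ d := by exact_mod_cast hd1
  -- double counting
  have hcount : ∀ L : ℕ, L * |β| ≤ 1 / 2 →
      (A.card : ℝ) * L ≤ (H + L * d) * (2 * κ / |β| + 1) := by
    intro L hL
    have hmaps : ∀ z ∈ A ×ˢ range L, z.1 + z.2 * d ∈ Icc 1 (H + L * d) := by
      intro z hz
      rw [mem_product, mem_range] at hz
      have h1 := mem_Icc.1 (hA hz.1)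
      rw [mem_Icc]
      have h2 : z.2 * d ≤ L * d := Nat.mul_le_mul_right d hz.2.le
      omega
    have h1 := card_eq_sum_card_fiberwise (f := fun z : ℕ × ℕ => z.1 + z.2 * d) hmaps
    have hfib : ∀ v ∈ Icc 1 (H + L * d),
        (#{z ∈ A ×ˢ range L | z.1 + z.2 * d = v} : ℝ) ≤ 2 * κ / |β| + 1 := by
      intro v _
      set F := {z ∈ A ×ˢ range L | z.1 + z.2 * d = v} with hF
      have hinj : Set.InjOn Prod.snd (F : Set (ℕ × ℕ)) := by
        intro z hz w hw h
        have h1 := (mem_filter.1 hz).2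
        have h2 := (mem_filter.1 hw).2
        rw [h] at h1
        exact Prod.ext (by omega) h
      rw [← card_image_of_injOn hinj]
      refine card_le_of_pairwise_le (by positivity) ?_
      intro i hi j hj hij
      rw [mem_image] at hi hj
      obtain ⟨⟨x, i⟩, hz, rfl⟩ := hi
      obtain ⟨⟨y, j⟩, hw, rfl⟩ := hj
      rw [hF, mem_filter, mem_product, mem_range] at hz hw
      simp only at hz hw hij ⊢
      obtain ⟨n1, hn1⟩ := hclose x hz.1.1
      obtain ⟨n2, hn2⟩ := hclose y hw.1.1
      have hxy : (x : ℝ) - y = (j - i) * d := by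
        have h3 : x + i * d = y + j * d := hz.2.trans hw.2.symm
        have h4 : (x : ℝ) + i * d = y + j * d := by exact_mod_cast h3
        linarith
      set n : ℤ := n1 - n2 - (j - i) * m with hn
      have hclose2 : |((j : ℝ) - i) * β - n| ≤ 2 * κ := by
        have e : ((j : ℝ) - i) * β - n = (x * θ - n1) - (y * θ - n2) := by
          rw [hβ, hn]
          push_cast
          linear_combination (-θ) * hxy
        rw [e]
        rw [abs_le] at *
        constructor <;> linarith [hn1.1, hn1.2, hn2.1, hn2.2]
      have hji : (0 : ℝ) ≤ (j : ℝ) - i := by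
        have : (i : ℝ) ≤ j := by exact_mod_cast hij
        linarith
      have habs : |((j : ℝ) - i) * β| = ((j : ℝ) - i) * |β| := by
        rw [abs_mul, abs_of_nonneg hji]
      have hsmall : |((j : ℝ) - i) * β| ≤ 1 / 2 := by
        rw [habs]
        refine le_trans ?_ hL
        gcongr
        have : (j : ℝ) ≤ L := by exact_mod_cast hw.1.2.le
        have : (0 : ℝ) ≤ i := by positivity
        linarith
      have hn0 : n = 0 := by
        have h5 : |(n : ℝ)| < 1 := by
          rw [abs_le] at *
          rw [abs_lt]
          constructor <;> linarith [hsmall.1, hsmall.2, hclose2.1, hclose2.2]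
        have h6 : |n| < 1 := by exact_mod_cast h5
        exact Int.abs_lt_one_iff.1 h6
      rw [hn0, Int.cast_zero, sub_zero, habs] at hclose2
      rwa [le_div_iff₀ hβpos]
    rw [card_product, card_range] at h1
    have h2 : (A.card : ℝ) * L = ∑ v ∈ Icc 1 (H + L * d),
        (#{z ∈ A ×ˢ range L | z.1 + z.2 * d = v} : ℝ) := by
      exact_mod_cast h1
    rw [h2]
    refine (sum_le_sum hfib).trans ?_
    rw [sum_const, Nat.card_Icc, nsmul_eq_mul]
    push_cast
    simp
  have hdH : (d : ℝ) ≤ H := by nlinarith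
  have hcount2 : ∀ L : ℕ, L * |β| ≤ 1 / 2 → (L * d : ℝ) ≤ H → L * |β| ≤ E * (4 * κ + 2 * |β|) := by
    intro L h1 h2
    have h3 := hcount L h1
    have h4 : (H : ℝ) * L ≤ H * (E * (2 * (2 * κ / |β| + 1))) := by
      calc (H : ℝ) * L ≤ E * A.card * L := by gcongr
        _ = E * (A.card * L) := by ring
        _ ≤ E * ((H + L * d) * (2 * κ / |β| + 1)) := by gcongr
        _ ≤ E * ((H + H) * (2 * κ / |β| + 1)) := by gcongr
        _ = _ := by ring
    have h5 := le_of_mul_le_mul_left h4 hH0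
    calc L * |β| ≤ E * (2 * (2 * κ / |β| + 1)) * |β| := by gcongr
      _ = _ := by field_simp; ring
  by_cases hc : (1 : ℝ) / (2 * |β|) ≤ H / d
  · exfalso
    have hx2 : (2 : ℝ) ≤ 1 / (2 * |β|) := by
      rw [le_div_iff₀ (by positivity)]
      linarith
    set L := ⌊(1 : ℝ) / (2 * |β|)⌋₊ with hL
    have hL1 : (L : ℝ) ≤ 1 / (2 * |β|) := Nat.floor_le (by positivity)
    have hL2 : (1 : ℝ) / (2 * |β|) < L + 1 := Nat.lt_floor_add_one _
    have h1 : (L : ℝ) * |β| ≤ 1 / 2 := by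
      calc (L : ℝ) * |β| ≤ 1 / (2 * |β|) * |β| := by gcongr
        _ = 1 / 2 := by field_simp
    have h2 : (L * d : ℝ) ≤ H := by
      have := hL1.trans hc
      rwa [le_div_iff₀ (by linarith)] at this
    have h3 := hcount2 L h1 h2
    have h4 : 1 / 4 ≤ L * |β| := by
      have : (1 : ℝ) / (2 * |β|) / 2 ≤ L := by linarith
      calc (1 : ℝ) / 4 = 1 / (2 * |β|) / 2 * |β| := by field_simp; norm_num
        _ ≤ _ := by gcongr
    have h5 : E * (4 * κ + 2 * |β|) ≤ 8 * (E * κ) := by nlinarith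
    linarith
  · push Not at hc
    set L := ⌊(H : ℝ) / d⌋₊ with hL
    have hHd : 1 ≤ (H : ℝ) / d := by rw [le_div_iff₀ (by linarith)]; linarith
    have hL1 : (L : ℝ) ≤ H / d := Nat.floor_le (by positivity)
    have hL2 : (H : ℝ) / d < L + 1 := Nat.lt_floor_add_one _
    have hL3 : (1 : ℝ) ≤ L := by exact_mod_cast Nat.one_le_iff_ne_zero.2 (Nat.floor_pos.2 hHd).ne'
    have h1 : (L : ℝ) * |β| ≤ 1 / 2 := by
      calc (L : ℝ) * |β| ≤ 1 / (2 * |β|) * |β| := by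
            have := hL1.trans hc.le
            gcongr
        _ = 1 / 2 := by field_simp
    have h2 : (L * d : ℝ) ≤ H := by rwa [le_div_iff₀ (by linarith)] at hL1
    have h3 := hcount2 L h1 h2
    have h4 : (H : ℝ) ≤ 4 * E * L := by
      have h5 : (H : ℝ) ≤ 2 * L * d := by
        have : (H : ℝ) / d ≤ 2 * L := by linarith
        rwa [div_le_iff₀ (by linarith)] at this
      calc (H : ℝ) ≤ 2 * L * d := h5
        _ ≤ 2 * L * (2 * E) := by gcongr
        _ = _ := by ring
    have h6 : |β| * H ≤ 16 * (E ^ 2 * κ) + 8 * E ^ 2 * |β| := by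
      calc |β| * H ≤ |β| * (4 * E * L) := by gcongr
        _ = 4 * E * (L * |β|) := by ring
        _ ≤ 4 * E * (E * (4 * κ + 2 * |β|)) := by gcongr
        _ = _ := by ring
    have h7 : |β| * (16 * E ^ 2) ≤ |β| * H := by gcongr
    linarith

end Recurrence

section Weyl

open Polynomial

lemma norm_sum_sq_eq (g : ℕ → ℂ) (hg : ∀ x, ‖g x‖ = 1) (N : ℕ) :
    ‖∑ x ∈ range N, g x‖ ^ 2 + N =
      2 * (∑ h ∈ range N, ∑ x ∈ range (N - h), g (x + h) * (starRingEnd ℂ) (g x)).re := by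
  induction N with
  | zero => simp
  | succ N ih =>
    have h1 : ∑ h ∈ range (N + 1), ∑ x ∈ range (N + 1 - h), g (x + h) * (starRingEnd ℂ) (g x) =
        ∑ h ∈ range N, ∑ x ∈ range (N - h), g (x + h) * (starRingEnd ℂ) (g x) +
          g N * (starRingEnd ℂ) (∑ x ∈ range (N + 1), g x) := by
      have h2 : ∀ h ∈ range (N + 1),
          ∑ x ∈ range (N + 1 - h), g (x + h) * (starRingEnd ℂ) (g x) =
          ∑ x ∈ range (N - h), g (x + h) * (starRingEnd ℂ) (g x) +
            g N * (starRingEnd ℂ) (g (N - h)) := by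
        intro h hh
        have hle : h ≤ N := Nat.lt_succ_iff.1 (mem_range.1 hh)
        rw [Nat.sub_add_comm hle, sum_range_succ, Nat.sub_add_cancel hle]
      rw [sum_congr rfl h2, sum_add_distrib, sum_range_succ _ N, Nat.sub_self, range_zero, sum_empty,
        add_zero, ← mul_sum, map_sum]
      congr 2
      exact sum_range_reflect (fun x => (starRingEnd ℂ) (g x)) (N + 1)
    have hgN : g N * (starRingEnd ℂ) (g N) = 1 := by
      rw [Complex.mul_conj, Complex.normSq_eq_norm_sq, hg]; norm_num
    rw [h1, sum_range_succ g N, map_add, mul_add, hgN, Complex.add_re, mul_add, ← ih]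
    rw [← Complex.normSq_eq_norm_sq, ← Complex.normSq_eq_norm_sq, Complex.normSq_add,
      Complex.normSq_eq_norm_sq (g N), hg, Complex.add_re, Complex.one_re]
    have h3 : (∑ x ∈ range N, g x) * (starRingEnd ℂ) (g N) =
        (starRingEnd ℂ) (g N * (starRingEnd ℂ) (∑ x ∈ range N, g x)) := by
      rw [map_mul, Complex.conj_conj, mul_comm]
    rw [h3, Complex.conj_re]
    push_cast
    ring

lemma norm_sum_sq_le (g : ℕ → ℂ) (hg : ∀ x, ‖g x‖ = 1) (N : ℕ) :
    ‖∑ x ∈ range N, g x‖ ^ 2 ≤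
      2 * ∑ h ∈ range N, ‖∑ x ∈ range (N - h), g (x + h) * (starRingEnd ℂ) (g x)‖ := by
  have h1 := norm_sum_sq_eq g hg N
  have h2 := (Complex.re_le_norm
    (∑ h ∈ range N, ∑ x ∈ range (N - h), g (x + h) * (starRingEnd ℂ) (g x))).trans (norm_sum_le _ _)
  have h3 : (0 : ℝ) ≤ N := by positivity
  linarith

lemma natDegree_taylor_sub_le {d : ℕ} {P : ℝ[X]} (hP : P.natDegree ≤ d + 1) (h : ℝ) :
    (taylor h P - P).natDegree ≤ d := by
  rw [natDegree_le_iff_coeff_eq_zero]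
  intro n hn
  rw [coeff_sub]
  rcases eq_or_lt_of_le (Nat.succ_le_of_lt hn) with h1 | h1
  · have h2 : (hasseDeriv n P).natDegree ≤ 0 := by
      refine (natDegree_hasseDeriv_le P n).trans ?_
      omega
    rw [taylor_coeff, eq_C_of_natDegree_le_zero h2, eval_C, hasseDeriv_coeff]
    simp
  · rw [coeff_eq_zero_of_natDegree_lt (p := P) (by omega),
      coeff_eq_zero_of_natDegree_lt (by rw [natDegree_taylor]; omega), sub_zero]

lemma coeff_taylor_sub {d : ℕ} {P : ℝ[X]} (hP : P.natDegree ≤ d + 1) (h : ℝ) :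
    (taylor h P - P).coeff d = (d + 1) * h * P.coeff (d + 1) := by
  have h2 : (hasseDeriv d P).natDegree < 2 := by
    have := natDegree_hasseDeriv_le P d
    omega
  rw [coeff_sub, taylor_coeff, eval_eq_sum_range' h2]
  simp only [sum_range_succ, range_zero, sum_empty, hasseDeriv_coeff]
  have h3 : (1 + d).choose d = d + 1 := by rw [add_comm, Nat.choose_succ_self_right]
  rw [h3, add_comm 1 d]
  simp
  ring

lemma four_mul_abs_le_norm_ec_sub_one {x : ℝ} (hx : |x| ≤ 1 / 2) : 4 * |x| ≤ ‖ec x - 1‖ := by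
  have h1 : ec x - 1 = ec (x / 2) * (2 * Complex.I * Complex.sin (Real.pi * x)) := by
    have e : ec x = ec (x / 2) * ec (x / 2) := by rw [← ec_add]; ring_nf
    have e1 : ec (x / 2) * ec (-(x / 2)) = 1 := by rw [← ec_add]; simp [ec_zero]
    have e2 : 2 * Complex.I * Complex.sin (Real.pi * x) = ec (x / 2) - ec (-(x / 2)) := by
      rw [ec_eq, ec_eq, Complex.exp_mul_I, Complex.exp_mul_I]
      push_cast
      have a1 : (2 * Real.pi * (-(x / 2)) : ℂ) = -(Real.pi * x) := by ring
      have a2 : (2 * Real.pi * (x / 2) : ℂ) = Real.pi * x := by ring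
      rw [a1, a2, Complex.cos_neg, Complex.sin_neg]
      ring
    rw [e2, mul_sub, e1, ← e]
  rw [h1, norm_mul, norm_ec, one_mul, norm_mul, norm_mul, Complex.norm_I, Complex.norm_ofNat,
    mul_one, ← Complex.ofReal_mul, ← Complex.ofReal_sin, Complex.norm_real, Real.norm_eq_abs]
  have h2 : |Real.pi * x| ≤ Real.pi / 2 := by
    rw [abs_mul, abs_of_pos Real.pi_pos]
    nlinarith [Real.pi_pos]
  have h3 := Real.mul_abs_le_abs_sin h2
  rw [abs_mul, abs_of_pos Real.pi_pos] at h3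
  have h4 : 2 / Real.pi * (Real.pi * |x|) = 2 * |x| := by field_simp
  linarith

lemma exists_int_abs_sub_le_half (x : ℝ) : ∃ m : ℤ, |x - m| ≤ 1 / 2 :=
  ⟨round x, abs_sub_round x⟩

lemma norm_geom_ec_mul_le {θ c : ℝ} {m : ℤ} (hm : |θ - m| ≤ 1 / 2) (N : ℕ) :
    |θ - m| * ‖∑ x ∈ range N, ec (c + θ * x)‖ ≤ 1 / 2 := by
  have h1 : (ec (θ - m) - 1) * ∑ x ∈ range N, ec (c + θ * x) = ec (c + θ * N) - ec c := by
    have e : ec (θ - m) = ec θ := by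
      rw [sub_eq_add_neg, ← Int.cast_neg, ec_add_int]
    rw [e, sub_mul, one_mul, mul_sum, ← sum_sub_distrib]
    have h2 : ∀ x ∈ range N, ec θ * ec (c + θ * x) - ec (c + θ * x) =
        ec (c + θ * (x + 1 : ℕ)) - ec (c + θ * x) := by
      intro x _
      rw [← ec_add]
      congr 2
      push_cast
      ring
    rw [sum_congr rfl h2, sum_range_sub fun x : ℕ => ec (c + θ * x)]
    simp
  have h2 : ‖(ec (θ - m) - 1) * ∑ x ∈ range N, ec (c + θ * x)‖ ≤ 2 := by
    rw [h1]
    refine (norm_sub_le _ _).trans ?_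
    rw [norm_ec, norm_ec]
    norm_num
  rw [norm_mul] at h2
  have h3 := mul_le_mul_of_nonneg_right (four_mul_abs_le_norm_ec_sub_one hm)
    (norm_nonneg (∑ x ∈ range N, ec (c + θ * x)))
  linarith

set_option maxHeartbeats 1000000 in
/-- Weyl's inequality, in inverse form: a large exponential sum over a polynomial forces its leading
coefficient to be close to a rational number of small denominator. -/
theorem exists_approx_of_large_sum {d : ℕ} (hd : 1 ≤ d) :
    ∃ C : ℕ, 1 ≤ C ∧ ∀ (D : ℝ) (X N : ℕ) (P : ℝ[X]), 1 ≤ D → 1 ≤ X → N ≤ X → P.natDegree ≤ d →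
      (X : ℝ) ≤ D * ‖∑ x ∈ range N, ec (P.eval (x : ℝ))‖ →
      ∃ q : ℕ, 1 ≤ q ∧ (q : ℝ) ≤ C * D ^ C ∧
        ∃ m : ℤ, |q * P.coeff d - m| * (X : ℝ) ^ d ≤ C * D ^ C := by
  induction d, hd using Nat.le_induction with
  | base =>
    refine ⟨1, le_rfl, fun D X N P hD hX hN hP hlarge => ⟨1, le_rfl, by simpa using hD, ?_⟩⟩
    obtain ⟨m, hm⟩ := exists_int_abs_sub_le_half (P.coeff 1)
    refine ⟨m, ?_⟩
    have h1 : ∀ x : ℕ, P.eval (x : ℝ) = P.coeff 0 + P.coeff 1 * x := by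
      intro x
      rw [eval_eq_sum_range' (Nat.lt_succ_of_le hP)]
      simp [sum_range_succ]
    simp only [h1] at hlarge
    have h2 := norm_geom_ec_mul_le (c := P.coeff 0) hm N
    have h3 : |P.coeff 1 - m| * X ≤
        D * (|P.coeff 1 - m| * ‖∑ x ∈ range N, ec (P.coeff 0 + P.coeff 1 * x)‖) := by
      calc |P.coeff 1 - m| * X ≤ |P.coeff 1 - m| *
            (D * ‖∑ x ∈ range N, ec (P.coeff 0 + P.coeff 1 * x)‖) := by gcongr
        _ = _ := by ring
    simp only [Nat.cast_one, one_mul, pow_one]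
    nlinarith
  | succ d hd ih =>
    obtain ⟨C, hC, IH⟩ := ih
    set c : ℝ := 8 ^ (C + 1) * C with hc
    set C' : ℕ := (32 * (8 ^ (C + 1) * C) ^ 2) ^ (d + 1) + (4 * C + 4) * (d + 1) with hC'
    have hC1 : (1 : ℝ) ≤ C := by exact_mod_cast hC
    refine ⟨C', by rw [hC']; exact le_add_left (Nat.mul_pos (by omega) (by omega)), fun D X N P hD hX hN hP hlarge => ?_⟩
    have hX0 : (0 : ℝ) < X := by exact_mod_cast hX
    set D1 : ℝ := 8 * D ^ 2 with hD1
    have hD11 : 1 ≤ D1 := by nlinarith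
    set B1 : ℝ := C * D1 ^ C with hB1
    have hB11 : 1 ≤ B1 := one_le_mul_of_one_le_of_one_le hC1 (one_le_pow₀ hD11)
    set E : ℝ := D1 * B1 with hE
    have hE1 : 1 ≤ E := one_le_mul_of_one_le_of_one_le hD11 hB11
    have hB1E : B1 ≤ E := le_mul_of_one_le_left (by linarith) hD11
    have hD1E : D1 ≤ E := le_mul_of_one_le_right (by linarith) hB11
    have hEc : E = c * D ^ (2 * C + 2) := by
      rw [hE, hB1, hD1, hc]; ring
    have hfinal : (32 * E ^ 2) ^ (d + 1) ≤ C' * D ^ C' := by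
      have h1 : (32 * E ^ 2) ^ (d + 1) = (32 * c ^ 2) ^ (d + 1) * D ^ ((4 * C + 4) * (d + 1)) := by
        rw [hEc, mul_pow c, ← pow_mul, ← mul_assoc, mul_pow _ (D ^ _), ← pow_mul]
        congr 2
        ring
      rw [h1]
      have h2 : (32 * c ^ 2) ^ (d + 1) ≤ (C' : ℝ) := by
        rw [hC', hc]
        push_cast
        have : (0 : ℝ) ≤ (4 * C + 4) * (d + 1) := by positivity
        linarith
      gcongr
      rw [hC']; exact Nat.le_add_left _ _
    have hE32 : 1 ≤ 32 * E ^ 2 := by nlinarith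
    by_cases hXE : (X : ℝ) ≤ 32 * E ^ 2
    · obtain ⟨m, hm⟩ := exists_int_abs_sub_le_half (P.coeff (d + 1))
      refine ⟨1, le_rfl, ?_, m, ?_⟩
      · rw [Nat.cast_one]
        exact (one_le_pow₀ hE32).trans hfinal
      · rw [Nat.cast_one, one_mul]
        refine le_trans ?_ hfinal
        calc |P.coeff (d + 1) - m| * (X : ℝ) ^ (d + 1) ≤ 1 * (32 * E ^ 2) ^ (d + 1) := by
              gcongr
              linarith
          _ = _ := one_mul _
    push Not at hXE
    -- the differenced sums
    set T : ℕ → ℝ := fun h => ‖∑ x ∈ range (N - h), ec ((taylor (h : ℝ) P - P).eval (x : ℝ))‖ with hT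
    have hTX : ∀ h, T h ≤ X := by
      intro h
      refine (norm_sum_le _ _).trans ?_
      simp only [norm_ec, sum_const, card_range, nsmul_eq_mul, mul_one]
      exact_mod_cast (Nat.sub_le N h).trans hN
    have hsq : (X : ℝ) ^ 2 ≤ 2 * D ^ 2 * ∑ h ∈ range N, T h := by
      have h1 := norm_sum_sq_le (fun x : ℕ => ec (P.eval (x : ℝ))) (fun _ => norm_ec _) N
      have h2 : ∀ h x : ℕ, ec (P.eval ((x + h : ℕ) : ℝ)) * (starRingEnd ℂ) (ec (P.eval (x : ℝ))) =
          ec ((taylor (h : ℝ) P - P).eval (x : ℝ)) := by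
        intro h x
        rw [← ec_neg, ← ec_add, eval_sub, taylor_eval, sub_eq_add_neg]
        push_cast
        rfl
      simp only [h2] at h1
      calc (X : ℝ) ^ 2 ≤ (D * ‖∑ x ∈ range N, ec (P.eval (x : ℝ))‖) ^ 2 := by gcongr
        _ = D ^ 2 * ‖∑ x ∈ range N, ec (P.eval (x : ℝ))‖ ^ 2 := mul_pow _ _ _
        _ ≤ D ^ 2 * (2 * ∑ h ∈ range N, T h) := by gcongr
        _ = _ := by ring
    set G : Finset ℕ := {h ∈ range N | 1 ≤ h ∧ (X : ℝ) ≤ D1 * T h} with hG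
    have hGcard : (X : ℝ) ≤ D1 * G.card := by
      have h1 : ∑ h ∈ range N, T h ≤ ∑ h ∈ range N, (X / D1 +
          ((if h ∈ G then (X : ℝ) else 0) + (if h = 0 then (X : ℝ) else 0))) := by
        refine sum_le_sum fun h hh => ?_
        by_cases hG' : h ∈ G
        · rw [if_pos hG']
          have h3 : (0 : ℝ) ≤ if h = 0 then (X : ℝ) else 0 := by split_ifs <;> positivity
          have h4 : 0 ≤ X / D1 := by positivity
          linarith [hTX h]
        rcases Nat.eq_zero_or_pos h with h0 | h0
        · rw [if_pos h0, if_neg hG']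
          have h4 : 0 ≤ X / D1 := by positivity
          linarith [hTX h]
        · have h5 : D1 * T h < X := by
            by_contra! hcon
            exact hG' (mem_filter.2 ⟨hh, h0, hcon⟩)
          have h6 : T h ≤ X / D1 := by rw [le_div_iff₀ (by linarith)]; linarith
          rw [if_neg hG', if_neg (by omega)]
          linarith
      have h2 : ∑ h ∈ range N, (X / D1 +
          ((if h ∈ G then (X : ℝ) else 0) + (if h = 0 then (X : ℝ) else 0))) ≤
          X * (X / D1) + (G.card * X + X) := by
        rw [sum_add_distrib, sum_add_distrib]
        have h3 : ∑ h ∈ range N, (if h ∈ G then (X : ℝ) else 0) ≤ G.card * X := by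
          rw [← sum_filter, sum_const, nsmul_eq_mul]
          gcongr
          exact fun x hx => (mem_filter.1 hx).2
        have h4 : ∑ h ∈ range N, (if h = 0 then (X : ℝ) else 0) ≤ X := by
          rw [sum_ite_eq']
          split_ifs <;> linarith
        have h5 : ∑ h ∈ range N, (X : ℝ) / D1 ≤ X * (X / D1) := by
          rw [sum_const, card_range, nsmul_eq_mul]
          gcongr
        linarith
      have h3 : (X : ℝ) ^ 2 ≤ 2 * D ^ 2 * (X * (X / D1) + (G.card * X + X)) := by
        refine hsq.trans ?_
        gcongr
        exact h1.trans h2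
      have h4 : 2 * D ^ 2 * (X * (X / D1) + (G.card * X + X)) =
          X * (X / 4 + D1 / 4 * G.card + D1 / 4) := by
        rw [hD1]
        field_simp
        ring
      rw [h4, pow_two] at h3
      have h5 := le_of_mul_le_mul_left h3 hX0
      have h6 : D1 ≤ X := by nlinarith
      have h7 : 0 ≤ D1 * G.card := by positivity
      linarith
    -- denominators for each good shift
    have hq : ∀ h ∈ G, ∃ q : ℕ, 1 ≤ q ∧ (q : ℝ) ≤ B1 ∧
        ∃ m : ℤ, |h * (q * (d + 1) * P.coeff (d + 1)) - m| * (X : ℝ) ^ d ≤ B1 := by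
      intro h hh
      obtain ⟨-, h1, h2⟩ := mem_filter.1 hh
      obtain ⟨q, hq1, hq2, m, hm⟩ := IH D1 X (N - h) (taylor (h : ℝ) P - P) hD11 hX
        ((Nat.sub_le N h).trans hN) (natDegree_taylor_sub_le hP h) h2
      refine ⟨q, hq1, hq2, m, ?_⟩
      rw [coeff_taylor_sub hP] at hm
      convert hm using 4
      ring
    choose! Q hQ1 hQ2 hQ3 using hq
    have hmaps : ∀ h ∈ G, Q h ∈ Icc 1 ⌊B1⌋₊ := fun h hh =>
      mem_Icc.2 ⟨hQ1 h hh, Nat.le_floor (hQ2 h hh)⟩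
    obtain ⟨q, hqmem, hqcard⟩ : ∃ q ∈ Icc 1 ⌊B1⌋₊, (X : ℝ) ≤ E * #{h ∈ G | Q h = q} := by
      by_contra! hcon
      have h1 := card_eq_sum_card_fiberwise hmaps
      have hne : (Icc 1 ⌊B1⌋₊).Nonempty := nonempty_Icc.2 (Nat.le_floor (by simpa using hB11))
      have h2 : E * G.card < ∑ q ∈ Icc 1 ⌊B1⌋₊, (X : ℝ) := by
        rw [h1]
        push_cast
        rw [mul_sum]
        exact sum_lt_sum_of_nonempty hne hcon
      rw [sum_const, Nat.card_Icc, nsmul_eq_mul, Nat.add_sub_cancel] at h2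
      have h3 : (⌊B1⌋₊ : ℝ) ≤ B1 := Nat.floor_le (by linarith)
      have h4 : (⌊B1⌋₊ : ℝ) * X ≤ B1 * X := by gcongr
      have h5 : B1 * X ≤ B1 * (D1 * G.card) := by gcongr
      rw [hE] at h2
      linarith
    rw [mem_Icc] at hqmem
    have hqB : (q : ℝ) ≤ B1 := (Nat.le_floor_iff (by linarith)).1 hqmem.2
    have hXd : (X : ℝ) ≤ (X : ℝ) ^ d := le_self_pow₀ (by exact_mod_cast hX) (by omega)
    obtain ⟨e, he1, he2, m, hm⟩ := exists_approx_of_recurrent (H := X) (A := {h ∈ G | Q h = q})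
      (θ := q * (d + 1) * P.coeff (d + 1)) (κ := B1 / (X : ℝ) ^ d) (E := E)
      (fun h hh => by
        obtain ⟨h1, h2, -⟩ := mem_filter.1 (mem_filter.1 hh).1
        rw [mem_range] at h1
        exact mem_Icc.2 ⟨h2, by omega⟩) hE1 (by positivity)
      (by
        rw [mul_div_assoc', mul_div_assoc', div_lt_one (by positivity)]
        calc 32 * (E * B1) ≤ 32 * (E * E) := by gcongr
          _ = 32 * E ^ 2 := by ring
          _ < X := hXE
          _ ≤ _ := hXd)
      (by nlinarith) hqcard
      (fun h hh => by
        obtain ⟨h1, h2⟩ := mem_filter.1 hh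
        obtain ⟨m, hm⟩ := hQ3 h h1
        rw [h2] at hm
        exact ⟨m, by rwa [le_div_iff₀ (by positivity)]⟩)
    have hsq2 : (32 * E ^ 2) ^ 2 ≤ (32 * E ^ 2) ^ (d + 1) := pow_le_pow_right₀ hE32 (by omega)
    refine ⟨e * (q * (d + 1)), ?_, ?_, m, ?_⟩
    · exact Nat.mul_pos he1 (Nat.mul_pos hqmem.1 (by omega))
    · refine le_trans ?_ hfinal
      push_cast
      calc (e : ℝ) * (q * (d + 1)) ≤ 2 * E * (E * (d + 1)) := by
            have := hqB.trans hB1E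
            gcongr
        _ = E ^ 2 * (2 * (d + 1)) := by ring
        _ ≤ (E ^ 2) ^ (d + 1) * 32 ^ (d + 1) := by
            have h1 : E ^ 2 ≤ (E ^ 2) ^ (d + 1) := le_self_pow₀ (one_le_pow₀ hE1) (by omega)
            have h2 : (2 * (d + 1) : ℝ) ≤ 32 ^ (d + 1) := by
              have h3 : d + 1 < 2 ^ (d + 1) := Nat.lt_two_pow_self
              have h4 : ((d + 1 : ℕ) : ℝ) ≤ 2 ^ (d + 1) := by exact_mod_cast h3.le
              have h5 : (2 : ℝ) * 2 ^ (d + 1) ≤ 16 ^ (d + 1) * 2 ^ (d + 1) := by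
                gcongr
                exact (by norm_num : (2 : ℝ) ≤ 16).trans (le_self_pow₀ (by norm_num) (by omega))
              rw [← mul_pow] at h5
              norm_num at h5
              push_cast at h4
              linarith
            gcongr
        _ = _ := by rw [mul_pow 32, mul_comm]
    · refine le_trans ?_ hfinal
      have h1 : |((e * (q * (d + 1)) : ℕ) : ℝ) * P.coeff (d + 1) - m| * (X : ℝ) ^ (d + 1) =
          |e * (q * (d + 1) * P.coeff (d + 1)) - m| * X * (X : ℝ) ^ d := by
        push_cast
        rw [pow_succ', ← mul_assoc]
        congr 3
        ring_nf
      rw [h1]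
      calc |e * (q * (d + 1) * P.coeff (d + 1)) - m| * X * (X : ℝ) ^ d
          ≤ 32 * (B1 / (X : ℝ) ^ d) * E ^ 2 * (X : ℝ) ^ d := by gcongr
        _ = 32 * B1 * E ^ 2 := by field_simp
        _ ≤ (32 * E ^ 2) ^ 2 := by
            have : B1 ≤ E ^ 2 := hB1E.trans (le_self_pow₀ hE1 (by norm_num))
            nlinarith [mul_le_mul_of_nonneg_right this (by positivity : 0 ≤ E ^ 2)]
        _ ≤ _ := hsq2

end Weyl

end Waring

namespace Waring

open Finset

section Blocks

lemma sum_Icc_one_eq_sum_range {M : Type*} [AddCommMonoid M] (f : ℕ → M) (n : ℕ) :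
    ∑ x ∈ Icc 1 n, f x = ∑ x ∈ range n, f (x + 1) := by
  induction n with
  | zero => simp
  | succ n ih => rw [sum_Icc_succ_top (by omega), ih, sum_range_succ]

lemma norm_block_sub_le {q : ℕ} (hq : 1 ≤ q) {c : ℕ → ℂ} (hc1 : ∀ x, ‖c x‖ ≤ 1) {g : ℝ → ℂ}
    (hg : Continuous g) {L A : ℝ} (hL : 0 ≤ L)
    (hLip : ∀ x ∈ Set.Icc A (A + q), ∀ y ∈ Set.Icc A (A + q), ‖g x - g y‖ ≤ L * |x - y|) :
    ‖∑ x ∈ range q, c (x + 1) * g (A + (x + 1 : ℕ)) -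
      ((q : ℂ)⁻¹ * ∑ x ∈ range q, c (x + 1)) * ∫ γ in A..(A + q), g γ‖ ≤ q * (L * q) := by
  have hq0 : (q : ℂ) ≠ 0 := by exact_mod_cast (by omega : q ≠ 0)
  have hqR : (0 : ℝ) < q := by exact_mod_cast hq
  have h1 : ∑ x ∈ range q, c (x + 1) * g (A + (x + 1 : ℕ)) -
      ((q : ℂ)⁻¹ * ∑ x ∈ range q, c (x + 1)) * ∫ γ in A..(A + q), g γ =
      ∑ x ∈ range q, c (x + 1) * ((q : ℂ)⁻¹ * ∫ γ in A..(A + q), (g (A + (x + 1 : ℕ)) - g γ)) := by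
    rw [mul_assoc, sum_mul, mul_sum, ← sum_sub_distrib]
    refine sum_congr rfl fun x _ => ?_
    rw [intervalIntegral.integral_sub (by simp) (hg.intervalIntegrable _ _)]
    simp only [intervalIntegral.integral_const, add_sub_cancel_left, Complex.real_smul,
      Complex.ofReal_natCast]
    field_simp
  rw [h1]
  refine (norm_sum_le _ _).trans ?_
  have : ∀ x ∈ range q,
      ‖c (x + 1) * ((q : ℂ)⁻¹ * ∫ γ in A..(A + q), (g (A + (x + 1 : ℕ)) - g γ))‖ ≤ L * q := by
    intro x hx
    have hx' : ((x + 1 : ℕ) : ℝ) ≤ q := by exact_mod_cast mem_range.1 hx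
    have h2 : ‖∫ γ in A..(A + q), (g (A + (x + 1 : ℕ)) - g γ)‖ ≤ L * q * |A + q - A| := by
      refine intervalIntegral.norm_integral_le_of_norm_le_const fun γ hγ => ?_
      rw [Set.uIoc_of_le (by linarith)] at hγ
      have hx0 : (0 : ℝ) ≤ ((x + 1 : ℕ) : ℝ) := by positivity
      refine (hLip _ ⟨by linarith, by linarith⟩ _ ⟨hγ.1.le, hγ.2⟩).trans ?_
      refine mul_le_mul_of_nonneg_left ?_ hL
      rw [abs_le]; constructor <;> linarith [hγ.1, hγ.2]
    rw [add_sub_cancel_left, abs_of_pos hqR] at h2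
    rw [norm_mul, norm_mul, norm_inv, Complex.norm_natCast]
    calc ‖c (x + 1)‖ * ((q : ℝ)⁻¹ * ‖∫ γ in A..(A + q), (g (A + (x + 1 : ℕ)) - g γ)‖)
        ≤ 1 * ((q : ℝ)⁻¹ * (L * q * q)) := by gcongr; exact hc1 _
      _ = L * q := by field_simp
  refine (sum_le_card_nsmul _ _ _ this).trans ?_
  simp

lemma norm_sum_sub_integral_le {q : ℕ} (hq : 1 ≤ q) {c : ℕ → ℂ} (hc1 : ∀ x, ‖c x‖ ≤ 1)
    (hper : ∀ x, c (x + q) = c x) {g : ℝ → ℂ} (hg : Continuous g) (hg1 : ∀ x, ‖g x‖ ≤ 1)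
    {X : ℕ} {L : ℝ} (hL : 0 ≤ L)
    (hLip : ∀ x ∈ Set.Icc (0 : ℝ) X, ∀ y ∈ Set.Icc (0 : ℝ) X, ‖g x - g y‖ ≤ L * |x - y|) :
    ‖∑ x ∈ range X, c (x + 1) * g (x + 1 : ℕ) -
      ((q : ℂ)⁻¹ * ∑ x ∈ range q, c (x + 1)) * ∫ γ in (0 : ℝ)..X, g γ‖ ≤
      2 * q + q * L * X := by
  have hqR : (0 : ℝ) < q := by exact_mod_cast hq
  have hperm : ∀ j x, c (j * q + x) = c x := by
    intro j x
    induction j with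
    | zero => simp
    | succ j ih => rw [← ih, ← hper (j * q + x)]; congr 1; ring
  set G := (q : ℂ)⁻¹ * ∑ x ∈ range q, c (x + 1) with hG
  have hG1 : ‖G‖ ≤ 1 := by
    rw [hG, norm_mul, norm_inv, Complex.norm_natCast]
    have : ‖∑ x ∈ range q, c (x + 1)‖ ≤ q := by
      refine (norm_sum_le _ _).trans ((sum_le_card_nsmul _ _ 1 fun x _ => hc1 _).trans ?_)
      simp
    calc (q : ℝ)⁻¹ * ‖∑ x ∈ range q, c (x + 1)‖ ≤ (q : ℝ)⁻¹ * q := by gcongr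
      _ = 1 := by field_simp
  have hblocks : ∀ J : ℕ, J * q ≤ X →
      ‖∑ x ∈ range (J * q), c (x + 1) * g (x + 1 : ℕ) - G * ∫ γ in (0 : ℝ)..(J * q : ℕ), g γ‖ ≤
        J * (q * (L * q)) := by
    intro J
    induction J with
    | zero => simp
    | succ J ih =>
      intro hJ
      have hJ' : J * q + q ≤ X := by rw [← Nat.succ_mul]; exact hJ
      have hJR : ((J * q : ℕ) : ℝ) + q ≤ X := by exact_mod_cast hJ'
      have hJ0 : (0 : ℝ) ≤ ((J * q : ℕ) : ℝ) := by positivity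
      have h1 := ih (by omega)
      have h2 := norm_block_sub_le hq hc1 hg (A := ((J * q : ℕ) : ℝ)) hL fun x hx y hy =>
        hLip x ⟨by linarith [hx.1], by linarith [hx.2]⟩ y ⟨by linarith [hy.1], by linarith [hy.2]⟩
      rw [Nat.succ_mul, sum_range_add, Nat.cast_add (J * q) q,
        ← intervalIntegral.integral_add_adjacent_intervals (b := ((J * q : ℕ) : ℝ))
          (hg.intervalIntegrable _ _) (hg.intervalIntegrable _ _)]
      have h3 : ∑ x ∈ range q, c (J * q + x + 1) * g ((J * q + x + 1 : ℕ) : ℝ) =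
          ∑ x ∈ range q, c (x + 1) * g (((J * q : ℕ) : ℝ) + (x + 1 : ℕ)) := by
        refine sum_congr rfl fun x _ => ?_
        rw [add_assoc, hperm, Nat.cast_add (J * q) (x + 1)]
      rw [h3, mul_add, add_sub_add_comm]
      refine (norm_add_le _ _).trans ?_
      push_cast at h1 h2 ⊢
      linarith
  set J := X / q with hJ
  have hXe : J * q + X % q = X := by rw [hJ, mul_comm]; exact Nat.div_add_mod X q
  have hr : X % q < q := Nat.mod_lt _ (by omega)
  have hrR : ((X % q : ℕ) : ℝ) ≤ q := by exact_mod_cast hr.le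
  have hJX : J * q ≤ X := by omega
  have hXR : ((J * q : ℕ) : ℝ) + (X % q : ℕ) = X := by exact_mod_cast hXe
  have h1 := hblocks J hJX
  have h2 : ‖∑ x ∈ range (X % q), c (J * q + x + 1) * g ((J * q + x + 1 : ℕ) : ℝ)‖ ≤ q := by
    refine (norm_sum_le _ _).trans ((sum_le_card_nsmul _ _ 1 fun x _ => ?_).trans ?_)
    · rw [norm_mul]; exact mul_le_one₀ (hc1 _) (norm_nonneg _) (hg1 _)
    · simpa using hrR
  have h3 : ‖G * ∫ γ in ((J * q : ℕ) : ℝ)..X, g γ‖ ≤ q := by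
    rw [norm_mul]
    have := intervalIntegral.norm_integral_le_of_norm_le_const (a := ((J * q : ℕ) : ℝ)) (b := X)
      (f := g) (C := 1) fun x _ => hg1 x
    rw [← hXR, add_sub_cancel_left, abs_of_nonneg (by positivity), hXR] at this
    nlinarith [norm_nonneg G, norm_nonneg (∫ γ in ((J * q : ℕ) : ℝ)..X, g γ)]
  have h4 : ∑ x ∈ range X, c (x + 1) * g (x + 1 : ℕ) - G * ∫ γ in (0 : ℝ)..X, g γ =
      (∑ x ∈ range (J * q), c (x + 1) * g (x + 1 : ℕ) - G * ∫ γ in (0 : ℝ)..(J * q : ℕ), g γ) +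
      ∑ x ∈ range (X % q), c (J * q + x + 1) * g ((J * q + x + 1 : ℕ) : ℝ) -
      G * ∫ γ in ((J * q : ℕ) : ℝ)..X, g γ := by
    rw [← intervalIntegral.integral_add_adjacent_intervals (b := ((J * q : ℕ) : ℝ))
          (hg.intervalIntegrable 0 _) (hg.intervalIntegrable _ (X : ℝ))]
    nth_rewrite 1 [← hXe]
    rw [sum_range_add]
    ring
  rw [h4]
  refine (norm_sub_le _ _).trans ?_
  have h5 := norm_add_le (∑ x ∈ range (J * q), c (x + 1) * g (x + 1 : ℕ) -
      G * ∫ γ in (0 : ℝ)..(J * q : ℕ), g γ)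
    (∑ x ∈ range (X % q), c (J * q + x + 1) * g ((J * q + x + 1 : ℕ) : ℝ))
  have h6 : (J : ℝ) * (q * (L * q)) ≤ q * L * X := by
    have : (J : ℝ) * q ≤ X := by exact_mod_cast hJX
    calc (J : ℝ) * (q * (L * q)) = (q * L) * (J * q) := by ring
      _ ≤ (q * L) * X := by gcongr
  linarith

end Blocks

section Approximation

/-- The normalised complete exponential sum `q⁻¹ ∑ e(a xᵏ / q)`. -/
noncomputable def gsum (k q a : ℕ) : ℂ :=
  (q : ℂ)⁻¹ * ∑ x ∈ Icc 1 q, ec ((a : ℝ) * (x : ℝ) ^ k / (q : ℝ))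

/-- The generating integral `∫₀ᴬ e(β γᵏ) dγ`. -/
noncomputable def vint (k : ℕ) (A β : ℝ) : ℂ := ∫ γ in (0 : ℝ)..A, ec (β * γ ^ k)

lemma norm_ec_sub_le (x y : ℝ) : ‖ec x - ec y‖ ≤ 2 * Real.pi * |x - y| := by
  have h : ec x - ec y = ec y * (ec (x - y) - 1) := by
    rw [mul_sub, ← ec_add, mul_one]; congr 2; ring
  rw [h, norm_mul, norm_ec, one_mul, ec_eq, mul_comm]
  refine (Real.norm_exp_I_mul_ofReal_sub_one_le).trans ?_
  rw [Real.norm_eq_abs, abs_mul, abs_of_pos Real.two_pi_pos]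

lemma norm_ec_mul_pow_sub_le (k : ℕ) (β : ℝ) {X x y : ℝ} (hx : x ∈ Set.Icc 0 X)
    (hy : y ∈ Set.Icc 0 X) :
    ‖ec (β * x ^ k) - ec (β * y ^ k)‖ ≤ 2 * Real.pi * |β| * k * X ^ (k - 1) * |x - y| := by
  refine (norm_ec_sub_le _ _).trans ?_
  rw [← mul_sub, abs_mul]
  have h1 := abs_pow_sub_pow_le (a := x) (b := y) (n := k)
  have h2 : max |x| |y| ≤ X := by
    rw [abs_of_nonneg hx.1, abs_of_nonneg hy.1]; exact max_le hx.2 hy.2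
  have h3 : max |x| |y| ^ (k - 1) ≤ X ^ (k - 1) :=
    pow_le_pow_left₀ (le_max_of_le_left (abs_nonneg _)) h2 _
  have h4 : |x ^ k - y ^ k| ≤ |x - y| * k * X ^ (k - 1) := h1.trans (by gcongr)
  calc 2 * Real.pi * (|β| * |x ^ k - y ^ k|) ≤ 2 * Real.pi * (|β| * (|x - y| * k * X ^ (k - 1))) := by
        gcongr
    _ = _ := by ring

lemma weylSum_approx {k : ℕ} (hk : 1 ≤ k) {q : ℕ} (hq : 1 ≤ q) (a X : ℕ) (β : ℝ) :
    ‖weylSum k X (a / q + β) - gsum k q a * vint k X β‖ ≤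
      2 * Real.pi * k * q * (1 + (X : ℝ) ^ k * |β|) := by
  have hqR : (q : ℝ) ≠ 0 := by exact_mod_cast (by omega : q ≠ 0)
  have hper : ∀ x : ℕ, ec ((a : ℝ) * ((x + q : ℕ) : ℝ) ^ k / (q : ℝ)) =
      ec ((a : ℝ) * (x : ℝ) ^ k / (q : ℝ)) := by
    intro x
    have hd : (q : ℤ) ∣ ((x + q : ℕ) : ℤ) ^ k - (x : ℤ) ^ k := by
      refine dvd_trans ?_ (sub_dvd_pow_sub_pow _ _ k)
      push_cast; simp
    obtain ⟨m, hm⟩ := hd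
    have hm' : ((x + q : ℕ) : ℝ) ^ k = (x : ℝ) ^ k + q * m := by
      have : (((x + q : ℕ) : ℤ) ^ k - (x : ℤ) ^ k : ℝ) = ((q * m : ℤ) : ℝ) := by
        exact_mod_cast congrArg (Int.cast : ℤ → ℝ) hm
      push_cast at this ⊢
      linarith
    rw [hm', show (a : ℝ) * ((x : ℝ) ^ k + q * m) / q = a * (x : ℝ) ^ k / q + ((a * m : ℤ) : ℝ) by
      push_cast; field_simp, ec_add_int]
  have h := norm_sum_sub_integral_le hq (c := fun x => ec ((a : ℝ) * (x : ℝ) ^ k / (q : ℝ)))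
    (fun x => (norm_ec _).le) hper (g := fun γ => ec (β * γ ^ k)) (by fun_prop)
    (fun x => (norm_ec _).le) (X := X) (L := 2 * Real.pi * |β| * k * (X : ℝ) ^ (k - 1))
    (by positivity) (fun x hx y hy => norm_ec_mul_pow_sub_le k β hx hy)
  rw [← sum_Icc_one_eq_sum_range (fun x => ec ((a : ℝ) * (x : ℝ) ^ k / (q : ℝ)) * ec (β * (x : ℝ) ^ k)),
    ← sum_Icc_one_eq_sum_range (fun x => ec ((a : ℝ) * (x : ℝ) ^ k / (q : ℝ)))] at h
  have hw : weylSum k X (a / q + β) =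
      ∑ x ∈ Icc 1 X, ec ((a : ℝ) * (x : ℝ) ^ k / (q : ℝ)) * ec (β * (x : ℝ) ^ k) := by
    refine sum_congr rfl fun x _ => ?_
    rw [← ec_add]; congr 1; ring
  rw [hw]
  refine h.trans ?_
  have hX : (X : ℝ) ^ (k - 1) * X = (X : ℝ) ^ k := by
    rw [← pow_succ]; congr 1; omega
  have hkR : (1 : ℝ) ≤ k := by exact_mod_cast hk
  have hπ := Real.pi_gt_three
  calc 2 * (q : ℝ) + q * (2 * Real.pi * |β| * k * (X : ℝ) ^ (k - 1)) * X
      = 2 * q * 1 * 1 + 2 * Real.pi * k * q * ((X : ℝ) ^ k * |β|) := by rw [← hX]; ring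
    _ ≤ 2 * q * Real.pi * k + 2 * Real.pi * k * q * ((X : ℝ) ^ k * |β|) := by
        gcongr; linarith
    _ = _ := by ring

lemma norm_gsum_le_one (k q a : ℕ) : ‖gsum k q a‖ ≤ 1 := by
  rw [gsum, norm_mul, norm_inv, Complex.norm_natCast]
  have : ‖∑ x ∈ Icc 1 q, ec ((a : ℝ) * (x : ℝ) ^ k / (q : ℝ))‖ ≤ q := by
    refine (norm_sum_le _ _).trans ((sum_le_card_nsmul _ _ 1 fun x _ => (norm_ec _).le).trans ?_)
    simp
  exact inv_mul_le_one_of_le₀ this (by positivity)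

lemma vint_eq {k : ℕ} {A : ℝ} (hA : A ≠ 0) (β : ℝ) : vint k A β = A * vint k 1 (A ^ k * β) := by
  have h := intervalIntegral.integral_comp_mul_left (a := 0) (b := 1) (c := A)
    (fun γ => ec (β * γ ^ k)) hA
  have h2 : vint k 1 (A ^ k * β) = ∫ γ in (0 : ℝ)..1, ec (β * (A * γ) ^ k) := by
    refine intervalIntegral.integral_congr fun γ _ => ?_
    simp only [mul_pow]; congr 1; ring
  rw [h2, h, Complex.real_smul, mul_zero, mul_one, vint, ← mul_assoc, ← Complex.ofReal_mul,
    mul_inv_cancel₀ hA, Complex.ofReal_one, one_mul]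

lemma norm_vint_le {k : ℕ} {A : ℝ} (hA : 0 ≤ A) (β : ℝ) : ‖vint k A β‖ ≤ A := by
  have := intervalIntegral.norm_integral_le_of_norm_le_const (a := 0) (b := A)
    (f := fun γ => ec (β * γ ^ k)) (C := 1) fun x _ => (norm_ec _).le
  rwa [sub_zero, abs_of_nonneg hA, one_mul] at this

lemma continuous_vint (k : ℕ) (A : ℝ) : Continuous (vint k A) :=
  intervalIntegral.continuous_parametric_intervalIntegral_of_continuous' (by fun_prop) _ _

end Approximation

end Waring

namespace Waring

open Finset

section Decay

lemma hasDerivAt_ec_mul_pow (k : ℕ) (u x : ℝ) :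
    HasDerivAt (fun γ : ℝ => ec (u * γ ^ k))
      ((2 * Real.pi * Complex.I * u * k : ℂ) * ((x ^ (k - 1) : ℝ) : ℂ) * ec (u * x ^ k)) x := by
  have h1 : HasDerivAt (fun γ : ℝ => ((u * γ ^ k : ℝ) : ℂ))
      ((u * (k * x ^ (k - 1)) : ℝ) : ℂ) x :=
    ((hasDerivAt_pow k x).const_mul u).ofReal_comp
  have h2 := ((h1.const_mul (2 * Real.pi * Complex.I)).cexp)
  refine h2.congr_deriv ?_
  rw [ec]
  push_cast
  ring

lemma norm_integral_ec_mul_pow_le {k : ℕ} (hk : 1 ≤ k) {u δ : ℝ} (hu : u ≠ 0) (hδ : 0 < δ)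
    (hδ1 : δ ≤ 1) : ‖∫ γ in δ..1, ec (u * γ ^ k)‖ ≤ (|u| * δ ^ (k - 1))⁻¹ := by
  set h : ℝ → ℝ := fun γ => (γ ^ (k - 1))⁻¹ with hh
  set h' : ℝ → ℝ := fun γ => -(((k - 1 : ℕ) : ℝ) * γ ^ (k - 1 - 1)) / (γ ^ (k - 1)) ^ 2 with hh'
  have hpos : ∀ x ∈ Set.uIcc δ 1, 0 < x := by
    intro x hx
    rw [Set.uIcc_of_le hδ1] at hx
    linarith [hx.1]
  have hd : ∀ x ∈ Set.uIcc δ 1, HasDerivAt h (h' x) x := fun x hx =>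
    (hasDerivAt_pow (k - 1) x).inv (pow_ne_zero _ (hpos x hx).ne')
  have hdc : ∀ x ∈ Set.uIcc δ 1, HasDerivAt (fun γ => ((h γ : ℝ) : ℂ)) ((h' x : ℝ) : ℂ) x :=
    fun x hx => (hd x hx).ofReal_comp
  have hcont : ContinuousOn h' (Set.uIcc δ 1) := by
    refine ContinuousOn.div (by fun_prop) (by fun_prop) fun x hx => ?_
    exact pow_ne_zero _ (pow_ne_zero _ (hpos x hx).ne')
  have hInt' : IntervalIntegrable h' MeasureTheory.volume δ 1 := hcont.intervalIntegrable
  have hintc : IntervalIntegrable (fun γ => ((h' γ : ℝ) : ℂ)) MeasureTheory.volume δ 1 :=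
    (Complex.continuous_ofReal.comp_continuousOn hcont).intervalIntegrable
  set c : ℂ := 2 * Real.pi * Complex.I * u * k with hc
  have hvint : IntervalIntegrable (fun x : ℝ => c * ((x ^ (k - 1) : ℝ) : ℂ) * ec (u * x ^ k))
      MeasureTheory.volume δ 1 := by
    apply Continuous.intervalIntegrable
    fun_prop
  have hparts := intervalIntegral.integral_mul_deriv_eq_deriv_mul hdc
    (fun x _ => hasDerivAt_ec_mul_pow k u x) hintc hvint
  have hl : ∫ x in δ..1, ((h x : ℝ) : ℂ) * (c * ((x ^ (k - 1) : ℝ) : ℂ) * ec (u * x ^ k)) =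
      c * ∫ x in δ..1, ec (u * x ^ k) := by
    rw [← intervalIntegral.integral_const_mul]
    refine intervalIntegral.integral_congr fun x hx => ?_
    have : ((x ^ (k - 1) : ℝ) : ℂ) ≠ 0 := by
      exact_mod_cast pow_ne_zero _ (hpos x hx).ne'
    simp only [hh, Complex.ofReal_inv]
    field_simp
  rw [hl] at hparts
  have hh0 : ∀ x ∈ Set.uIcc δ 1, 0 ≤ h x := fun x hx => by
    have := hpos x hx; simp only [hh]; positivity
  have hneg : ∀ x ∈ Set.uIcc δ 1, h' x ≤ 0 := fun x hx => by
    have := hpos x hx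
    exact div_nonpos_of_nonpos_of_nonneg (neg_nonpos.2 (by positivity)) (by positivity)
  have hlast : ‖∫ x in δ..1, ((h' x : ℝ) : ℂ) * ec (u * x ^ k)‖ ≤ h δ - h 1 := by
    have h1 : ∫ x in δ..1, h' x = h 1 - h δ :=
      intervalIntegral.integral_eq_sub_of_hasDerivAt hd hInt'
    have h2 : ‖∫ x in δ..1, ((h' x : ℝ) : ℂ) * ec (u * x ^ k)‖ ≤ ∫ x in δ..1, -h' x := by
      refine intervalIntegral.norm_integral_le_of_norm_le hδ1 ?_ hInt'.neg
      refine Filter.Eventually.of_forall fun x hx => ?_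
      have hx' : x ∈ Set.uIcc δ 1 := by rw [Set.uIcc_of_le hδ1]; exact ⟨hx.1.le, hx.2⟩
      rw [norm_mul, norm_ec, mul_one, Complex.norm_real, Real.norm_eq_abs,
        abs_of_nonpos (hneg x hx')]
    rw [intervalIntegral.integral_neg, h1] at h2
    linarith
  have hnorm : ‖c‖ * ‖∫ x in δ..1, ec (u * x ^ k)‖ ≤ 2 * h δ := by
    rw [← norm_mul, hparts]
    refine (norm_sub_le _ _).trans ?_
    have h3 := norm_sub_le (((h 1 : ℝ) : ℂ) * ec (u * 1 ^ k)) (((h δ : ℝ) : ℂ) * ec (u * δ ^ k))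
    rw [norm_mul, norm_mul, norm_ec, norm_ec, mul_one, mul_one, Complex.norm_real,
      Complex.norm_real, Real.norm_eq_abs, Real.norm_eq_abs, abs_of_nonneg (hh0 1 (by simp)),
      abs_of_nonneg (hh0 δ (by simp))] at h3
    linarith
  have hcn : ‖c‖ = 2 * Real.pi * |u| * k := by
    simp [hc, abs_of_pos Real.pi_pos]
  have hu' : 0 < |u| := abs_pos.2 hu
  have hkR : (1 : ℝ) ≤ k := by exact_mod_cast hk
  have h5 : 2 * |u| ≤ ‖c‖ := by
    rw [hcn]
    have : (1 : ℝ) ≤ Real.pi * k := by nlinarith [Real.pi_gt_three]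
    nlinarith
  have h6 : |u| * ‖∫ x in δ..1, ec (u * x ^ k)‖ ≤ h δ := by
    nlinarith [norm_nonneg (∫ x in δ..1, ec (u * x ^ k))]
  rw [mul_inv, ← div_eq_inv_mul, le_div_iff₀ hu']
  linarith

lemma norm_vint_one_le_of_pow_mul {k : ℕ} (hk : 1 ≤ k) {u δ : ℝ} (hδ : 0 < δ) (hδ1 : δ ≤ 1)
    (h : |u| * δ ^ k = 1) : ‖vint k 1 u‖ ≤ 2 * δ := by
  have hu : u ≠ 0 := by rintro rfl; simp at h
  have h1 : (|u| * δ ^ (k - 1))⁻¹ = δ := by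
    have : |u| * δ ^ (k - 1) * δ = 1 := by
      rw [mul_assoc, ← pow_succ, Nat.sub_add_cancel hk, h]
    exact inv_eq_of_mul_eq_one_right this
  have h2 := norm_integral_ec_mul_pow_le hk hu hδ hδ1
  have h3 := norm_vint_le (k := k) hδ.le u
  rw [h1] at h2
  have hcont : Continuous fun γ : ℝ => ec (u * γ ^ k) := by fun_prop
  rw [vint, ← intervalIntegral.integral_add_adjacent_intervals (b := δ)
    (hcont.intervalIntegrable _ _) (hcont.intervalIntegrable _ _)]
  refine (norm_add_le _ _).trans ?_
  rw [vint] at h3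
  linarith

lemma norm_vint_one_le {k : ℕ} (hk : 1 ≤ k) (u : ℝ) :
    ‖vint k 1 u‖ ≤ 4 * (1 + |u|) ^ (-(1 / (k : ℝ))) := by
  have hk0 : (k : ℝ) ≠ 0 := by exact_mod_cast (by omega : k ≠ 0)
  have hkR : (1 : ℝ) ≤ k := by exact_mod_cast hk
  have hk1 : 1 / (k : ℝ) ≤ 1 := by rw [div_le_one (by positivity)]; exact hkR
  have hk2 : 0 ≤ 1 / (k : ℝ) := by positivity
  have h2k : (2 : ℝ) ^ (1 / (k : ℝ)) ≤ 2 := by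
    simpa using Real.rpow_le_rpow_of_exponent_le (x := 2) (by norm_num) hk1
  have h2k' : (1 : ℝ) / 2 ≤ 2 ^ (-(1 / (k : ℝ))) := by
    rw [Real.rpow_neg (by norm_num), one_div (2 : ℝ)]
    exact inv_anti₀ (by positivity) h2k
  rcases le_total |u| 1 with hu | hu
  · have h1 := norm_vint_le (k := k) zero_le_one u
    have h3 : (2 : ℝ) ^ (-(1 / (k : ℝ))) ≤ (1 + |u|) ^ (-(1 / (k : ℝ))) :=
      Real.rpow_le_rpow_of_nonpos (by positivity) (by linarith) (by linarith)
    linarith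
  · have hu0 : 0 < |u| := by linarith
    set δ := |u| ^ (-(1 / (k : ℝ))) with hδ
    have hδ0 : 0 < δ := Real.rpow_pos_of_pos hu0 _
    have hδ1 : δ ≤ 1 := Real.rpow_le_one_of_one_le_of_nonpos hu (by linarith)
    have hδk : |u| * δ ^ k = 1 := by
      rw [hδ, ← Real.rpow_natCast, ← Real.rpow_mul hu0.le, neg_mul, one_div,
        inv_mul_cancel₀ hk0, Real.rpow_neg_one, mul_inv_cancel₀ hu0.ne']
    have h1 := norm_vint_one_le_of_pow_mul hk hδ0 hδ1 hδk
    have h3 : (2 * |u|) ^ (-(1 / (k : ℝ))) ≤ (1 + |u|) ^ (-(1 / (k : ℝ))) :=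
      Real.rpow_le_rpow_of_nonpos (by positivity) (by linarith) (by linarith)
    rw [Real.mul_rpow (by norm_num) hu0.le, ← hδ] at h3
    nlinarith

lemma norm_vint_one_pow_le {k : ℕ} (hk : 1 ≤ k) (s : ℕ) (u : ℝ) :
    ‖vint k 1 u‖ ^ s ≤ 4 ^ s * (1 + ‖u‖) ^ (-((s : ℝ) / k)) := by
  refine (pow_le_pow_left₀ (norm_nonneg _) (norm_vint_one_le hk u) s).trans ?_
  rw [mul_pow, ← Real.rpow_natCast (_ ^ _) s, ← Real.rpow_mul (by positivity), Real.norm_eq_abs]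
  refine le_of_eq ?_
  congr 2
  ring

lemma integrable_one_add_norm_rpow {k s : ℕ} (hk : 1 ≤ k) (hs : k < s) :
    MeasureTheory.Integrable fun u : ℝ => 4 ^ s * (1 + ‖u‖) ^ (-((s : ℝ) / k)) := by
  refine (integrable_one_add_norm ?_).const_mul _
  simp only [Module.finrank_self, Nat.cast_one]
  rw [one_lt_div (by exact_mod_cast hk)]
  exact_mod_cast hs

end Decay

end Waring

namespace Waring

open Finset

section GaussSum

lemma exists_approx_of_large_weylSum {k : ℕ} (hk : 1 ≤ k) :
    ∃ C : ℕ, 1 ≤ C ∧ ∀ (D : ℝ) (X : ℕ) (α : ℝ), 1 ≤ D → 1 ≤ X → (X : ℝ) ≤ D * ‖weylSum k X α‖ →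
      ∃ q : ℕ, 1 ≤ q ∧ (q : ℝ) ≤ C * D ^ C ∧
        ∃ m : ℤ, |q * α - m| * (X : ℝ) ^ k ≤ C * D ^ C := by
  obtain ⟨C, hC, h⟩ := exists_approx_of_large_sum hk
  refine ⟨C, hC, fun D X α hD hX hl => ?_⟩
  have hmonic : ((Polynomial.X + Polynomial.C (1 : ℝ)) ^ k).natDegree = k := by
    rw [Polynomial.natDegree_pow, Polynomial.natDegree_X_add_C, mul_one]
  have hco : (Polynomial.C α * (Polynomial.X + Polynomial.C (1 : ℝ)) ^ k).coeff k = α := by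
    rw [Polynomial.coeff_C_mul]
    have := (Polynomial.monic_X_add_C (1 : ℝ)).pow k
    rw [Polynomial.Monic, Polynomial.leadingCoeff, hmonic] at this
    rw [this, mul_one]
  have := h D X X (Polynomial.C α * (Polynomial.X + Polynomial.C (1 : ℝ)) ^ k) hD hX le_rfl
    ((Polynomial.natDegree_C_mul_le _ _).trans hmonic.le) (by
      rw [weylSum, sum_Icc_one_eq_sum_range (fun x : ℕ => ec (α * (x : ℝ) ^ k))] at hl
      simpa using hl)
  rwa [hco] at this

lemma weylSum_div {k q : ℕ} (hq : 1 ≤ q) (a : ℕ) : weylSum k q (a / q) = q * gsum k q a := by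
  have hq0 : (q : ℂ) ≠ 0 := by exact_mod_cast (by omega : q ≠ 0)
  rw [gsum, mul_inv_cancel_left₀ hq0, weylSum]
  refine sum_congr rfl fun x _ => ?_
  congr 1; ring

lemma exists_mul_norm_gsum_pow_le {k : ℕ} (hk : 2 ≤ k) :
    ∃ C : ℕ, 1 ≤ C ∧ ∀ q a : ℕ, 1 ≤ q → a.Coprime q → (q : ℝ) * ‖gsum k q a‖ ^ C ≤ C := by
  obtain ⟨C, hC, h⟩ := exists_approx_of_large_weylSum (k := k) (by omega)
  refine ⟨C, hC, fun q a hq hcop => ?_⟩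
  have hqR : (1 : ℝ) ≤ q := by exact_mod_cast hq
  rcases (norm_nonneg (gsum k q a)).eq_or_lt with h0 | h0
  · rw [← h0, zero_pow (by omega)]; simp
  set D := ‖gsum k q a‖⁻¹ with hD
  have hD1 : 1 ≤ D := (one_le_inv₀ h0).2 (norm_gsum_le_one k q a)
  obtain ⟨q', hq', hq'D, m, hm⟩ := h D q (a / q) hD1 hq (by
    rw [weylSum_div hq, norm_mul, Complex.norm_natCast, hD]
    exact le_of_eq (by field_simp))
  have key : (q : ℝ) ≤ C * D ^ C := by
    by_contra! hlt
    have h1 : |(q' : ℝ) * (a / q) - m| * q ^ 2 < q := by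
      have : (q : ℝ) ^ 2 ≤ q ^ k := pow_le_pow_right₀ hqR hk
      nlinarith [abs_nonneg ((q' : ℝ) * (a / q) - m)]
    have h2 : |((q' * a - m * q : ℤ) : ℝ)| < 1 := by
      have : ((q' * a - m * q : ℤ) : ℝ) = ((q' : ℝ) * (a / q) - m) * q := by
        push_cast; field_simp
      rw [this, abs_mul, abs_of_pos (by linarith : (0 : ℝ) < q)]
      nlinarith
    have h3 : (q' * a - m * q : ℤ) = 0 := by
      rw [← Int.cast_abs] at h2
      exact Int.abs_lt_one_iff.1 (by exact_mod_cast h2)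
    have h4 : (q : ℤ) ∣ q' * a := ⟨m, by linarith⟩
    have h5 : q ∣ q' := (Nat.Coprime.symm hcop).dvd_of_dvd_mul_right (by exact_mod_cast h4)
    have h6 : (q : ℝ) ≤ q' := by exact_mod_cast Nat.le_of_dvd (by omega) h5
    linarith
  calc (q : ℝ) * ‖gsum k q a‖ ^ C ≤ C * D ^ C * ‖gsum k q a‖ ^ C := by gcongr
    _ = C := by rw [mul_assoc, ← mul_pow, hD, inv_mul_cancel₀ h0.ne', one_pow, mul_one]

end GaussSum

section Arcs

/-- Pairs `⟨q, a⟩` with `q ≤ Q`, `1 ≤ a ≤ q` and `a` coprime to `q`. -/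
def farey (Q : ℕ) : Finset (Σ _ : ℕ, ℕ) :=
  (Icc 1 Q).sigma fun q => (Icc 1 q).filter fun a => a.Coprime q

/-- The arc of radius `τ` around `a / q`. -/
def arc (τ : ℝ) (p : Σ _ : ℕ, ℕ) : Set ℝ :=
  Set.Ioc ((p.2 : ℝ) / p.1 - τ) ((p.2 : ℝ) / p.1 + τ)

lemma mem_farey {Q : ℕ} {p : Σ _ : ℕ, ℕ} : p ∈ farey Q ↔
    (1 ≤ p.1 ∧ p.1 ≤ Q) ∧ (1 ≤ p.2 ∧ p.2 ≤ p.1) ∧ p.2.Coprime p.1 := by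
  simp [farey]

lemma arc_subset {Q : ℕ} {τ : ℝ} (hτ : 2 * τ * (Q : ℝ) ^ 2 ≤ 1) {p : Σ _ : ℕ, ℕ}
    (hp : p ∈ farey Q) : arc τ p ⊆ Set.Ioc τ (1 + τ) := by
  obtain ⟨⟨h1, h2⟩, ⟨h3, h4⟩, -⟩ := mem_farey.1 hp
  have h1R : (1 : ℝ) ≤ p.1 := by exact_mod_cast h1
  have h2R : (p.1 : ℝ) ≤ Q := by exact_mod_cast h2
  have h3R : (1 : ℝ) ≤ p.2 := by exact_mod_cast h3
  have h4R : (p.2 : ℝ) ≤ p.1 := by exact_mod_cast h4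
  have h5 : (p.2 : ℝ) / p.1 ≤ 1 := by rw [div_le_one (by linarith)]; exact h4R
  have h6 : 2 * τ ≤ (p.2 : ℝ) / p.1 := by
    rw [le_div_iff₀ (by linarith)]
    rcases le_or_gt τ 0 with h | h
    · nlinarith
    · have : (p.1 : ℝ) ≤ (Q : ℝ) ^ 2 := by nlinarith
      nlinarith
  intro x hx
  exact ⟨by linarith [hx.1], by linarith [hx.2]⟩

lemma farey_separated {Q : ℕ} {p p' : Σ _ : ℕ, ℕ} (hp : p ∈ farey Q) (hp' : p' ∈ farey Q)
    (hne : p ≠ p') : 1 ≤ |(p.2 : ℝ) / p.1 - (p'.2 : ℝ) / p'.1| * (Q : ℝ) ^ 2 := by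
  obtain ⟨q, a⟩ := p
  obtain ⟨q', a'⟩ := p'
  obtain ⟨⟨h1, h2⟩, -, h3⟩ := mem_farey.1 hp
  obtain ⟨⟨h1', h2'⟩, -, h3'⟩ := mem_farey.1 hp'
  dsimp only at *
  have hqR : (0 : ℝ) < q := by exact_mod_cast h1
  have hqR' : (0 : ℝ) < q' := by exact_mod_cast h1'
  have hz : (a * q' - a' * q : ℤ) ≠ 0 := by
    intro h0
    have h4 : a * q' = a' * q := by
      have : (a * q' : ℤ) = a' * q := by linarith
      exact_mod_cast this
    have h5 : q = q' := Nat.dvd_antisymm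
      ((Nat.Coprime.symm h3).dvd_of_dvd_mul_left ⟨a', by rw [h4]; ring⟩)
      ((Nat.Coprime.symm h3').dvd_of_dvd_mul_left ⟨a, by rw [← h4]; ring⟩)
    subst h5
    have h6 : a = a' := Nat.eq_of_mul_eq_mul_right h1 h4
    subst h6
    exact hne rfl
  have h4 : (1 : ℝ) ≤ |((a * q' - a' * q : ℤ) : ℝ)| := by
    rw [← Int.cast_abs]; exact_mod_cast Int.one_le_abs hz
  have h5 : (a : ℝ) / q - a' / q' = ((a * q' - a' * q : ℤ) : ℝ) / (q * q') := by
    push_cast; field_simp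
  rw [h5, abs_div, abs_of_pos (mul_pos hqR hqR'), div_mul_eq_mul_div, le_div_iff₀ (by positivity)]
  have h6 : (q : ℝ) ≤ Q := by exact_mod_cast h2
  have h7 : (q' : ℝ) ≤ Q := by exact_mod_cast h2'
  have h8 : (q : ℝ) * q' ≤ Q ^ 2 := by rw [sq]; gcongr
  nlinarith

lemma pairwise_disjoint_arc {Q : ℕ} {τ : ℝ} (hτ : 2 * τ * (Q : ℝ) ^ 2 ≤ 1) :
    (farey Q : Set (Σ _ : ℕ, ℕ)).Pairwise (Function.onFun Disjoint (arc τ)) := by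
  intro p hp p' hp' hne
  rw [Function.onFun, Set.disjoint_left]
  intro x hx hx'
  have h := farey_separated hp hp' hne
  have hlt : |(p.2 : ℝ) / p.1 - (p'.2 : ℝ) / p'.1| < 2 * τ := by
    rw [abs_lt]
    constructor <;> linarith [hx.1, hx.2, hx'.1, hx'.2]
  have hQ : (0 : ℝ) < (Q : ℝ) ^ 2 := by
    have := (mem_farey.1 hp).1
    have : (0 : ℝ) < Q := by exact_mod_cast (by omega : 0 < Q)
    positivity
  nlinarith

lemma measurableSet_arc (τ : ℝ) (p : Σ _ : ℕ, ℕ) : MeasurableSet (arc τ p) := measurableSet_Ioc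

lemma setIntegral_arc {E : Type*} [NormedAddCommGroup E] [NormedSpace ℝ E] {τ : ℝ} (hτ : 0 ≤ τ)
    (p : Σ _ : ℕ, ℕ) (f : ℝ → E) :
    ∫ α in arc τ p, f α = ∫ β in (-τ)..τ, f ((p.2 : ℝ) / p.1 + β) := by
  rw [intervalIntegral.integral_comp_add_left, intervalIntegral.integral_of_le (by linarith), arc,
    sub_eq_add_neg]

lemma weylSum_add_one (k X : ℕ) (α : ℝ) : weylSum k X (α + 1) = weylSum k X α := by
  refine sum_congr rfl fun x _ => ?_
  rw [add_mul, one_mul, show (x : ℝ) ^ k = (((x : ℤ) ^ k : ℤ) : ℝ) by push_cast; rfl, ec_add_int]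

lemma continuous_weylSum (k X : ℕ) : Continuous (weylSum k X) := by
  unfold weylSum
  fun_prop

lemma sum_setIntegral_arc_le {Q : ℕ} {τ : ℝ} (hτ : 2 * τ * (Q : ℝ) ^ 2 ≤ 1) {g : ℝ → ℝ}
    (hg : Continuous g) (hg0 : ∀ x, 0 ≤ g x) (hper : Function.Periodic g 1) :
    ∑ p ∈ farey Q, ∫ α in arc τ p, g α ≤ ∫ α in (0 : ℝ)..1, g α := by
  rw [← MeasureTheory.integral_biUnion_finset _ (fun p _ => measurableSet_arc τ p)
    (pairwise_disjoint_arc hτ)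
    (fun p _ => (hg.integrableOn_Icc (μ := MeasureTheory.volume)).mono_set Set.Ioc_subset_Icc_self)]
  have h1 : ∫ α in (0 : ℝ)..1, g α = ∫ α in Set.Ioc τ (1 + τ), g α := by
    have := hper.intervalIntegral_add_eq 0 τ
    rw [zero_add] at this
    rw [this, intervalIntegral.integral_of_le (by linarith), add_comm τ]
  rw [h1]
  refine MeasureTheory.setIntegral_mono_set
    ((hg.integrableOn_Icc (μ := MeasureTheory.volume)).mono_set Set.Ioc_subset_Icc_self)
    (Filter.Eventually.of_forall hg0) (Filter.Eventually.of_forall ?_)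
  exact Set.iUnion₂_subset fun p hp => arc_subset hτ hp

end Arcs

end Waring

namespace Waring

open Finset

section SingularSeries

lemma half_le_norm_vint_one (k : ℕ) {u : ℝ} (hu : |u| ≤ 1 / 16) : 1 / 2 ≤ ‖vint k 1 u‖ := by
  have hcont : Continuous fun γ : ℝ => ec (u * γ ^ k) := by fun_prop
  have h1 : vint k 1 u - 1 = ∫ γ in (0 : ℝ)..1, (ec (u * γ ^ k) - 1) := by
    rw [intervalIntegral.integral_sub (hcont.intervalIntegrable _ _) (by simp), vint]
    simp
  have h2 : ‖vint k 1 u - 1‖ ≤ 1 / 2 * |(1 : ℝ) - 0| := by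
    rw [h1]
    refine intervalIntegral.norm_integral_le_of_norm_le_const fun γ hγ => ?_
    rw [Set.uIoc_of_le zero_le_one] at hγ
    have h3 := norm_ec_sub_le (u * γ ^ k) 0
    rw [ec_zero, sub_zero, abs_mul, abs_of_nonneg (pow_nonneg hγ.1.le k)] at h3
    have h4 : γ ^ k ≤ 1 := pow_le_one₀ hγ.1.le hγ.2
    have h5 : |u| * γ ^ k ≤ 1 / 16 * 1 := by
      gcongr
      exact pow_nonneg hγ.1.le k
    nlinarith [Real.pi_lt_four, Real.pi_pos, norm_nonneg (ec (u * γ ^ k) - 1)]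
  have h3 := norm_sub_norm_le (1 : ℂ) (1 - vint k 1 u)
  rw [sub_sub_cancel, norm_sub_rev 1 (vint k 1 u), norm_one] at h3
  norm_num at h2
  linarith

lemma card_farey_le (Q : ℕ) : #(farey Q) ≤ Q ^ 2 := by
  rw [farey, card_sigma, sq]
  refine (sum_le_card_nsmul _ _ Q fun q hq => ?_).trans (by simp)
  refine (card_filter_le _ _).trans ?_
  simpa using (mem_Icc.1 hq).2

lemma norm_gsum_mul_pow_le {k X q a : ℕ} (hk : 1 ≤ k) (hX : 1 ≤ X) (hq : 1 ≤ q) {Q β : ℝ}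
    (hqQ : (q : ℝ) ≤ Q) (hβ : (X : ℝ) ^ k * |β| ≤ 1 / 16) (s : ℕ) :
    (‖gsum k q a‖ * X) ^ s ≤
      4 ^ s * (‖weylSum k X (a / q + β)‖ ^ s + (4 * Real.pi * k * Q) ^ s) := by
  have hXR : (0 : ℝ) < X := by exact_mod_cast hX
  have hqR : (0 : ℝ) < q := by exact_mod_cast hq
  have h1 := weylSum_approx hk hq a X β
  have h2 : (X : ℝ) / 2 ≤ ‖vint k X β‖ := by
    rw [vint_eq hXR.ne', norm_mul, Complex.norm_real, Real.norm_eq_abs, abs_of_pos hXR]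
    have := half_le_norm_vint_one k (u := (X : ℝ) ^ k * β) (by
      rwa [abs_mul, abs_of_pos (pow_pos hXR k)])
    nlinarith
  have h3 := norm_sub_norm_le (gsum k q a * vint k X β) (weylSum k X (a / q + β))
  rw [norm_sub_rev, norm_mul] at h3
  have hπ := Real.pi_pos
  have h4 : 2 * Real.pi * k * q * (1 + (X : ℝ) ^ k * |β|) ≤ 2 * Real.pi * k * Q * 2 := by
    have hQ0 : 0 ≤ 2 * Real.pi * k * Q :=
      mul_nonneg (by positivity) (hqR.le.trans hqQ)
    gcongr; linarith
  have h5 : ‖gsum k q a‖ * X ≤ 2 * (‖weylSum k X (a / q + β)‖ + 4 * Real.pi * k * Q) := by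
    nlinarith [norm_nonneg (gsum k q a)]
  have hQ : 0 ≤ 4 * Real.pi * k * Q := by
    have : 0 ≤ Q := by linarith
    positivity
  calc (‖gsum k q a‖ * X) ^ s
      ≤ (2 * (‖weylSum k X (a / q + β)‖ + 4 * Real.pi * k * Q)) ^ s := by gcongr
    _ = 2 ^ s * (‖weylSum k X (a / q + β)‖ + 4 * Real.pi * k * Q) ^ s := mul_pow _ _ _
    _ ≤ 2 ^ s * (2 ^ s * (‖weylSum k X (a / q + β)‖ ^ s + (4 * Real.pi * k * Q) ^ s)) := by
        gcongr
        refine (add_pow_le (norm_nonneg _) hQ s).trans ?_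
        gcongr
        · norm_num
        · omega
    _ = _ := by rw [← mul_assoc, ← mul_pow]; norm_num

lemma exists_sum_farey_norm_gsum_pow_le {k : ℕ} (hk : 1 ≤ k) {ε : ℝ} (hε : 0 < ε) :
    ∃ C : ℝ, 0 < C ∧ ∀ Q : ℕ, 1 ≤ Q →
      ∑ p ∈ farey Q, ‖gsum k p.1 p.2‖ ^ (2 * rr k) ≤ C * (Q : ℝ) ^ ε := by
  obtain ⟨C, hC, hmv⟩ := integral_weylSum_pow_le hk (half_pos hε)
  set s := 2 * rr k with hs
  have hse : s = k ^ 2 + k := by rw [hs, two_mul_rr]; ring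
  have hπ := Real.pi_pos
  refine ⟨4 ^ s * (8 * C + (4 * Real.pi * k) ^ s), by positivity, fun Q hQ => ?_⟩
  have hQR : (1 : ℝ) ≤ Q := by exact_mod_cast hQ
  set X := Q ^ 2 with hX
  have hX1 : 1 ≤ X := Nat.one_le_pow _ _ (by omega)
  have hXR : (1 : ℝ) ≤ X := by exact_mod_cast hX1
  have hX0 : (0 : ℝ) < X := by linarith
  have hXQ : (X : ℝ) = (Q : ℝ) ^ 2 := by rw [hX]; push_cast; rfl
  set τ : ℝ := ((X : ℝ) ^ k)⁻¹ / 16 with hτ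
  have hXk : 0 < (X : ℝ) ^ k := by positivity
  have hτ0 : 0 < τ := by positivity
  have hτX : (X : ℝ) ^ k * τ = 1 / 16 := by rw [hτ]; field_simp
  have hτQ : 2 * τ * (Q : ℝ) ^ 2 ≤ 1 := by
    have : (X : ℝ) ≤ (X : ℝ) ^ k := le_self_pow₀ hXR (by omega)
    rw [← hXQ]
    nlinarith
  have harc : ∀ p ∈ farey Q, 2 * τ * (‖gsum k p.1 p.2‖ * X) ^ s ≤
      4 ^ s * ((∫ α in arc τ p, ‖weylSum k X α‖ ^ s) + 2 * τ * (4 * Real.pi * k * Q) ^ s) := by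
    intro p hp
    obtain ⟨⟨h1, h2⟩, -, -⟩ := mem_farey.1 hp
    have hcont := continuous_weylSum k X
    rw [setIntegral_arc hτ0.le p (fun α => ‖weylSum k X α‖ ^ s)]
    have hInt : IntervalIntegrable (fun β => ‖weylSum k X (p.2 / p.1 + β)‖ ^ s)
        MeasureTheory.volume (-τ) τ := by
      apply Continuous.intervalIntegrable
      fun_prop
    have := intervalIntegral.integral_mono_on (a := -τ) (b := τ)
      (f := fun _ => (‖gsum k p.1 p.2‖ * X) ^ s)
      (g := fun β => 4 ^ s * (‖weylSum k X (p.2 / p.1 + β)‖ ^ s + (4 * Real.pi * k * Q) ^ s))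
      (by linarith) (by simp) ((hInt.add (by simp)).const_mul _) (fun β hβ =>
        norm_gsum_mul_pow_le hk hX1 h1 (by exact_mod_cast h2) (by
          have : |β| ≤ τ := abs_le.2 hβ
          calc (X : ℝ) ^ k * |β| ≤ (X : ℝ) ^ k * τ := by gcongr
            _ = 1 / 16 := hτX
            _ ≤ 1 / 16 := le_rfl) s)
    rw [intervalIntegral.integral_const, intervalIntegral.integral_const_mul,
      intervalIntegral.integral_add hInt (by simp), intervalIntegral.integral_const,
      smul_eq_mul, smul_eq_mul] at this
    calc _ = (τ - -τ) * (‖gsum k p.1 p.2‖ * X) ^ s := by ring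
      _ ≤ _ := this
      _ = _ := by ring
  have hsum := sum_le_sum harc
  rw [← mul_sum, ← mul_sum, sum_add_distrib, sum_const, nsmul_eq_mul] at hsum
  have hm : ∑ p ∈ farey Q, ∫ α in arc τ p, ‖weylSum k X α‖ ^ s ≤
      C * (X : ℝ) ^ ((k : ℝ) ^ 2 + ε / 2) := by
    have hcont := continuous_weylSum k X
    refine (sum_setIntegral_arc_le hτQ (by fun_prop) (fun x => by positivity) ?_).trans (hmv X hX1)
    intro x
    simp only [weylSum_add_one]
  have hcard : (#(farey Q) : ℝ) ≤ (Q : ℝ) ^ 2 := by exact_mod_cast card_farey_le Q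
  simp only [mul_pow _ (X : ℝ)] at hsum
  rw [← sum_mul] at hsum
  set G := ∑ p ∈ farey Q, ‖gsum k p.1 p.2‖ ^ s with hG
  have hXs : (X : ℝ) ^ s = (X : ℝ) ^ (k ^ 2) * (X : ℝ) ^ k := by rw [hse, pow_add]
  have hXε : (X : ℝ) ^ ((k : ℝ) ^ 2 + ε / 2) = (X : ℝ) ^ (k ^ 2) * (Q : ℝ) ^ ε := by
    rw [Real.rpow_add hX0, ← Nat.cast_pow, Real.rpow_natCast, hXQ, ← Real.rpow_natCast _ 2,
      ← Real.rpow_mul (by positivity)]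
    congr 2
    push_cast; ring
  have hQε : 1 ≤ (Q : ℝ) ^ ε := Real.one_le_rpow hQR hε.le
  have hQs : (Q : ℝ) ^ 2 * (Q : ℝ) ^ s ≤ (X : ℝ) ^ s := by
    rw [hXQ, ← pow_mul, ← pow_add]
    exact pow_le_pow_right₀ hQR (by rw [hse]; nlinarith)
  have hlast : 2 * τ * (Q ^ 2 * (4 * Real.pi * k * Q) ^ s) ≤
      2 * τ * ((4 * Real.pi * k) ^ s * (X : ℝ) ^ s) := by
    rw [mul_pow _ (Q : ℝ)]
    refine mul_le_mul_of_nonneg_left ?_ (by positivity)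
    calc (Q : ℝ) ^ 2 * ((4 * Real.pi * k) ^ s * (Q : ℝ) ^ s)
        = (4 * Real.pi * k) ^ s * ((Q : ℝ) ^ 2 * (Q : ℝ) ^ s) := by ring
      _ ≤ _ := by gcongr
  have hτs : 2 * τ * (X : ℝ) ^ s = (X : ℝ) ^ (k ^ 2) / 8 := by
    rw [hXs]; linear_combination (2 * (X : ℝ) ^ (k ^ 2)) * hτX
  have hfin : (X : ℝ) ^ (k ^ 2) / 8 * G ≤ (X : ℝ) ^ (k ^ 2) / 8 *
      (4 ^ s * (8 * C + (4 * Real.pi * k) ^ s) * (Q : ℝ) ^ ε) := by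
    calc (X : ℝ) ^ (k ^ 2) / 8 * G = 2 * τ * (G * (X : ℝ) ^ s) := by rw [← hτs]; ring
      _ ≤ _ := hsum
      _ ≤ 4 ^ s * (C * (X : ℝ) ^ ((k : ℝ) ^ 2 + ε / 2) +
          (Q : ℝ) ^ 2 * (2 * τ * (4 * Real.pi * k * Q) ^ s)) := by gcongr
      _ = 4 ^ s * (C * (X : ℝ) ^ ((k : ℝ) ^ 2 + ε / 2) +
          2 * τ * (Q ^ 2 * (4 * Real.pi * k * Q) ^ s)) := by ring
      _ ≤ 4 ^ s * (C * ((X : ℝ) ^ (k ^ 2) * (Q : ℝ) ^ ε) +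
          2 * τ * ((4 * Real.pi * k) ^ s * (X : ℝ) ^ s)) := by rw [hXε]; gcongr
      _ = (X : ℝ) ^ (k ^ 2) / 8 * (4 ^ s * (8 * C * (Q : ℝ) ^ ε + (4 * Real.pi * k) ^ s * 1)) := by
          linear_combination (4 ^ s * (4 * Real.pi * k) ^ s) * hτs
      _ ≤ (X : ℝ) ^ (k ^ 2) / 8 *
          (4 ^ s * (8 * C * (Q : ℝ) ^ ε + (4 * Real.pi * k) ^ s * (Q : ℝ) ^ ε)) := by gcongr
      _ = _ := by ring
  exact le_of_mul_le_mul_left hfin (by positivity)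

/-- The majorant `∑ₐ |S(q,a)/q|ˢ` of the `q`-th term of the singular series. -/
noncomputable def gmaj (s k q : ℕ) : ℝ :=
  ∑ a ∈ (Icc 1 q).filter fun a => a.Coprime q, ‖gsum k q a‖ ^ s

lemma gmaj_nonneg (s k q : ℕ) : 0 ≤ gmaj s k q := sum_nonneg fun _ _ => by positivity

lemma summable_gmaj {k s : ℕ} (hk : 2 ≤ k) (hs : 2 * rr k + 1 ≤ s) : Summable (gmaj s k) := by
  obtain ⟨C, hC, hg⟩ := exists_mul_norm_gsum_pow_le hk
  have hCR : (0 : ℝ) < C := by exact_mod_cast hC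
  obtain ⟨B, hB, hsum⟩ := exists_sum_farey_norm_gsum_pow_le (k := k) (by omega)
    (ε := 1 / (2 * C)) (by positivity)
  have hL : LSeriesSummable (fun q => ((gmaj (2 * rr k) k q : ℝ) : ℂ)) ((1 / C : ℝ) : ℂ) := by
    refine LSeriesSummable_of_sum_norm_bigO (r := 1 / (2 * C)) ?_ (by positivity) ?_
    · refine Asymptotics.IsBigO.of_bound B ?_
      filter_upwards [Filter.eventually_ge_atTop 1] with Q hQ
      have h1 := hsum Q hQ
      rw [farey, sum_sigma] at h1
      rw [Real.norm_of_nonneg (sum_nonneg fun _ _ => norm_nonneg _),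
        Real.norm_of_nonneg (by positivity)]
      refine le_trans (le_of_eq (sum_congr rfl fun q _ => ?_)) h1
      rw [Complex.norm_real, Real.norm_of_nonneg (gmaj_nonneg _ _ _), gmaj]
    · rw [Complex.ofReal_re]
      gcongr
      linarith
  have hL' := (summable_norm_iff.2 hL).mul_left ((C : ℝ) ^ (1 / C : ℝ))
  refine Summable.of_nonneg_of_le (gmaj_nonneg s k) (fun q => ?_) hL'
  rw [LSeries.norm_term_eq]
  rcases Nat.eq_zero_or_pos q with rfl | hq
  · simp [gmaj]
  have hqR : (0 : ℝ) < q := by exact_mod_cast hq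
  rw [if_neg hq.ne', Complex.norm_real, Real.norm_of_nonneg (gmaj_nonneg _ _ _), Complex.ofReal_re,
    ← mul_div_assoc, mul_div_right_comm, gmaj, gmaj, mul_sum]
  refine sum_le_sum fun a ha => ?_
  have h1 := hg q a hq (mem_filter.1 ha).2
  have h2 : ‖gsum k q a‖ ≤ (C : ℝ) ^ (1 / C : ℝ) / (q : ℝ) ^ (1 / C : ℝ) := by
    rw [← Real.div_rpow hCR.le hqR.le, one_div]
    rw [Real.le_rpow_inv_iff_of_pos (norm_nonneg _) (by positivity) hCR, Real.rpow_natCast,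
      le_div_iff₀ hqR, mul_comm]
    exact h1
  calc ‖gsum k q a‖ ^ s ≤ ‖gsum k q a‖ ^ (2 * rr k + 1) :=
        pow_le_pow_of_le_one (norm_nonneg _) (norm_gsum_le_one _ _ _) hs
    _ = ‖gsum k q a‖ * ‖gsum k q a‖ ^ (2 * rr k) := by ring
    _ ≤ _ := by gcongr

end SingularSeries

end Waring

namespace Waring

open Finset

section Orthogonality

lemma weylSum_pow_mul_ec (k X s n : ℕ) (α : ℝ) :
    weylSum k X α ^ s * ec (-(n : ℝ) * α) = ∑ x ∈ Fintype.piFinset fun _ : Fin s => Icc 1 X,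
      ec (α * ((∑ i, (x i : ℤ) ^ k - n : ℤ) : ℝ)) := by
  have h := prod_univ_sum (fun _ : Fin s => Icc 1 X) fun _ x => ec (α * (x : ℝ) ^ k)
  rw [prod_const, card_univ, Fintype.card_fin] at h
  rw [weylSum, h, sum_mul]
  refine sum_congr rfl fun x _ => ?_
  rw [← ec_sum, ← ec_add]
  congr 1
  push_cast
  rw [← mul_sum]
  ring

lemma Rcount_eq_integral {s k n X : ℕ} (hn : n < (X + 1) ^ k) :
    (Rcount s k n : ℂ) = ∫ α in (0 : ℝ)..1, weylSum k X α ^ s * ec (-(n : ℝ) * α) := by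
  simp only [weylSum_pow_mul_ec]
  rw [intervalIntegral.integral_finsetSum]
  swap
  · intro x _
    apply Continuous.intervalIntegrable
    fun_prop
  simp only [integral_ec_int]
  rw [sum_boole]
  congr 1
  rw [Rcount, ← Set.ncard_coe_finset]
  congr 1
  ext x
  simp only [Set.mem_ofPred_eq, coe_filter, Fintype.mem_piFinset, mem_Icc, sub_eq_zero]
  constructor
  · rintro ⟨h1, h2⟩
    refine ⟨fun i => ⟨h1 i, ?_⟩, by exact_mod_cast h2⟩
    have h3 : x i ^ k ≤ n := by
      rw [← h2]
      exact single_le_sum (f := fun i => x i ^ k) (fun _ _ => Nat.zero_le _) (mem_univ i)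
    have h4 : x i < X + 1 := lt_of_pow_lt_pow_left₀ k (by omega) (h3.trans_lt hn)
    omega
  · rintro ⟨h1, h2⟩
    exact ⟨fun i => (h1 i).1, by exact_mod_cast h2⟩

end Orthogonality

section MinorArcs

/-- The largest denominator of a major arc. -/
noncomputable def majQ (X : ℕ) : ℕ := ⌊(X : ℝ) ^ (1 / 6 : ℝ)⌋₊

/-- The radius of a major arc. -/
noncomputable def majτ (k X : ℕ) : ℝ := (X : ℝ) ^ ((1 / 6 : ℝ) - k)

lemma majQ_le (X : ℕ) : (majQ X : ℝ) ≤ (X : ℝ) ^ (1 / 6 : ℝ) := Nat.floor_le (by positivity)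

lemma majτ_nonneg (k X : ℕ) : 0 ≤ majτ k X := by unfold majτ; positivity

lemma pow_mul_majτ {k X : ℕ} (hX : 1 ≤ X) : (X : ℝ) ^ k * majτ k X = (X : ℝ) ^ (1 / 6 : ℝ) := by
  have hX0 : (0 : ℝ) < X := by exact_mod_cast hX
  rw [majτ, ← Real.rpow_natCast, ← Real.rpow_add hX0]
  congr 1; ring

lemma two_mul_majτ_mul_le {k X : ℕ} (hk : 2 ≤ k) (hX : 2 ≤ X) :
    2 * majτ k X * (majQ X : ℝ) ^ 2 ≤ 1 := by
  have hXR : (2 : ℝ) ≤ X := by exact_mod_cast hX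
  have hX0 : (0 : ℝ) < X := by linarith
  have hkR : (2 : ℝ) ≤ k := by exact_mod_cast hk
  have h1 : (majQ X : ℝ) ^ 2 ≤ (X : ℝ) ^ (1 / 3 : ℝ) := by
    calc (majQ X : ℝ) ^ 2 ≤ ((X : ℝ) ^ (1 / 6 : ℝ)) ^ 2 := by gcongr; exact majQ_le X
      _ = (X : ℝ) ^ (1 / 3 : ℝ) := by
        rw [← Real.rpow_natCast, ← Real.rpow_mul hX0.le]; norm_num
  calc 2 * majτ k X * (majQ X : ℝ) ^ 2 ≤ 2 * majτ k X * (X : ℝ) ^ (1 / 3 : ℝ) := by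
        gcongr; exact mul_nonneg (by norm_num) (majτ_nonneg k X)
    _ = 2 * (X : ℝ) ^ ((1 / 6 : ℝ) - k + 1 / 3) := by rw [Real.rpow_add hX0, majτ]; ring
    _ ≤ 2 * (X : ℝ) ^ (-1 : ℝ) := by
        gcongr
        · linarith
        · linarith
    _ ≤ 1 := by
        rw [Real.rpow_neg_one, ← div_eq_mul_inv, div_le_one hX0]; exact hXR

/-- The union of the major arcs. -/
def major (k X : ℕ) : Set ℝ := ⋃ p ∈ farey (majQ X), arc (majτ k X) p

/-- A number well approximated by a fraction with small denominator lies on a major arc. -/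
lemma mem_major_of_approx {k X : ℕ} (hk : 2 ≤ k) (hX : 2 ≤ X) {α : ℝ}
    (hα : α ∈ Set.Ioc (majτ k X) (1 + majτ k X)) {q : ℕ} (hq : 1 ≤ q) (hqQ : q ≤ majQ X) {m : ℤ}
    (hm : |q * α - m| < majτ k X) : α ∈ major k X := by
  set τ := majτ k X with hτ
  have hτ0 : 0 ≤ τ := majτ_nonneg k X
  have hqR : (1 : ℝ) ≤ q := by exact_mod_cast hq
  have hdist : |α - m / q| < τ := by
    have h1 : (q : ℝ) * α - m = q * (α - m / q) := by field_simp
    rw [h1, abs_mul, abs_of_pos (by linarith : (0 : ℝ) < q)] at hm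
    nlinarith [abs_nonneg (α - m / q)]
  rw [abs_lt] at hdist
  have hm1 : 1 ≤ m := by
    have h1 : (0 : ℝ) < m / q := by linarith [hα.1]
    have h2 : (0 : ℝ) < m := by
      have := mul_pos h1 (by linarith : (0 : ℝ) < q)
      rwa [div_mul_cancel₀ _ (by linarith)] at this
    exact_mod_cast h2
  lift m to ℕ using by omega
  have hm1' : 1 ≤ m := by omega
  have hg : 0 < m.gcd q := Nat.gcd_pos_of_pos_right _ (by omega)
  obtain ⟨a, ha⟩ := Nat.gcd_dvd_left m q
  obtain ⟨b, hb⟩ := Nat.gcd_dvd_right m q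
  have hcop : a.Coprime b := by
    have := Nat.coprime_div_gcd_div_gcd hg
    rwa [Nat.div_eq_of_eq_mul_right hg ha, Nat.div_eq_of_eq_mul_right hg hb] at this
  set g := m.gcd q with hgdef
  have hb1 : 1 ≤ b := Nat.pos_of_ne_zero fun h => by rw [h] at hb; omega
  have ha1 : 1 ≤ a := Nat.pos_of_ne_zero fun h => by rw [h] at ha; omega
  have hbq : b ≤ q := by rw [hb]; exact Nat.le_mul_of_pos_left b hg
  have hbR : (1 : ℝ) ≤ b := by exact_mod_cast hb1
  have hfrac : ((m : ℤ) : ℝ) / q = (a : ℝ) / b := by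
    have hgR : (g : ℝ) ≠ 0 := by exact_mod_cast hg.ne'
    have hbR' : (b : ℝ) ≠ 0 := by linarith
    have h1 : (m : ℝ) = g * a := by exact_mod_cast ha
    have h2 : (q : ℝ) = g * b := by exact_mod_cast hb
    rw [Int.cast_natCast, h1, h2]
    field_simp
  rw [hfrac] at hdist
  have hab : a ≤ b := by
    by_contra! hlt
    have h1 : (b : ℝ) + 1 ≤ a := by exact_mod_cast hlt
    have h2 : 1 + 1 / (b : ℝ) ≤ a / b := by
      rw [le_div_iff₀ (by linarith), add_mul, one_div, inv_mul_cancel₀ (by linarith)]; linarith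
    have h3 : 2 * τ ≤ 1 / (b : ℝ) := by
      rw [le_div_iff₀ (by linarith)]
      have h4 : (b : ℝ) ≤ majQ X := by exact_mod_cast hbq.trans hqQ
      have h5 : (b : ℝ) ≤ (majQ X : ℝ) ^ 2 := by nlinarith
      have h6 := two_mul_majτ_mul_le hk hX
      rw [← hτ] at h6
      nlinarith
    linarith [hα.2]
  refine Set.mem_iUnion₂.2 ⟨⟨b, a⟩, mem_farey.2 ⟨⟨hb1, hbq.trans hqQ⟩, ⟨ha1, hab⟩, hcop⟩, ?_⟩
  exact ⟨by dsimp only; linarith, by dsimp only; linarith⟩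

/-- The exponential sum is small off the major arcs. -/
lemma exists_norm_weylSum_minor_le {k : ℕ} (hk : 2 ≤ k) : ∃ δ : ℝ, 0 < δ ∧ ∃ X₀ : ℕ, 2 ≤ X₀ ∧
    ∀ X : ℕ, X₀ ≤ X → ∀ α ∈ Set.Ioc (majτ k X) (1 + majτ k X) \ major k X,
      ‖weylSum k X α‖ ≤ X * (X : ℝ) ^ (-δ) := by
  obtain ⟨C, hC, h⟩ := exists_approx_of_large_weylSum (k := k) (by omega)
  have hCR : (0 : ℝ) < C := by exact_mod_cast hC
  set δ : ℝ := 1 / (12 * C) with hδ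
  have hδ0 : 0 < δ := by positivity
  have hlim : Filter.Tendsto (fun X : ℕ => (X : ℝ) ^ (1 / 12 : ℝ)) Filter.atTop Filter.atTop :=
    (tendsto_rpow_atTop (by norm_num)).comp tendsto_natCast_atTop_atTop
  obtain ⟨X₀, hX₀⟩ := Filter.eventually_atTop.1 (hlim.eventually_gt_atTop (C : ℝ))
  refine ⟨δ, hδ0, max 2 X₀, le_max_left _ _, fun X hX α hα => ?_⟩
  have hX2 : 2 ≤ X := (le_max_left _ _).trans hX
  have hXR : (2 : ℝ) ≤ X := by exact_mod_cast hX2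
  have hX0 : (0 : ℝ) < X := by linarith
  by_contra! hlt
  set D := (X : ℝ) ^ δ with hD
  have hD1 : 1 ≤ D := Real.one_le_rpow (by linarith) hδ0.le
  have hCD : C * D ^ C < (X : ℝ) ^ (1 / 6 : ℝ) := by
    have h1 : D ^ C = (X : ℝ) ^ (1 / 12 : ℝ) := by
      rw [hD, ← Real.rpow_natCast, ← Real.rpow_mul hX0.le, hδ]
      congr 1; field_simp
    have h2 : (X : ℝ) ^ (1 / 6 : ℝ) = (X : ℝ) ^ (1 / 12 : ℝ) * (X : ℝ) ^ (1 / 12 : ℝ) := by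
      rw [← Real.rpow_add hX0]; norm_num
    rw [h1, h2]
    have := hX₀ X ((le_max_right _ _).trans hX)
    gcongr
  obtain ⟨q, hq, hqD, m, hm⟩ := h D X α hD1 (by omega) (by
    rw [Real.rpow_neg hX0.le, ← hD, ← div_eq_mul_inv, div_lt_iff₀ (by linarith)] at hlt
    linarith)
  refine hα.2 (mem_major_of_approx hk hX2 hα.1 hq (Nat.le_floor (hqD.trans hCD.le)) (m := m) ?_)
  have h1 := pow_mul_majτ (k := k) (X := X) (by omega)
  have h2 : |q * α - m| * (X : ℝ) ^ k < majτ k X * (X : ℝ) ^ k := by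
    rw [mul_comm (majτ k X), h1]; exact hm.trans_lt hCD
  exact lt_of_mul_lt_mul_right h2 (by positivity)

lemma measurableSet_major (k X : ℕ) : MeasurableSet (major k X) :=
  Finset.measurableSet_biUnion _ fun _ _ => measurableSet_arc _ _

lemma integral_Ioc_eq {E : Type*} [NormedAddCommGroup E] [NormedSpace ℝ E] {g : ℝ → E}
    (hper : Function.Periodic g 1) (τ : ℝ) :
    ∫ α in Set.Ioc τ (1 + τ), g α = ∫ α in (0 : ℝ)..1, g α := by
  have := hper.intervalIntegral_add_eq τ 0
  rw [zero_add] at this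
  rw [← this, intervalIntegral.integral_of_le (by linarith), add_comm τ]

/-- The minor arcs contribute negligibly. -/
lemma exists_minor_le {k s : ℕ} (hk : 2 ≤ k) (hs : 2 * rr k + 1 ≤ s) :
    ∃ δ : ℝ, 0 < δ ∧ ∃ C : ℝ, ∃ X₀ : ℕ, 2 ≤ X₀ ∧ ∀ X : ℕ, X₀ ≤ X →
      ∫ α in Set.Ioc (majτ k X) (1 + majτ k X) \ major k X, ‖weylSum k X α‖ ^ s ≤
        C * (X : ℝ) ^ (-δ) * (X : ℝ) ^ (s - k) := by
  obtain ⟨δ, hδ, X₀, hX₀, hsmall⟩ := exists_norm_weylSum_minor_le hk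
  obtain ⟨C, hC, hmv⟩ := integral_weylSum_pow_le (k := k) (by omega) (half_pos hδ)
  refine ⟨δ / 2, by positivity, C, X₀, hX₀, fun X hX => ?_⟩
  have hX2 : 2 ≤ X := hX₀.trans hX
  have hXR : (2 : ℝ) ≤ X := by exact_mod_cast hX2
  have hX0 : (0 : ℝ) < X := by linarith
  set A := Set.Ioc (majτ k X) (1 + majτ k X) with hA
  set r := 2 * rr k with hr
  have hcont := continuous_weylSum k X
  have hintA : ∀ j : ℕ, MeasureTheory.IntegrableOn (fun α => ‖weylSum k X α‖ ^ j) A := fun j =>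
    ((by fun_prop : Continuous fun α => ‖weylSum k X α‖ ^ j).integrableOn_Icc).mono_set
      Set.Ioc_subset_Icc_self
  have hintAj : ∀ j : ℕ, MeasureTheory.IntegrableOn (fun α => ‖weylSum k X α‖ ^ j)
      (A \ major k X) := fun j => (hintA j).mono_set Set.sdiff_subset
  have hmeas : MeasurableSet (A \ major k X) := measurableSet_Ioc.diff (measurableSet_major k X)
  have hXδ1 : (X : ℝ) ^ (-δ) ≤ 1 := Real.rpow_le_one_of_one_le_of_nonpos (by linarith) (by linarith)
  have hpt : ∀ α ∈ A \ major k X, ‖weylSum k X α‖ ^ s ≤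
      ((X : ℝ) ^ (s - r) * (X : ℝ) ^ (-δ)) * ‖weylSum k X α‖ ^ r := by
    intro α hα
    have h1 := hsmall X hX α hα
    calc ‖weylSum k X α‖ ^ s = ‖weylSum k X α‖ ^ (s - r) * ‖weylSum k X α‖ ^ r := by
          rw [← pow_add]; congr 1; omega
      _ ≤ (X * (X : ℝ) ^ (-δ)) ^ (s - r) * ‖weylSum k X α‖ ^ r := by gcongr
      _ ≤ ((X : ℝ) ^ (s - r) * (X : ℝ) ^ (-δ)) * ‖weylSum k X α‖ ^ r := by
          rw [mul_pow]
          gcongr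
          exact pow_le_of_le_one (by positivity) hXδ1 (by omega)
  have hper : Function.Periodic (fun α => ‖weylSum k X α‖ ^ r) 1 := fun α => by
    simp only [weylSum_add_one]
  have hse : s - r + k ^ 2 = s - k := by
    have : r = k ^ 2 + k := by rw [hr, two_mul_rr]; ring
    omega
  calc ∫ α in A \ major k X, ‖weylSum k X α‖ ^ s
      ≤ ∫ α in A \ major k X, ((X : ℝ) ^ (s - r) * (X : ℝ) ^ (-δ)) * ‖weylSum k X α‖ ^ r :=
        MeasureTheory.setIntegral_mono_on (hintAj s) ((hintAj r).const_mul _) hmeas hpt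
    _ = ((X : ℝ) ^ (s - r) * (X : ℝ) ^ (-δ)) * ∫ α in A \ major k X, ‖weylSum k X α‖ ^ r :=
        MeasureTheory.integral_const_mul _ _
    _ ≤ ((X : ℝ) ^ (s - r) * (X : ℝ) ^ (-δ)) * ∫ α in A, ‖weylSum k X α‖ ^ r := by
        refine mul_le_mul_of_nonneg_left ?_ (by positivity)
        exact MeasureTheory.setIntegral_mono_set (hintA r)
          (Filter.Eventually.of_forall fun _ => by positivity)
          (LE.le.eventuallyLE Set.sdiff_subset)
    _ ≤ ((X : ℝ) ^ (s - r) * (X : ℝ) ^ (-δ)) * (C * (X : ℝ) ^ ((k : ℝ) ^ 2 + δ / 2)) := by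
        gcongr
        rw [integral_Ioc_eq hper]
        exact hmv X (by omega)
    _ = C * ((X : ℝ) ^ (-δ) * (X : ℝ) ^ (δ / 2)) * ((X : ℝ) ^ (s - r) * (X : ℝ) ^ (k ^ 2)) := by
        rw [Real.rpow_add hX0, ← Nat.cast_pow k, Real.rpow_natCast]; ring
    _ = C * (X : ℝ) ^ (-(δ / 2)) * (X : ℝ) ^ (s - k) := by
        rw [← Real.rpow_add hX0, ← pow_add, hse]
        congr 3
        ring

end MinorArcs

end Waring

namespace Waring

open Finset

section MajorArcs

lemma norm_pow_sub_pow_le {x y : ℂ} {M : ℝ} (hx : ‖x‖ ≤ M) (hy : ‖y‖ ≤ M) (s : ℕ) :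
    ‖x ^ s - y ^ s‖ ≤ s * M ^ (s - 1) * ‖x - y‖ := by
  have hM : 0 ≤ M := (norm_nonneg x).trans hx
  rw [← (Commute.all x y).mul_geom_sum₂, norm_mul, mul_comm]
  gcongr
  refine (norm_sum_le _ _).trans ((sum_le_card_nsmul _ _ (M ^ (s - 1)) fun i hi => ?_).trans ?_)
  · have hi' : i + (s - 1 - i) = s - 1 := by have := mem_range.1 hi; omega
    rw [norm_mul, norm_pow, norm_pow]
    calc ‖x‖ ^ i * ‖y‖ ^ (s - 1 - i) ≤ M ^ i * M ^ (s - 1 - i) := by gcongr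
      _ = M ^ (s - 1) := by rw [← pow_add, hi']
  · simp

lemma norm_weylSum_le (k X : ℕ) (α : ℝ) : ‖weylSum k X α‖ ≤ X := by
  refine (norm_sum_le _ _).trans ((sum_le_card_nsmul _ _ 1 fun x _ => (norm_ec _).le).trans ?_)
  simp

/-- The partial sum of the singular series over `q ≤ Q`. -/
noncomputable def singPartial (s k n Q : ℕ) : ℂ :=
  ∑ p ∈ farey Q, gsum k p.1 p.2 ^ s * ec (-(n : ℝ) * p.2 / p.1)

lemma norm_arc_sub_le {k X s n : ℕ} (hk : 2 ≤ k) (hX : 2 ≤ X) {p : Σ _ : ℕ, ℕ}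
    (hp : p ∈ farey (majQ X)) :
    ‖(∫ α in arc (majτ k X) p, weylSum k X α ^ s * ec (-(n : ℝ) * α)) -
      gsum k p.1 p.2 ^ s * ec (-(n : ℝ) * p.2 / p.1) *
        ∫ β in (-majτ k X)..majτ k X, vint k X β ^ s * ec (-(n : ℝ) * β)‖ ≤
      s * (X : ℝ) ^ (s - 1) * (4 * Real.pi * k * (X : ℝ) ^ (1 / 3 : ℝ)) * (2 * majτ k X) := by
  obtain ⟨⟨h1, h2⟩, -, -⟩ := mem_farey.1 hp
  have hτ0 := majτ_nonneg k X
  have hXR : (2 : ℝ) ≤ X := by exact_mod_cast hX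
  have hX0 : (0 : ℝ) < X := by linarith
  have hcw := continuous_weylSum k X
  have hcv := continuous_vint k X
  rw [setIntegral_arc hτ0, ← intervalIntegral.integral_const_mul,
    ← intervalIntegral.integral_sub]
  rotate_left
  · apply Continuous.intervalIntegrable; fun_prop
  · apply Continuous.intervalIntegrable; fun_prop
  have hb := intervalIntegral.norm_integral_le_of_norm_le_const (a := -majτ k X) (b := majτ k X)
    (f := fun β => weylSum k X (p.2 / p.1 + β) ^ s * ec (-(n : ℝ) * (p.2 / p.1 + β)) -
      gsum k p.1 p.2 ^ s * ec (-(n : ℝ) * p.2 / p.1) * (vint k X β ^ s * ec (-(n : ℝ) * β)))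
    (C := s * (X : ℝ) ^ (s - 1) * (4 * Real.pi * k * (X : ℝ) ^ (1 / 3 : ℝ))) (fun β hβ => ?_)
  · rwa [sub_neg_eq_add, ← two_mul, abs_of_nonneg (by linarith)] at hb
  · rw [Set.uIoc_of_le (by linarith)] at hβ
    have hβ' : |β| ≤ majτ k X := abs_le.2 ⟨hβ.1.le, hβ.2⟩
    have e1 : ec (-(n : ℝ) * (p.2 / p.1 + β)) =
        ec (-(n : ℝ) * p.2 / p.1) * ec (-(n : ℝ) * β) := by
      rw [← ec_add]; congr 1; ring
    have e2 : weylSum k X (p.2 / p.1 + β) ^ s * ec (-(n : ℝ) * (p.2 / p.1 + β)) -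
        gsum k p.1 p.2 ^ s * ec (-(n : ℝ) * p.2 / p.1) * (vint k X β ^ s * ec (-(n : ℝ) * β)) =
        (weylSum k X (p.2 / p.1 + β) ^ s - (gsum k p.1 p.2 * vint k X β) ^ s) *
          (ec (-(n : ℝ) * p.2 / p.1) * ec (-(n : ℝ) * β)) := by
      rw [e1]; ring
    rw [e2, norm_mul, norm_mul, norm_ec, norm_ec, mul_one, mul_one]
    have h3 : ‖gsum k p.1 p.2 * vint k X β‖ ≤ X := by
      rw [norm_mul]
      exact (mul_le_of_le_one_left (norm_nonneg _) (norm_gsum_le_one _ _ _)).trans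
        (norm_vint_le hX0.le β)
    refine (norm_pow_sub_pow_le (norm_weylSum_le k X _) h3 s).trans ?_
    gcongr
    refine (weylSum_approx (by omega) h1 p.2 X β).trans ?_
    have h4 : (p.1 : ℝ) ≤ (X : ℝ) ^ (1 / 6 : ℝ) :=
      (by exact_mod_cast h2 : (p.1 : ℝ) ≤ majQ X).trans (majQ_le X)
    have h5 : (X : ℝ) ^ k * |β| ≤ (X : ℝ) ^ (1 / 6 : ℝ) := by
      rw [← pow_mul_majτ (k := k) (by omega : 1 ≤ X)]; gcongr
    have h6 : 1 ≤ (X : ℝ) ^ (1 / 6 : ℝ) := Real.one_le_rpow (by linarith) (by norm_num)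
    have h7 : (X : ℝ) ^ (1 / 3 : ℝ) = (X : ℝ) ^ (1 / 6 : ℝ) * (X : ℝ) ^ (1 / 6 : ℝ) := by
      rw [← Real.rpow_add hX0]; norm_num
    have hπ := Real.pi_pos
    calc 2 * Real.pi * k * p.1 * (1 + (X : ℝ) ^ k * |β|)
        ≤ 2 * Real.pi * k * (X : ℝ) ^ (1 / 6 : ℝ) *
          ((X : ℝ) ^ (1 / 6 : ℝ) + (X : ℝ) ^ (1 / 6 : ℝ)) := by gcongr
      _ = _ := by rw [h7]; ring

lemma norm_major_sub_le {k X s n : ℕ} (hk : 2 ≤ k) (hX : 2 ≤ X) (hs : k + 1 ≤ s) :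
    ‖(∫ α in major k X, weylSum k X α ^ s * ec (-(n : ℝ) * α)) - singPartial s k n (majQ X) *
        ∫ β in (-majτ k X)..majτ k X, vint k X β ^ s * ec (-(n : ℝ) * β)‖ ≤
      8 * Real.pi * k * s * (X : ℝ) ^ (-(1 / 6) : ℝ) * (X : ℝ) ^ (s - k) := by
  have hcw := continuous_weylSum k X
  have hXR : (2 : ℝ) ≤ X := by exact_mod_cast hX
  have hX0 : (0 : ℝ) < X := by linarith
  rw [major, MeasureTheory.integral_biUnion_finset _ (fun p _ => measurableSet_arc _ p)
    (pairwise_disjoint_arc (two_mul_majτ_mul_le hk hX)) (fun p _ =>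
      ((by fun_prop : Continuous fun α => weylSum k X α ^ s * ec (-(n : ℝ) * α)).integrableOn_Icc
        (μ := MeasureTheory.volume)).mono_set Set.Ioc_subset_Icc_self),
    singPartial, sum_mul, ← sum_sub_distrib]
  refine (norm_sum_le _ _).trans ((sum_le_card_nsmul _ _ _ fun p hp =>
    norm_arc_sub_le hk hX hp).trans ?_)
  rw [nsmul_eq_mul]
  have hcard : (#(farey (majQ X)) : ℝ) ≤ (X : ℝ) ^ (1 / 3 : ℝ) := by
    calc (#(farey (majQ X)) : ℝ) ≤ (majQ X : ℝ) ^ 2 := by exact_mod_cast card_farey_le _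
      _ ≤ ((X : ℝ) ^ (1 / 6 : ℝ)) ^ 2 := by gcongr; exact majQ_le X
      _ = _ := by rw [← Real.rpow_natCast, ← Real.rpow_mul hX0.le]; norm_num
  have hτ0 := majτ_nonneg k X
  have hπ := Real.pi_pos
  have hexp : (X : ℝ) ^ (1 / 3 : ℝ) * (X : ℝ) ^ (s - 1) * (X : ℝ) ^ (1 / 3 : ℝ) * majτ k X =
      (X : ℝ) ^ (-(1 / 6) : ℝ) * (X : ℝ) ^ (s - k) := by
    rw [majτ, ← Real.rpow_natCast _ (s - 1), ← Real.rpow_natCast _ (s - k), ← Real.rpow_add hX0,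
      ← Real.rpow_add hX0, ← Real.rpow_add hX0, ← Real.rpow_add hX0, Nat.cast_sub (by omega),
      Nat.cast_sub (by omega)]
    congr 1
    push_cast; ring
  calc (#(farey (majQ X)) : ℝ) * (s * (X : ℝ) ^ (s - 1) *
        (4 * Real.pi * k * (X : ℝ) ^ (1 / 3 : ℝ)) * (2 * majτ k X))
      ≤ (X : ℝ) ^ (1 / 3 : ℝ) * (s * (X : ℝ) ^ (s - 1) *
        (4 * Real.pi * k * (X : ℝ) ^ (1 / 3 : ℝ)) * (2 * majτ k X)) := by gcongr
    _ = 8 * Real.pi * k * s * ((X : ℝ) ^ (1 / 3 : ℝ) * (X : ℝ) ^ (s - 1) *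
        (X : ℝ) ^ (1 / 3 : ℝ) * majτ k X) := by ring
    _ = _ := by rw [hexp]; ring

end MajorArcs

section SingularIntegral

/-- The singular integral. -/
noncomputable def singInt (s k : ℕ) : ℂ := ∫ u : ℝ, vint k 1 u ^ s * ec (-u)

lemma integral_vint_pow {k X s : ℕ} (hX : 1 ≤ X) (hs : k ≤ s) (n : ℕ) :
    ∫ β in (-majτ k X)..majτ k X, vint k X β ^ s * ec (-(n : ℝ) * β) =
      (X : ℂ) ^ (s - k) * ∫ u in (-(X : ℝ) ^ (1 / 6 : ℝ))..(X : ℝ) ^ (1 / 6 : ℝ),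
        vint k 1 u ^ s * ec (-((n : ℝ) / (X : ℝ) ^ k) * u) := by
  have hX0 : (X : ℝ) ≠ 0 := by exact_mod_cast (by omega : X ≠ 0)
  have hXC : (X : ℂ) ≠ 0 := by exact_mod_cast (by omega : X ≠ 0)
  have h := intervalIntegral.integral_comp_mul_left (a := -majτ k X) (b := majτ k X)
    (c := (X : ℝ) ^ k) (fun u => vint k 1 u ^ s * ec (-((n : ℝ) / (X : ℝ) ^ k) * u))
    (pow_ne_zero k hX0)
  rw [mul_neg, pow_mul_majτ hX, Complex.real_smul] at h
  have h2 : ∀ β : ℝ, vint k X β ^ s * ec (-(n : ℝ) * β) = (X : ℂ) ^ s *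
      (vint k 1 ((X : ℝ) ^ k * β) ^ s * ec (-((n : ℝ) / (X : ℝ) ^ k) * ((X : ℝ) ^ k * β))) := by
    intro β
    rw [vint_eq hX0, mul_pow, mul_assoc, Complex.ofReal_natCast]
    congr 3
    field_simp
  simp only [h2]
  rw [intervalIntegral.integral_const_mul, h, ← mul_assoc]
  congr 1
  push_cast
  rw [← div_eq_mul_inv, div_eq_iff (pow_ne_zero k hXC), ← pow_add]
  congr 1; omega

lemma tendsto_truncated_singInt {k s : ℕ} (hk : 1 ≤ k) (hs : k < s) {T r : ℕ → ℝ}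
    (hT : Filter.Tendsto T Filter.atTop Filter.atTop)
    (hr : Filter.Tendsto r Filter.atTop (nhds 1)) :
    Filter.Tendsto (fun n => ∫ u in (-T n)..T n, vint k 1 u ^ s * ec (-r n * u)) Filter.atTop
      (nhds (singInt s k)) := by
  have hcv := continuous_vint k 1
  have h1 : Filter.Tendsto (fun n => ∫ u : ℝ, (Set.Ioc (-T n) (T n)).indicator
      (fun u => vint k 1 u ^ s * ec (-r n * u)) u) Filter.atTop (nhds (singInt s k)) := by
    refine MeasureTheory.tendsto_integral_filter_of_dominated_convergence
      (fun u : ℝ => 4 ^ s * (1 + ‖u‖) ^ (-((s : ℝ) / k))) ?_ ?_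
      (integrable_one_add_norm_rpow hk hs) ?_
    · refine Filter.Eventually.of_forall fun n => ?_
      refine (Continuous.aestronglyMeasurable (by fun_prop)).indicator measurableSet_Ioc
    · refine Filter.Eventually.of_forall fun n => Filter.Eventually.of_forall fun u => ?_
      refine (norm_indicator_le_norm_self _ _).trans ?_
      rw [norm_mul, norm_ec, mul_one, norm_pow]
      exact norm_vint_one_pow_le hk s u
    · refine Filter.Eventually.of_forall fun u => ?_
      have h2 : Filter.Tendsto (fun n => vint k 1 u ^ s * ec (-r n * u)) Filter.atTop
          (nhds (vint k 1 u ^ s * ec (-u))) := by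
        refine Filter.Tendsto.const_mul _ ?_
        have h3 : Filter.Tendsto (fun n => -r n * u) Filter.atTop (nhds (-u)) := by
          simpa using (hr.neg).mul_const u
        exact (continuous_ec.tendsto _).comp h3
      refine h2.congr' ?_
      filter_upwards [hT.eventually_gt_atTop |u|] with n hn
      rw [Set.indicator_of_mem]
      exact ⟨(abs_lt.1 hn).1, (abs_lt.1 hn).2.le⟩
  refine h1.congr' ?_
  filter_upwards [hT.eventually_ge_atTop 0] with n hn
  rw [MeasureTheory.integral_indicator measurableSet_Ioc,
    intervalIntegral.integral_of_le (by linarith)]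

end SingularIntegral

section SingularSeriesTail

lemma norm_term_le_gmaj (s k n q : ℕ) :
    ‖∑ a ∈ (Icc 1 q).filter (fun a => a.Coprime q),
      gsum k q a ^ s * ec (-(n : ℝ) * (a : ℝ) / (q : ℝ))‖ ≤ gmaj s k q := by
  refine (norm_sum_le _ _).trans (le_of_eq (sum_congr rfl fun a _ => ?_))
  rw [norm_mul, norm_ec, mul_one, norm_pow]

lemma norm_singSeries_le {s k : ℕ} (h : Summable (gmaj s k)) (n : ℕ) :
    ‖singSeries s k n‖ ≤ ∑' q, gmaj s k q :=
  tsum_of_norm_bounded h.hasSum fun q => norm_term_le_gmaj s k n q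

lemma norm_singSeries_sub_le {s k : ℕ} (h : Summable (gmaj s k)) (n Q : ℕ) :
    ‖singSeries s k n - singPartial s k n Q‖ ≤ ∑' q, gmaj s k (q + (Q + 1)) := by
  have hsum : Summable fun q => ∑ a ∈ (Icc 1 q).filter (fun a => a.Coprime q),
      gsum k q a ^ s * ec (-(n : ℝ) * (a : ℝ) / (q : ℝ)) :=
    Summable.of_norm_bounded h fun q => norm_term_le_gmaj s k n q
  have h1 := hsum.sum_add_tsum_nat_add (Q + 1)
  have h2 : singPartial s k n Q = ∑ q ∈ range (Q + 1),
      ∑ a ∈ (Icc 1 q).filter (fun a => a.Coprime q),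
        gsum k q a ^ s * ec (-(n : ℝ) * (a : ℝ) / (q : ℝ)) := by
    rw [sum_range_succ', singPartial, farey, sum_sigma,
      sum_Icc_one_eq_sum_range (fun q => ∑ a ∈ (Icc 1 q).filter (fun a => a.Coprime q),
        gsum k q a ^ s * ec (-(n : ℝ) * (a : ℝ) / (q : ℝ)))]
    simp
  rw [← h2] at h1
  have h3 : singSeries s k n - singPartial s k n Q =
      ∑' q, ∑ a ∈ (Icc 1 (q + (Q + 1))).filter (fun a => a.Coprime (q + (Q + 1))),
        gsum k (q + (Q + 1)) a ^ s * ec (-(n : ℝ) * (a : ℝ) / ((q + (Q + 1) : ℕ) : ℝ)) := by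
    rw [sub_eq_iff_eq_add, add_comm, h1]
    rfl
  rw [h3]
  exact tsum_of_norm_bounded ((summable_nat_add_iff (Q + 1)).2 h).hasSum fun q =>
    norm_term_le_gmaj s k n _

end SingularSeriesTail

end Waring

namespace Waring

open Finset Filter Topology

section Root

/-- The integer part of the `k`-th root of `n`. -/
noncomputable def root (k n : ℕ) : ℕ := ⌊(n : ℝ) ^ (1 / (k : ℝ))⌋₊

lemma rpow_one_div_pow {k : ℕ} (hk : 1 ≤ k) (n : ℕ) : ((n : ℝ) ^ (1 / (k : ℝ))) ^ k = n := by
  rw [one_div]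
  exact Real.rpow_inv_natCast_pow (by positivity) (by omega)

lemma lt_root_add_one_pow {k : ℕ} (hk : 1 ≤ k) (n : ℕ) : n < (root k n + 1) ^ k := by
  have h := Nat.lt_floor_add_one ((n : ℝ) ^ (1 / (k : ℝ)))
  have h2 : ((n : ℝ) ^ (1 / (k : ℝ))) ^ k < ((root k n : ℝ) + 1) ^ k :=
    pow_lt_pow_left₀ h (by positivity) (by omega)
  rw [rpow_one_div_pow hk] at h2
  exact_mod_cast h2

lemma tendsto_rpow_one_div {k : ℕ} (hk : 1 ≤ k) :
    Tendsto (fun n : ℕ => (n : ℝ) ^ (1 / (k : ℝ))) atTop atTop := by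
  have hkR : (0 : ℝ) < k := by exact_mod_cast hk
  exact (tendsto_rpow_atTop (by positivity)).comp tendsto_natCast_atTop_atTop

lemma tendsto_root {k : ℕ} (hk : 1 ≤ k) : Tendsto (root k) atTop atTop :=
  tendsto_nat_floor_atTop.comp (tendsto_rpow_one_div hk)

lemma tendsto_root_div {k : ℕ} (hk : 1 ≤ k) :
    Tendsto (fun n : ℕ => (root k n : ℝ) / (n : ℝ) ^ (1 / (k : ℝ))) atTop (𝓝 1) :=
  tendsto_nat_floor_div_atTop.comp (tendsto_rpow_one_div hk)

lemma tendsto_div_root_pow {k : ℕ} (hk : 1 ≤ k) :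
    Tendsto (fun n : ℕ => (n : ℝ) / (root k n : ℝ) ^ k) atTop (𝓝 1) := by
  have h := ((tendsto_root_div hk).pow k).inv₀ (by simp)
  rw [one_pow, inv_one] at h
  refine h.congr fun n => ?_
  rw [div_pow, rpow_one_div_pow hk, inv_div]

end Root

section CircleMethod

lemma norm_Rcount_sub_le {k s : ℕ} (hk : 2 ≤ k) (hs : k + 1 ≤ s) (hsum : Summable (gmaj s k))
    {δ C : ℝ} {X n : ℕ} (hX : 2 ≤ X) (hn : n < (X + 1) ^ k)
    (hminor : ∫ α in Set.Ioc (majτ k X) (1 + majτ k X) \ major k X, ‖weylSum k X α‖ ^ s ≤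
        C * (X : ℝ) ^ (-δ) * (X : ℝ) ^ (s - k)) :
    ‖(Rcount s k n : ℂ) / (X : ℂ) ^ (s - k) - singInt s k * singSeries s k n‖ ≤
      C * (X : ℝ) ^ (-δ) + 8 * Real.pi * k * s * (X : ℝ) ^ (-(1 / 6) : ℝ) +
      (∑' q, gmaj s k q + ∑' q, gmaj s k (q + (majQ X + 1))) *
        ‖(∫ u in (-(X : ℝ) ^ (1 / 6 : ℝ))..(X : ℝ) ^ (1 / 6 : ℝ),
          vint k 1 u ^ s * ec (-((n : ℝ) / (X : ℝ) ^ k) * u)) - singInt s k‖ +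
      ‖singInt s k‖ * ∑' q, gmaj s k (q + (majQ X + 1)) := by
  have hXR : (2 : ℝ) ≤ X := by exact_mod_cast hX
  have hX0 : (0 : ℝ) < X := by linarith
  have hXC : (X : ℂ) ≠ 0 := by exact_mod_cast (by omega : X ≠ 0)
  set J := ∫ u in (-(X : ℝ) ^ (1 / 6 : ℝ))..(X : ℝ) ^ (1 / 6 : ℝ),
    vint k 1 u ^ s * ec (-((n : ℝ) / (X : ℝ) ^ k) * u) with hJ
  set P := singPartial s k n (majQ X) with hP
  set S := singSeries s k n with hS
  set I := singInt s k with hI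
  set t := ∑' q, gmaj s k (q + (majQ X + 1)) with ht
  have hcw := continuous_weylSum k X
  set F : ℝ → ℂ := fun α => weylSum k X α ^ s * ec (-(n : ℝ) * α) with hF
  have hFc : Continuous F := by fun_prop
  have hFper : Function.Periodic F 1 := fun α => by
    have : -(n : ℝ) * (α + 1) = -(n : ℝ) * α + ((-n : ℤ) : ℝ) := by push_cast; ring
    simp only [hF, weylSum_add_one, this, ec_add_int]
  set A := Set.Ioc (majτ k X) (1 + majτ k X) with hA
  have hMA : major k X ⊆ A :=
    Set.iUnion₂_subset fun p hp => arc_subset (two_mul_majτ_mul_le hk hX) hp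
  have hFA : MeasureTheory.IntegrableOn F A :=
    (hFc.integrableOn_Icc).mono_set Set.Ioc_subset_Icc_self
  have hR : (Rcount s k n : ℂ) = (∫ α in major k X, F α) + ∫ α in A \ major k X, F α := by
    rw [Rcount_eq_integral hn, ← integral_Ioc_eq hFper (majτ k X),
      MeasureTheory.setIntegral_sdiff (measurableSet_major k X) hFA hMA]
    ring
  have hV := norm_major_sub_le (n := n) hk hX hs
  rw [integral_vint_pow (by omega) (by omega), ← hJ, ← hP] at hV
  have hmin : ‖∫ α in A \ major k X, F α‖ ≤ C * (X : ℝ) ^ (-δ) * (X : ℝ) ^ (s - k) := by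
    refine (MeasureTheory.norm_integral_le_integral_norm _).trans (le_trans (le_of_eq ?_) hminor)
    refine MeasureTheory.integral_congr_ae (Eventually.of_forall fun α => ?_)
    simp only [hF, norm_mul, norm_ec, mul_one, norm_pow]
  have hSP : ‖S - P‖ ≤ t := norm_singSeries_sub_le hsum n _
  have hSn : ‖S‖ ≤ ∑' q, gmaj s k q := norm_singSeries_le hsum n
  have hPn : ‖P‖ ≤ ∑' q, gmaj s k q + t := by
    have := norm_sub_le S (S - P)
    rw [sub_sub_cancel] at this
    linarith
  have hXp : (0 : ℝ) < (X : ℝ) ^ (s - k) := by positivity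
  have hXcp : (X : ℂ) ^ (s - k) ≠ 0 := pow_ne_zero _ hXC
  have hdec : (Rcount s k n : ℂ) / (X : ℂ) ^ (s - k) - I * S =
      (∫ α in A \ major k X, F α) / (X : ℂ) ^ (s - k) +
      ((∫ α in major k X, F α) - P * ((X : ℂ) ^ (s - k) * J)) / (X : ℂ) ^ (s - k) +
      P * (J - I) - I * (S - P) := by
    rw [hR]
    field_simp
    ring
  have hdiv : ∀ (z : ℂ) (B : ℝ), ‖z‖ ≤ B * (X : ℝ) ^ (s - k) → ‖z / (X : ℂ) ^ (s - k)‖ ≤ B := by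
    intro z B hz
    rw [norm_div, norm_pow, Complex.norm_natCast, div_le_iff₀ hXp]
    exact hz
  rw [hdec]
  refine (norm_sub_le _ _).trans ?_
  have h1 := norm_add₃_le (a := (∫ α in A \ major k X, F α) / (X : ℂ) ^ (s - k))
    (b := ((∫ α in major k X, F α) - P * ((X : ℂ) ^ (s - k) * J)) / (X : ℂ) ^ (s - k))
    (c := P * (J - I))
  have h2 := hdiv _ _ hmin
  have h3 := hdiv _ _ hV
  have h4 : ‖P * (J - I)‖ ≤ (∑' q, gmaj s k q + t) * ‖J - I‖ := by
    rw [norm_mul]; gcongr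
  have h5 : ‖I * (S - P)‖ ≤ ‖I‖ * t := by rw [norm_mul]; gcongr
  linarith

/-- The circle method asymptotic, normalised by the integer part of `n ^ (1 / k)`. -/
lemma tendsto_Rcount_div_sub {k s : ℕ} (hk : 2 ≤ k) (hs : 2 * rr k + 1 ≤ s) :
    Tendsto (fun n : ℕ => (Rcount s k n : ℂ) / (root k n : ℂ) ^ (s - k) -
      singInt s k * singSeries s k n) atTop (𝓝 0) := by
  have hk1 : 1 ≤ k := by omega
  have hsum := summable_gmaj hk hs
  have hks : k + 1 ≤ s := by
    have h1 := two_mul_rr k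
    nlinarith
  obtain ⟨δ, hδ, C, X₀, hX₀, hminor⟩ := exists_minor_le hk hs
  have hroot := tendsto_root (k := k) (by omega)
  have hpow : ∀ c : ℝ, 0 < c → Tendsto (fun n => ((root k n : ℕ) : ℝ) ^ (-c)) atTop (𝓝 0) :=
    fun c hc => (tendsto_rpow_neg_atTop hc).comp (tendsto_natCast_atTop_atTop.comp hroot)
  have hT : Tendsto (fun n => ((root k n : ℕ) : ℝ) ^ (1 / 6 : ℝ)) atTop atTop :=
    (tendsto_rpow_atTop (by norm_num)).comp (tendsto_natCast_atTop_atTop.comp hroot)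
  have htail : Tendsto (fun n => ∑' q, gmaj s k (q + (majQ (root k n) + 1))) atTop (𝓝 0) := by
    refine (tendsto_sum_nat_add (gmaj s k)).comp ?_
    exact (tendsto_add_atTop_nat 1).comp (tendsto_nat_floor_atTop.comp hT)
  have hJ : Tendsto (fun n : ℕ => ‖(∫ u in (-(root k n : ℝ) ^ (1 / 6 : ℝ))..(root k n : ℝ) ^ (1 / 6 : ℝ),
          vint k 1 u ^ s * ec (-((n : ℝ) / (root k n : ℝ) ^ k) * u)) - singInt s k‖)
      atTop (𝓝 0) :=
    tendsto_iff_norm_sub_tendsto_zero.1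
      (tendsto_truncated_singInt hk1 (by omega) hT (tendsto_div_root_pow hk1))
  rw [tendsto_zero_iff_norm_tendsto_zero]
  have hbound := ((((hpow δ hδ).const_mul C).add
    ((hpow (1 / 6) (by norm_num)).const_mul (8 * Real.pi * k * s))).add
    ((htail.const_add (∑' q, gmaj s k q)).mul hJ)).add (htail.const_mul ‖singInt s k‖)
  simp only [mul_zero, add_zero] at hbound
  refine tendsto_of_tendsto_of_tendsto_of_le_of_le' tendsto_const_nhds hbound
    (Eventually.of_forall fun _ => norm_nonneg _) ?_
  filter_upwards [hroot.eventually_ge_atTop X₀] with n hn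
  exact norm_Rcount_sub_le hk hks hsum (hX₀.trans hn) (lt_root_add_one_pow (by omega) n)
    (hminor _ hn)

/-- The circle method asymptotic. -/
lemma tendsto_Rcount_div_rpow_sub {k s : ℕ} (hk : 2 ≤ k) (hs : 2 * rr k + 1 ≤ s) :
    Tendsto (fun n : ℕ => (Rcount s k n : ℂ) / (((n : ℝ) ^ ((s : ℝ) / k - 1) : ℝ) : ℂ) -
      singInt s k * singSeries s k n) atTop (𝓝 0) := by
  have hk1 : 1 ≤ k := by omega
  have hkR : (k : ℝ) ≠ 0 := by exact_mod_cast (by omega : k ≠ 0)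
  have hks : k + 1 ≤ s := by
    have h1 := two_mul_rr k
    nlinarith
  have hsum := summable_gmaj hk hs
  have h := tendsto_Rcount_div_sub hk hs
  have hw : Tendsto (fun n : ℕ => (((root k n : ℝ) / (n : ℝ) ^ (1 / (k : ℝ)) : ℝ) : ℂ) ^ (s - k))
      atTop (𝓝 1) := by
    have := ((Complex.continuous_ofReal.tendsto _).comp (tendsto_root_div hk1)).pow (s - k)
    simpa using this
  have hb : Tendsto (fun n : ℕ => ((((root k n : ℝ) / (n : ℝ) ^ (1 / (k : ℝ)) : ℝ) : ℂ) ^ (s - k) - 1)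
      * (singInt s k * singSeries s k n)) atTop (𝓝 0) := by
    refine Tendsto.zero_mul_isBoundedUnder_le (by simpa using hw.sub_const 1) ?_
    refine isBoundedUnder_of ⟨‖singInt s k‖ * ∑' q, gmaj s k q, fun n => ?_⟩
    simp only [Function.comp_apply, norm_mul]
    gcongr
    exact norm_singSeries_le hsum n
  have hmain := (hw.mul h).add hb
  simp only [mul_zero, add_zero] at hmain
  refine hmain.congr' ?_
  filter_upwards [(tendsto_root hk1).eventually_ge_atTop 1, eventually_ge_atTop 1] with n hr hn
  have hn0 : (0 : ℝ) < n := by exact_mod_cast hn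
  have hrC : (root k n : ℂ) ≠ 0 := by exact_mod_cast (by omega : root k n ≠ 0)
  have hpow : ((n : ℝ) ^ (1 / (k : ℝ))) ^ (s - k) = (n : ℝ) ^ ((s : ℝ) / k - 1) := by
    rw [← Real.rpow_natCast, ← Real.rpow_mul hn0.le, Nat.cast_sub (by omega)]
    congr 1
    field_simp
  have hpC : (((n : ℝ) ^ ((s : ℝ) / k - 1) : ℝ) : ℂ) ≠ 0 := by
    exact_mod_cast (Real.rpow_pos_of_pos hn0 _).ne'
  rw [Complex.ofReal_div, div_pow, ← Complex.ofReal_pow _ (s - k), ← Complex.ofReal_pow _ (s - k),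
    hpow]
  push_cast at hpC ⊢
  field_simp
  ring

end CircleMethod

end Waring

namespace Waring

open Finset Filter Topology MeasureTheory
open scoped Pointwise

section LatticePoints

lemma map_abs_volume :
    (volume : Measure ℝ).map (fun x => |x|) = (2 : ENNReal) • volume.restrict (Set.Ioi 0) := by
  ext S hS
  have hm : Measurable (fun x : ℝ => |x|) := continuous_abs.measurable
  rw [Measure.map_apply hm hS, Measure.smul_apply, Measure.restrict_apply hS, smul_eq_mul]
  have h1 : ((fun x : ℝ => |x|) ⁻¹' S) =ᵐ[volume]
      ((S ∩ Set.Ioi 0) ∪ Neg.neg ⁻¹' (S ∩ Set.Ioi 0) : Set ℝ) := by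
    have h0 : ∀ᵐ x : ℝ, x ≠ 0 := by simp [ae_iff]
    filter_upwards [h0] with x hx
    refine propext ?_
    change |x| ∈ S ↔ x ∈ S ∧ 0 < x ∨ -x ∈ S ∧ 0 < -x
    rcases lt_or_gt_of_ne hx with h | h
    · rw [abs_of_neg h]
      constructor
      · exact fun h' => Or.inr ⟨h', by linarith⟩
      · rintro (⟨_, h'⟩ | ⟨h', _⟩)
        · linarith
        · exact h'
    · rw [abs_of_pos h]
      constructor
      · exact fun h' => Or.inl ⟨h', h⟩
      · rintro (⟨h', _⟩ | ⟨_, h'⟩)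
        · exact h'
        · linarith
  have hS' : MeasurableSet (S ∩ Set.Ioi 0) := hS.inter measurableSet_Ioi
  rw [measure_congr h1, measure_union _ (measurable_neg hS'), Measure.measure_preimage_neg, two_mul]
  rw [Set.disjoint_left]
  rintro x ⟨_, hx⟩ ⟨_, hx'⟩
  simp only [Set.mem_Ioi] at hx hx'
  linarith

lemma map_pi_abs_volume (s : ℕ) :
    (volume : Measure (Fin s → ℝ)).map (fun x i => |x i|) =
      (2 : ENNReal) ^ s • volume.restrict (Set.univ.pi fun _ => Set.Ioi 0) := by
  have hm : Measurable (fun x : ℝ => |x|) := continuous_abs.measurable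
  have : SigmaFinite ((volume : Measure ℝ).map (fun x => |x|)) := by
    rw [map_abs_volume, two_smul]; infer_instance
  rw [volume_pi, Measure.pi_map_pi (fun _ => hm.aemeasurable), Measure.restrict_pi_pi]
  refine Measure.pi_eq fun S _ => ?_
  rw [map_abs_volume, Measure.smul_apply, Measure.pi_pi]
  simp [prod_mul_distrib]

/-- The part of the unit `ℓᵏ`-ball in the open positive orthant. -/
def posBall (s k : ℕ) : Set (Fin s → ℝ) := {x | (∀ i, 0 < x i) ∧ ∑ i, x i ^ k ≤ 1}

lemma measurableSet_posBall (s k : ℕ) : MeasurableSet (posBall s k) := by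
  have : posBall s k = (⋂ i, {x | 0 < x i}) ∩ {x | ∑ i, x i ^ k ≤ 1} := by
    ext x; simp [posBall]
  rw [this]
  refine (MeasurableSet.iInter fun i => ?_).inter ?_
  · exact measurableSet_lt measurable_const (measurable_pi_apply i)
  · exact measurableSet_le (by fun_prop) measurable_const

lemma volume_posBall {s k : ℕ} (hs : 1 ≤ s) (hk : 1 ≤ k) : volume.real (posBall s k) =
    Real.Gamma (1 + 1 / (k : ℝ)) ^ s / Real.Gamma ((s : ℝ) / k + 1) := by
  have : Nonempty (Fin s) := ⟨⟨0, hs⟩⟩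
  have hkR : (1 : ℝ) ≤ k := by exact_mod_cast hk
  have hk0 : (0 : ℝ) < k := by linarith
  have h := volume_sum_rpow_le (Fin s) hkR 1
  simp only [ENNReal.ofReal_one, one_pow, one_mul, Fintype.card_fin, Real.rpow_natCast] at h
  have hset : {x : Fin s → ℝ | (∑ i, |x i| ^ k) ^ (1 / (k : ℝ)) ≤ 1} =
      (fun x i => |x i|) ⁻¹' {x : Fin s → ℝ | ∑ i, x i ^ k ≤ 1} := by
    ext x
    have h0 : 0 ≤ ∑ i, |x i| ^ k := by positivity
    simp only [Set.mem_ofPred_eq, Set.mem_preimage]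
    constructor
    · intro hx
      by_contra! hc
      exact absurd hx (not_le.2 (Real.one_lt_rpow hc (by positivity)))
    · exact fun hx => Real.rpow_le_one h0 hx (by positivity)
  have hmeas : MeasurableSet {x : Fin s → ℝ | ∑ i, x i ^ k ≤ 1} :=
    measurableSet_le (by fun_prop) measurable_const
  have hpos : posBall s k = {x : Fin s → ℝ | ∑ i, x i ^ k ≤ 1} ∩ Set.univ.pi fun _ => Set.Ioi 0 := by
    ext x; simp [posBall, and_comm]
  rw [hset, ← Measure.map_apply (by fun_prop) hmeas, map_pi_abs_volume, Measure.smul_apply,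
    Measure.restrict_apply hmeas, ← hpos, smul_eq_mul] at h
  have hG1 : 0 < Real.Gamma (1 / (k : ℝ) + 1) := Real.Gamma_pos_of_pos (by positivity)
  have hG2 : 0 < Real.Gamma ((s : ℝ) / k + 1) := Real.Gamma_pos_of_pos (by positivity)
  have h' := congrArg ENNReal.toReal h
  rw [ENNReal.toReal_mul, ENNReal.toReal_ofReal (by positivity), mul_pow, mul_div_assoc] at h'
  simp only [ENNReal.toReal_pow, ENNReal.toReal_ofNat] at h'
  rw [Measure.real, add_comm 1]
  exact mul_left_cancel₀ (by positivity) h'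

lemma convex_posBall (s k : ℕ) : Convex ℝ (posBall s k) := by
  rintro x ⟨hx, hx1⟩ y ⟨hy, hy1⟩ a b ha hb hab
  refine ⟨fun i => ?_, ?_⟩
  · have h := (convex_Ioi (0 : ℝ)) (hx i) (hy i) ha hb hab
    simpa using h
  · calc ∑ i, (a • x + b • y) i ^ k ≤ ∑ i, (a * x i ^ k + b * y i ^ k) := by
          refine sum_le_sum fun i _ => ?_
          have h := (convexOn_pow k).2 (Set.mem_Ici.2 (hx i).le) (Set.mem_Ici.2 (hy i).le) ha hb hab
          simpa using h
      _ = a * ∑ i, x i ^ k + b * ∑ i, y i ^ k := by rw [sum_add_distrib, mul_sum, mul_sum]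
      _ ≤ a * 1 + b * 1 := by gcongr
      _ = 1 := by linarith

lemma isBounded_posBall {s k : ℕ} (hk : 1 ≤ k) : Bornology.IsBounded (posBall s k) := by
  refine (Metric.isBounded_iff_subset_closedBall 0).2 ⟨1, fun x hx => ?_⟩
  rw [mem_closedBall_zero_iff, pi_norm_le_iff_of_nonneg zero_le_one]
  intro i
  rw [Real.norm_of_nonneg (hx.1 i).le]
  have h1 : x i ^ k ≤ 1 := (single_le_sum (f := fun i => x i ^ k)
    (fun j _ => pow_nonneg (hx.1 j).le k) (mem_univ i)).trans hx.2
  exact (pow_le_one_iff_of_nonneg (hx.1 i).le (by omega)).1 h1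

lemma sum_Rcount {s k M : ℕ} (hs : 1 ≤ s) (hk : 1 ≤ k) (hM : 1 ≤ M) :
    ∑ n ∈ Icc 1 (M ^ k), Rcount s k n =
      Nat.card ↑(posBall s k ∩
        (M : ℝ)⁻¹ • (Submodule.span ℤ (Set.range (Pi.basisFun ℝ (Fin s))) : Set (Fin s → ℝ))) := by
  have hMR : (0 : ℝ) < M := by exact_mod_cast hM
  set T : Finset (Fin s → ℕ) := (Fintype.piFinset fun _ => Icc 1 M).filter
    fun x => ∑ i, x i ^ k ≤ M ^ k with hT
  have hle : ∀ (x : Fin s → ℕ), ∑ i, x i ^ k ≤ M ^ k → ∀ i, x i ≤ M := by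
    intro x hx i
    have h3 : x i ^ k ≤ M ^ k := (single_le_sum (f := fun i => x i ^ k)
      (fun _ _ => Nat.zero_le _) (mem_univ i)).trans hx
    exact (Nat.pow_le_pow_iff_left (by omega)).1 h3
  have hcard : T.card = ∑ n ∈ Icc 1 (M ^ k), Rcount s k n := by
    rw [card_eq_sum_card_fiberwise (f := fun x : Fin s → ℕ => ∑ i, x i ^ k) (t := Icc 1 (M ^ k))]
    · refine sum_congr rfl fun n hn => ?_
      rw [Rcount, ← Set.ncard_coe_finset]
      congr 1
      ext x
      simp only [hT, coe_filter, mem_filter, Fintype.mem_piFinset, mem_Icc, Set.mem_ofPred_eq]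
      constructor
      · rintro ⟨⟨h1, _⟩, h2⟩
        exact ⟨fun i => (h1 i).1, h2⟩
      · rintro ⟨h1, h2⟩
        have h3 : ∑ i, x i ^ k ≤ M ^ k := h2.le.trans (mem_Icc.1 hn).2
        exact ⟨⟨fun i => ⟨h1 i, hle x h3 i⟩, h3⟩, h2⟩
    · intro x hx
      simp only [hT, coe_filter, Fintype.mem_piFinset, mem_Icc, Set.mem_ofPred_eq] at hx
      simp only [coe_Icc, Set.mem_Icc]
      refine ⟨?_, hx.2⟩
      refine le_trans ?_ (single_le_sum (f := fun i => x i ^ k)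
        (fun _ _ => Nat.zero_le _) (mem_univ (⟨0, hs⟩ : Fin s)))
      exact Nat.one_le_pow _ _ (hx.1 _).1
  rw [← hcard, Nat.card_coe_set_eq, ← Set.ncard_coe_finset]
  refine Set.ncard_congr (fun x _ => (fun i => (M : ℝ)⁻¹ * (x i : ℝ))) ?_ ?_ ?_
  · intro x hx
    simp only [hT, coe_filter, Fintype.mem_piFinset, mem_Icc, Set.mem_ofPred_eq] at hx
    refine ⟨⟨fun i => ?_, ?_⟩, ?_⟩
    · have : (1 : ℝ) ≤ x i := by exact_mod_cast (hx.1 i).1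
      positivity
    · have h : (∑ i, (x i : ℝ) ^ k) ≤ (M : ℝ) ^ k := by exact_mod_cast hx.2
      simp only [mul_pow]
      rw [← mul_sum, inv_pow, inv_mul_le_iff₀ (by positivity), mul_one]
      exact h
    · refine Set.mem_smul_set.2 ⟨fun i => (x i : ℝ), ?_, by ext i; simp⟩
      rw [SetLike.mem_coe, Module.Basis.mem_span_iff_repr_mem]
      intro i
      exact ⟨(x i : ℤ), by simp⟩
  · intro x y _ _ hxy
    ext i
    have := congrFun hxy i
    have h := mul_left_cancel₀ (inv_ne_zero hMR.ne') this
    exact_mod_cast h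
  · rintro y ⟨⟨hy1, hy2⟩, hy3⟩
    obtain ⟨z, hz, rfl⟩ := Set.mem_smul_set.1 hy3
    rw [SetLike.mem_coe, Module.Basis.mem_span_iff_repr_mem] at hz
    choose w hw using hz
    simp only [algebraMap_int_eq, eq_intCast, Pi.basisFun_repr] at hw
    simp only [Pi.smul_apply, smul_eq_mul, ← hw] at hy1 hy2
    have hw0 : ∀ i, 0 < w i := fun i => by
      have := (pos_iff_pos_of_mul_pos (hy1 i)).1 (inv_pos.2 hMR)
      exact_mod_cast this
    have hwn : ∀ i, ((w i).toNat : ℤ) = w i := fun i => Int.toNat_of_nonneg (hw0 i).le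
    have hwR : ∀ i, (((w i).toNat : ℕ) : ℝ) = z i := fun i => by
      have h : (((w i).toNat : ℤ) : ℝ) = (w i : ℝ) := by rw [hwn]
      rw [← hw i, ← h, Int.cast_natCast]
    have hsum : ∑ i, (w i).toNat ^ k ≤ M ^ k := by
      simp only [mul_pow] at hy2
      rw [← mul_sum, inv_pow, inv_mul_le_iff₀ (by positivity), mul_one] at hy2
      simp only [hw, ← hwR] at hy2
      exact_mod_cast hy2
    refine ⟨fun i => (w i).toNat, ?_, ?_⟩
    · simp only [hT, coe_filter, Fintype.mem_piFinset, mem_Icc, Set.mem_ofPred_eq]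
      refine ⟨fun i => ⟨?_, hle _ hsum i⟩, hsum⟩
      have := hw0 i
      omega
    · ext i
      simp [hwR]

lemma tendsto_sum_Rcount {s k : ℕ} (hs : 1 ≤ s) (hk : 1 ≤ k) :
    Tendsto (fun M : ℕ => ((∑ n ∈ Icc 1 (M ^ k), Rcount s k n : ℕ) : ℝ) / (M : ℝ) ^ s) atTop
      (𝓝 (Real.Gamma (1 + 1 / (k : ℝ)) ^ s / Real.Gamma ((s : ℝ) / k + 1))) := by
  have h := tendsto_card_div_pow_atTop_volume (posBall s k) (isBounded_posBall hk)
    (measurableSet_posBall s k) ((convex_posBall s k).addHaar_frontier volume)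
  rw [volume_posBall hs hk] at h
  refine h.congr' ?_
  filter_upwards [eventually_ge_atTop 1] with M hM
  rw [sum_Rcount hs hk hM, Fintype.card_fin]

end LatticePoints

end Waring

namespace Waring

open Finset Filter Topology

section Averages

lemma tendsto_sum_rpow_div {τ : ℝ} (hτ : 0 ≤ τ) :
    Tendsto (fun N : ℕ => (∑ n ∈ Icc 1 N, (n : ℝ) ^ τ) / (N : ℝ) ^ (τ + 1)) atTop
      (𝓝 (1 / (τ + 1))) := by
  have hInt : ∀ N : ℕ, ∫ x in (0 : ℝ)..(0 + N), x ^ τ = (N : ℝ) ^ (τ + 1) / (τ + 1) := fun N => by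
    rw [zero_add, integral_rpow (Or.inl (by linarith)), Real.zero_rpow (by linarith), sub_zero]
  have hmono : ∀ N : ℕ, MonotoneOn (fun x : ℝ => x ^ τ) (Set.Icc 0 (0 + N)) :=
    fun N x hx y _ hxy => Real.rpow_le_rpow hx.1 hxy hτ
  have hup : Tendsto (fun N : ℕ => 1 / (τ + 1) + 1 / (N : ℝ)) atTop (𝓝 (1 / (τ + 1))) := by
    simpa using tendsto_one_div_atTop_nhds_zero_nat.const_add (1 / (τ + 1))
  refine tendsto_of_tendsto_of_tendsto_of_le_of_le' tendsto_const_nhds hup ?_ ?_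
  · filter_upwards [eventually_ge_atTop 1] with N hN
    have hN0 : (0 : ℝ) < N := by exact_mod_cast hN
    have h := (hmono N).integral_le_sum
    rw [hInt] at h
    simp only [zero_add] at h
    rw [le_div_iff₀ (by positivity), sum_Icc_one_eq_sum_range]
    rwa [one_div_mul_eq_div]
  · filter_upwards [eventually_ge_atTop 1] with N hN
    have hN0 : (0 : ℝ) < N := by exact_mod_cast hN
    have h := (hmono N).sum_le_integral
    rw [hInt] at h
    simp only [zero_add] at h
    have h2 : ∑ n ∈ Icc 1 N, (n : ℝ) ^ τ ≤ (N : ℝ) ^ (τ + 1) / (τ + 1) + (N : ℝ) ^ τ := by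
      rw [sum_Icc_one_eq_sum_range]
      have h3 := sum_range_succ' (fun n : ℕ => (n : ℝ) ^ τ) N
      rw [sum_range_succ] at h3
      have h4 : (0 : ℝ) ≤ ((0 : ℕ) : ℝ) ^ τ := by positivity
      linarith
    rw [div_le_iff₀ (by positivity)]
    refine h2.trans_eq ?_
    rw [Real.rpow_add_one hN0.ne']
    field_simp

lemma norm_one_sub_mul_sum_le {w : ℕ → ℝ} (hw : Monotone w) (hw0 : 0 ≤ w 0) {z : ℂ}
    (hz : ‖z‖ = 1) (N : ℕ) : ‖(1 - z) * ∑ n ∈ Icc 1 N, (w n : ℂ) * z ^ n‖ ≤ 2 * w N := by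
  have hwn : ∀ n, 0 ≤ w n := fun n => hw0.trans (hw n.zero_le)
  have key : ‖(1 - z) * ∑ n ∈ Icc 1 N, (w n : ℂ) * z ^ n + w N * z ^ (N + 1)‖ ≤ w N := by
    induction N with
    | zero => simp [hz, abs_of_nonneg hw0]
    | succ N ih =>
      rw [sum_Icc_succ_top (by omega)]
      have h1 : (1 - z) * (∑ n ∈ Icc 1 N, (w n : ℂ) * z ^ n + w (N + 1) * z ^ (N + 1)) +
          w (N + 1) * z ^ (N + 1 + 1) =
          ((1 - z) * ∑ n ∈ Icc 1 N, (w n : ℂ) * z ^ n + w N * z ^ (N + 1)) +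
            ((w (N + 1) - w N : ℝ) : ℂ) * z ^ (N + 1) := by
        push_cast; ring
      rw [h1]
      refine (norm_add_le _ _).trans ?_
      rw [norm_mul, norm_pow, hz, one_pow, mul_one, Complex.norm_real,
        Real.norm_of_nonneg (sub_nonneg.2 (hw N.le_succ))]
      linarith
  have h2 : ‖(w N : ℂ) * z ^ (N + 1)‖ = w N := by
    rw [norm_mul, norm_pow, hz, one_pow, mul_one, Complex.norm_real, Real.norm_of_nonneg (hwn N)]
  have h3 := norm_sub_le ((1 - z) * ∑ n ∈ Icc 1 N, (w n : ℂ) * z ^ n + w N * z ^ (N + 1))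
    ((w N : ℂ) * z ^ (N + 1))
  rw [add_sub_cancel_right] at h3
  linarith

lemma tendsto_twisted_sum_rpow_div {τ : ℝ} (hτ : 0 ≤ τ) {z : ℂ} (hz : ‖z‖ = 1) (hz1 : z ≠ 1) :
    Tendsto (fun N : ℕ => (∑ n ∈ Icc 1 N, (((n : ℝ) ^ τ : ℝ) : ℂ) * z ^ n) /
      (((N : ℝ) ^ (τ + 1) : ℝ) : ℂ)) atTop (𝓝 0) := by
  have hz0 : 0 < ‖1 - z‖ := norm_pos_iff.2 (sub_ne_zero.2 (Ne.symm hz1))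
  have hlim : Tendsto (fun N : ℕ => 2 / ‖1 - z‖ * (1 / (N : ℝ))) atTop (𝓝 0) := by
    simpa using tendsto_one_div_atTop_nhds_zero_nat.const_mul (2 / ‖1 - z‖)
  refine squeeze_zero_norm' ?_ hlim
  filter_upwards [eventually_ge_atTop 1] with N hN
  have hN0 : (0 : ℝ) < N := by exact_mod_cast hN
  have hmono : Monotone fun n : ℕ => (n : ℝ) ^ τ := fun a b hab =>
    Real.rpow_le_rpow (by positivity) (by exact_mod_cast hab) hτ
  have h := norm_one_sub_mul_sum_le hmono (by positivity) hz N
  rw [norm_mul] at h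
  rw [norm_div, Complex.norm_real, Real.norm_of_nonneg (by positivity),
    div_le_iff₀ (by positivity), Real.rpow_add_one hN0.ne']
  have : 2 / ‖1 - z‖ * (1 / (N : ℝ)) * ((N : ℝ) ^ τ * N) = (2 * (N : ℝ) ^ τ) / ‖1 - z‖ := by
    field_simp
  rw [this, le_div_iff₀ hz0, mul_comm]
  exact h

lemma ec_neg_mul_div (n a q : ℕ) : ec (-(n : ℝ) * a / q) = ec (-(a : ℝ) / q) ^ n := by
  rw [ec_eq, ec_eq, ← Complex.exp_nat_mul]
  congr 1
  push_cast
  ring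

lemma ec_neg_div_ne_one {a q : ℕ} (hq : 2 ≤ q) (h : a.Coprime q) :
    ec (-(a : ℝ) / q) ≠ 1 := by
  intro h1
  rw [ec_eq, Complex.exp_eq_one_iff] at h1
  obtain ⟨m, hm⟩ := h1
  have hq0 : (q : ℂ) ≠ 0 := by exact_mod_cast (by omega : q ≠ 0)
  have h2 : (((-(a : ℝ) / q : ℝ)) : ℂ) = m := by
    apply mul_left_cancel₀ Complex.two_pi_I_ne_zero
    rw [mul_comm _ (m : ℂ), ← hm]
    push_cast
    ring
  push_cast at h2
  rw [div_eq_iff hq0] at h2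
  have h3 : -(a : ℤ) = m * q := by exact_mod_cast h2
  have h4 : (q : ℤ) ∣ a := ⟨-m, by linarith⟩
  have h5 : q ∣ a := by exact_mod_cast h4
  have h6 : q ∣ 1 := by rw [← h]; exact Nat.dvd_gcd h5 dvd_rfl
  have := Nat.le_of_dvd one_pos h6
  omega

lemma gsum_one (k a : ℕ) : gsum k 1 a = 1 := by
  have h := ec_int (a : ℤ)
  simp only [Int.cast_natCast] at h
  simp [gsum, h]

lemma tendsto_sum_mul_term {s k : ℕ} {τ : ℝ} (hτ : 0 ≤ τ) (q : ℕ) :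
    Tendsto (fun N : ℕ => (∑ n ∈ Icc 1 N, (((n : ℝ) ^ τ : ℝ) : ℂ) *
        ∑ a ∈ (Icc 1 q).filter (fun a => a.Coprime q),
          gsum k q a ^ s * ec (-(n : ℝ) * (a : ℝ) / (q : ℝ))) / (((N : ℝ) ^ (τ + 1) : ℝ) : ℂ))
      atTop (𝓝 (if q = 1 then (((1 / (τ + 1) : ℝ)) : ℂ) else 0)) := by
  split_ifs with hq
  · subst hq
    have h := (Complex.continuous_ofReal.tendsto _).comp (tendsto_sum_rpow_div hτ)
    refine h.congr fun N => ?_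
    simp only [Function.comp_apply]
    push_cast
    congr 1
    refine sum_congr rfl fun n _ => ?_
    have h1 : ec (-(n : ℝ)) = 1 := by
      have := ec_int (-(n : ℤ))
      simpa using this
    simp [gsum_one, h1]
  · have h : Tendsto (fun N : ℕ => ∑ a ∈ (Icc 1 q).filter (fun a => a.Coprime q), gsum k q a ^ s *
        ((∑ n ∈ Icc 1 N, (((n : ℝ) ^ τ : ℝ) : ℂ) * ec (-(a : ℝ) / q) ^ n) /
          (((N : ℝ) ^ (τ + 1) : ℝ) : ℂ))) atTop (𝓝 0) := by
      rw [← sum_const_zero (s := (Icc 1 q).filter (fun a => a.Coprime q))]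
      refine tendsto_finsetSum _ fun a ha => ?_
      rw [mem_filter, mem_Icc] at ha
      simpa using (tendsto_twisted_sum_rpow_div hτ (norm_ec _)
        (ec_neg_div_ne_one (by omega) ha.2)).const_mul (gsum k q a ^ s)
    refine h.congr fun N => ?_
    simp only [mul_sum, sum_div, ec_neg_mul_div]
    rw [sum_comm]
    refine sum_congr rfl fun n _ => sum_congr rfl fun a _ => ?_
    ring

lemma tendsto_sum_singSeries {s k : ℕ} (hsum : Summable (gmaj s k)) {τ : ℝ} (hτ : 0 ≤ τ) :
    Tendsto (fun N : ℕ => (∑ n ∈ Icc 1 N, (((n : ℝ) ^ τ : ℝ) : ℂ) * singSeries s k n) /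
      (((N : ℝ) ^ (τ + 1) : ℝ) : ℂ)) atTop (𝓝 (((1 / (τ + 1) : ℝ)) : ℂ)) := by
  have h := tendsto_tsum_of_dominated_convergence (𝓕 := atTop) hsum
    (fun q => tendsto_sum_mul_term (s := s) (k := k) hτ q) ?_
  · rw [tsum_ite_eq] at h
    refine h.congr fun N => ?_
    rw [tsum_div_const]
    congr 1
    rw [Summable.tsum_finsetSum]
    · refine sum_congr rfl fun n _ => ?_
      rw [tsum_mul_left]
      rfl
    · intro n _
      exact (Summable.of_norm_bounded hsum (norm_term_le_gmaj s k n)).mul_left _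
  · filter_upwards [eventually_ge_atTop 1] with N hN q
    have hN0 : (0 : ℝ) < N := by exact_mod_cast hN
    rw [norm_div, Complex.norm_real, Real.norm_of_nonneg (by positivity),
      div_le_iff₀ (by positivity)]
    have hb : ∀ n ∈ Icc 1 N, ‖(((n : ℝ) ^ τ : ℝ) : ℂ) *
        ∑ a ∈ (Icc 1 q).filter (fun a => a.Coprime q),
          gsum k q a ^ s * ec (-(n : ℝ) * (a : ℝ) / (q : ℝ))‖ ≤ (N : ℝ) ^ τ * gmaj s k q := by
      intro n hn
      rw [norm_mul, Complex.norm_real, Real.norm_of_nonneg (by positivity)]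
      have : (n : ℝ) ≤ N := by exact_mod_cast (mem_Icc.1 hn).2
      gcongr
      exact norm_term_le_gmaj s k n q
    refine (norm_sum_le_of_le _ hb).trans_eq ?_
    rw [sum_const, Nat.card_Icc, Real.rpow_add_one hN0.ne', nsmul_eq_mul]
    simp only [add_tsub_cancel_right]
    ring

lemma tendsto_sum_rpow_mul_of_tendsto_zero {τ : ℝ} (hτ : 0 ≤ τ) {u : ℕ → ℂ}
    (hu : Tendsto u atTop (𝓝 0)) :
    Tendsto (fun N : ℕ => (∑ n ∈ Icc 1 N, (((n : ℝ) ^ τ : ℝ) : ℂ) * u n) /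
      (((N : ℝ) ^ (τ + 1) : ℝ) : ℂ)) atTop (𝓝 0) := by
  have h1 : (fun n : ℕ => ((((n + 1 : ℕ) : ℝ) ^ τ : ℝ) : ℂ) * u (n + 1)) =o[atTop]
      fun n : ℕ => ((n + 1 : ℕ) : ℝ) ^ τ := by
    have hu' : (fun n : ℕ => u (n + 1)) =o[atTop] fun _ => (1 : ℝ) :=
      (Asymptotics.isLittleO_one_iff ℝ).2 (hu.comp (tendsto_add_atTop_nat 1))
    have h0 : (fun n : ℕ => ((((n + 1 : ℕ) : ℝ) ^ τ : ℝ) : ℂ)) =O[atTop]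
        fun n : ℕ => ((n + 1 : ℕ) : ℝ) ^ τ :=
      Asymptotics.IsBigO.of_norm_le fun n => by
        rw [Complex.norm_real, Real.norm_of_nonneg (by positivity)]
    simpa using h0.mul_isLittleO hu'
  have hS : Tendsto (fun N : ℕ => ∑ n ∈ range N, ((n + 1 : ℕ) : ℝ) ^ τ) atTop atTop := by
    refine tendsto_atTop_mono (fun N => ?_) tendsto_natCast_atTop_atTop
    calc (N : ℝ) = ∑ n ∈ range N, (1 : ℝ) := by simp
      _ ≤ _ := sum_le_sum fun n _ => Real.one_le_rpow (by push_cast; linarith [n.cast_nonneg (α := ℝ)]) hτ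
  have h2 := h1.sum_range (fun n => by positivity) hS
  have h3 : (fun N : ℕ => ∑ n ∈ range N, ((n + 1 : ℕ) : ℝ) ^ τ) =O[atTop]
      fun N : ℕ => (N : ℝ) ^ (τ + 1) := by
    refine Asymptotics.IsBigO.of_bound 1 (Eventually.of_forall fun N => ?_)
    rw [Real.norm_of_nonneg (by positivity), Real.norm_of_nonneg (by positivity), one_mul]
    rcases Nat.eq_zero_or_pos N with rfl | hN
    · simp [Real.zero_rpow (by linarith : τ + 1 ≠ 0)]
    have hN0 : (0 : ℝ) < N := by exact_mod_cast hN
    calc ∑ n ∈ range N, ((n + 1 : ℕ) : ℝ) ^ τ ≤ ∑ n ∈ range N, (N : ℝ) ^ τ := by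
          refine sum_le_sum fun n hn => ?_
          have : ((n + 1 : ℕ) : ℝ) ≤ N := by exact_mod_cast mem_range.1 hn
          gcongr
      _ = (N : ℝ) ^ (τ + 1) := by rw [sum_const, card_range, Real.rpow_add_one hN0.ne', nsmul_eq_mul]; ring
  have h4 : (fun N : ℕ => ∑ n ∈ Icc 1 N, (((n : ℝ) ^ τ : ℝ) : ℂ) * u n) =o[atTop]
      fun N : ℕ => (((N : ℝ) ^ (τ + 1) : ℝ) : ℂ) := by
    have h5 : (fun N : ℕ => (N : ℝ) ^ (τ + 1)) =O[atTop]
        fun N : ℕ => (((N : ℝ) ^ (τ + 1) : ℝ) : ℂ) :=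
      Asymptotics.IsBigO.of_bound 1 (Eventually.of_forall fun N => by
        rw [Complex.norm_real, one_mul])
    refine ((h2.trans_isBigO h3).trans_isBigO h5).congr_left fun N => ?_
    rw [sum_Icc_one_eq_sum_range]
  exact h4.tendsto_div_nhds_zero

end Averages

section SingularIntegral

lemma singInt_eq {k s : ℕ} (hk : 2 ≤ k) (hs : 2 * rr k + 1 ≤ s) :
    singInt s k = ((Real.Gamma (1 + 1 / (k : ℝ)) ^ s / Real.Gamma ((s : ℝ) / k) : ℝ) : ℂ) := by
  have hkR : (0 : ℝ) < k := by exact_mod_cast (by omega : 0 < k)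
  have hks : k + 1 ≤ s := by
    have h1 := two_mul_rr k
    nlinarith
  have hσ : 1 ≤ (s : ℝ) / k := by
    rw [le_div_iff₀ hkR, one_mul]; exact_mod_cast (by omega : k ≤ s)
  have hτ : 0 ≤ (s : ℝ) / k - 1 := by linarith
  have hpow : Tendsto (fun M : ℕ => M ^ k) atTop atTop := tendsto_pow_atTop (by omega)
  have h1 := (((tendsto_sum_singSeries (summable_gmaj hk hs) hτ).const_mul (singInt s k)).add
    (tendsto_sum_rpow_mul_of_tendsto_zero hτ (tendsto_Rcount_div_rpow_sub hk hs))).comp hpow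
  have h2 := (Complex.continuous_ofReal.tendsto _).comp
    (tendsto_sum_Rcount (s := s) (k := k) (by omega) (by omega))
  rw [sub_add_cancel, add_zero] at h1
  have h3 := tendsto_nhds_unique (h1.congr fun M => ?_) h2
  · have hG : 0 < Real.Gamma ((s : ℝ) / k) := Real.Gamma_pos_of_pos (by linarith)
    have hσC : (((s : ℝ) / k : ℝ) : ℂ) ≠ 0 := by exact_mod_cast (by linarith : (s : ℝ) / k ≠ 0)
    rw [Real.Gamma_add_one (by linarith), one_div, Complex.ofReal_inv, ← div_eq_mul_inv,
      div_eq_iff hσC] at h3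
    rw [h3, ← Complex.ofReal_mul]
    congr 1
    have hs0 : (s : ℝ) ≠ 0 := by exact_mod_cast (by omega : s ≠ 0)
    field_simp
  · simp only [Function.comp_apply]
    have hN : (((M ^ k : ℕ) : ℝ) ^ ((s : ℝ) / k)) = (M : ℝ) ^ s := by
      rw [Nat.cast_pow, ← Real.rpow_natCast (M : ℝ) k, ← Real.rpow_mul (by positivity),
        mul_div_cancel₀ _ hkR.ne', Real.rpow_natCast]
    rw [hN, Complex.ofReal_div, ← mul_div_assoc, ← add_div]
    congr 1
    rw [mul_sum, ← sum_add_distrib]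
    push_cast
    refine sum_congr rfl fun n hn => ?_
    have hn0 : (0 : ℝ) < n := by exact_mod_cast (mem_Icc.1 hn).1
    have hpC : (((n : ℝ) ^ ((s : ℝ) / k - 1) : ℝ) : ℂ) ≠ 0 := by
      exact_mod_cast (Real.rpow_pos_of_pos hn0 _).ne'
    rw [mul_sub, mul_div_cancel₀ _ hpC]
    ring

/-- The asymptotic formula in Waring's problem holds with `k² + k + 1` variables. -/
theorem asympFormula_of_le {k s : ℕ} (hk : 2 ≤ k) (hs : 2 * rr k + 1 ≤ s) : AsympFormula s k := by
  have h := tendsto_Rcount_div_rpow_sub hk hs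
  rw [singInt_eq hk hs] at h
  have h1 := (Asymptotics.isLittleO_one_iff ℝ).2 h
  unfold AsympFormula
  have h3 : (fun n : ℕ => (((n : ℝ) ^ ((s : ℝ) / k - 1) : ℝ) : ℂ)) =O[atTop]
      fun n : ℕ => (n : ℝ) ^ ((s : ℝ) / k - 1) :=
    Asymptotics.IsBigO.of_norm_le fun n => by
      rw [Complex.norm_real, Real.norm_of_nonneg (by positivity)]
  have h4 := h3.mul_isLittleO h1
  simp only [mul_one] at h4
  refine h4.congr' ?_ (EventuallyEq.refl _ _)
  filter_upwards [eventually_ge_atTop 1] with n hn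
  have hn0 : (0 : ℝ) < n := by exact_mod_cast hn
  have hpC : (((n : ℝ) ^ ((s : ℝ) / k - 1) : ℝ) : ℂ) ≠ 0 := by
    exact_mod_cast (Real.rpow_pos_of_pos hn0 _).ne'
  rw [mul_sub, mul_div_cancel₀ _ hpC]
  ring

lemma two_mul_rr_lt_of_le {k s : ℕ} (hk : 8 ≤ k)
    (h : 2 * (k : ℝ) ^ 2 - 2 ^ ((2 : ℝ) / 3) * (k : ℝ) ^ ((4 : ℝ) / 3) + 2 * (k : ℝ) ≤ (s : ℝ)) :
    2 * rr k + 1 ≤ s := by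
  have hkR : (8 : ℝ) ≤ k := by exact_mod_cast hk
  have hk0 : (0 : ℝ) < k := by linarith
  have h2 : (2 : ℝ) ^ ((2 : ℝ) / 3) ≤ (k : ℝ) ^ ((2 : ℝ) / 3) :=
    Real.rpow_le_rpow (by norm_num) (by linarith) (by norm_num)
  have h3 : (2 : ℝ) ^ ((2 : ℝ) / 3) * (k : ℝ) ^ ((4 : ℝ) / 3) ≤ (k : ℝ) ^ 2 := by
    calc (2 : ℝ) ^ ((2 : ℝ) / 3) * (k : ℝ) ^ ((4 : ℝ) / 3)
        ≤ (k : ℝ) ^ ((2 : ℝ) / 3) * (k : ℝ) ^ ((4 : ℝ) / 3) := by gcongr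
      _ = (k : ℝ) ^ 2 := by
          rw [← Real.rpow_add hk0, ← Real.rpow_natCast]; norm_num
  have h4 : (k : ℝ) ^ 2 + k + 1 ≤ s := by linarith
  have h5 : k ^ 2 + k + 1 ≤ s := by exact_mod_cast h4
  have h6 := two_mul_rr k
  nlinarith

end SingularIntegral

end Waring

/-- Corollary 9.4: G̃(k) ≤ 2k² - 2^{2/3} k^{4/3} + O(k); that is, there is a constant
C > 0 such that for all large k, the asymptotic formula holds whenever
s ≥ 2k² - 2^{2/3} k^{4/3} + C k. -/
theorem corollary9_4 :
    ∃ C : ℝ, 0 < C ∧ ∃ k₀ : ℕ, ∀ k : ℕ, k₀ ≤ k → ∀ s : ℕ,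
      2*(k:ℝ)^2 - 2 ^ ((2:ℝ)/3) * (k:ℝ) ^ ((4:ℝ)/3) + C*(k:ℝ) ≤ (s:ℝ) →
      AsympFormula s k := by
  exact ⟨2, two_pos, 8, fun k hk s hs =>
    Waring.asympFormula_of_le (by omega) (Waring.two_mul_rr_lt_of_le hk hs)⟩
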